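/- Assume r ≥ 1. Let W ⊆ ((Fin n) → ℝ) × ((Fin m) → ℝ) be open and let L be a smooth function on D^r_W that is variationally trivial: E_σ(L) = 0 on D^{2r}_W for every σ ∈ Fin m. Then every point of W has an open neighborhood W' ⊆ W for which there exist, for each 0 ≤ s ≤ n−1, alternating-symmetric families A^{I_1…I_s}_{σ_1…σ_s,i_{s+1}…i_{n−1}} (|I_l| = r−1) of smooth functions on D^{r−1}_{W'} such that L coincides with the associated Lagrangian L_A on D^r_{W'}. (Local structure theorem for variationally trivial Lagrangians: they are hyper-Jacobian polynomials in the highest-order derivatives.) -/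

import Mathlib

open scoped BigOperators

namespace JetVar

/-- Multi-indices on `Fin n` of degree at most `r`. -/
abbrev MD (n r : ℕ) : Type := {J : Fin n → ℕ // (∑ i, J i) ≤ r}

noncomputable instance (n r : ℕ) : Fintype (MD n r) :=
  Fintype.ofInjective
    (fun J : MD n r => fun i : Fin n =>
      (⟨J.1 i, Nat.lt_succ_of_le ((Finset.single_le_sum
        (fun j _ => Nat.zero_le (J.1 j)) (Finset.mem_univ i)).trans J.2)⟩ : Fin (r+1)))
    (fun _a _b h => Subtype.ext (funext fun i => congrArg Fin.val (congrFun h i)))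

/-- Index set for the `y` coordinates of the `r`-th order jet space. -/
abbrev JIdx (n m r : ℕ) : Type := Fin m × MD n r

/-- The `r`-th order jet coordinate space. -/
abbrev Jet (n m r : ℕ) : Type := ((Fin n) → ℝ) × (JIdx n m r → ℝ)

variable {n m : ℕ}

/-- The coordinate `x^i`. -/
def xc (i : Fin n) {r : ℕ} (p : Jet n m r) : ℝ := p.1 i

/-- The coordinate `y^σ_J` (with the convention that it is `0` for `|J| > r`). -/
def yc (σ : Fin m) (J : Fin n → ℕ) {r : ℕ} (p : Jet n m r) : ℝ :=
  if h : (∑ i, J i) ≤ r then p.2 (σ, ⟨J, h⟩) else 0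

/-- Partial derivative along the coordinate direction `x^i`. -/
noncomputable def pdX (i : Fin n) {r : ℕ} (f : Jet n m r → ℝ) (p : Jet n m r) : ℝ :=
  fderiv ℝ f p (Pi.single i 1, 0)

/-- Partial derivative along the coordinate direction `y^σ_J`
(by convention `0` for `|J| > r`). -/
noncomputable def pdY (σ : Fin m) (J : Fin n → ℕ) {r : ℕ} (f : Jet n m r → ℝ)
    (p : Jet n m r) : ℝ :=
  if h : (∑ i, J i) ≤ r then fderiv ℝ f p (0, Pi.single (σ, (⟨J, h⟩ : MD n r)) 1) else 0

/-- Projection `J^s → J^r` for `r ≤ s`, forgetting higher order coordinates. -/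
def projJet {r s : ℕ} (h : r ≤ s) (p : Jet n m s) : Jet n m r :=
  (p.1, fun q => p.2 (q.1, ⟨q.2.1, q.2.2.trans h⟩))

/-- `J + e_i`. -/
def addE (J : Fin n → ℕ) (i : Fin n) : Fin n → ℕ := fun j => J j + (if j = i then 1 else 0)

/-- `J - e_i` (truncated subtraction). -/
def subE (J : Fin n → ℕ) (i : Fin n) : Fin n → ℕ := fun j => J j - (if j = i then 1 else 0)

/-- The `i`-th formal (total) derivative of a function on `J^r`, a function on `J^{r+1}`. -/
noncomputable def formalD (i : Fin n) {r : ℕ} (f : Jet n m r → ℝ) (p : Jet n m (r+1)) : ℝ :=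
  pdX i f (projJet (Nat.le_succ r) p)
    + ∑ q : JIdx n m r, yc q.1 (addE q.2.1 i) p * pdY q.1 q.2.1 f (projJet (Nat.le_succ r) p)

/-- Iterated formal derivatives along a list of directions. -/
noncomputable def formalDL {r : ℕ} : (l : List (Fin n)) → (Jet n m r → ℝ) →
    (Jet n m (r + l.length) → ℝ)
  | [], f => f
  | i :: l, f => formalD i (formalDL l f)

/-- The canonical list of directions attached to a multi-index
(each `i` repeated `J i` times, in increasing order of `i`). -/
def mlist (J : Fin n → ℕ) : List (Fin n) :=
  (List.finRange n).flatMap (fun i => List.replicate (J i) i)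

lemma mlist_length (J : Fin n → ℕ) : (mlist J).length = ∑ i, J i := by
  rw [mlist, List.length_flatMap]
  simp only [Function.comp_def, List.length_replicate]
  rw [Fin.sum_univ_def]

/-- The iterated formal derivative `d_I`, applying each `d_i` exactly `I i` times
(in increasing order of `i`); a function on `J^{r+|I|}`. -/
noncomputable def formalDI (I : Fin n → ℕ) {r : ℕ} (f : Jet n m r → ℝ)
    (p : Jet n m (r + ∑ i, I i)) : ℝ :=
  formalDL (mlist I) f (projJet (le_of_eq (by rw [mlist_length])) p)

/-- The Lie–Euler expression `E^I_σ(L)` of a function `L` on `J^r`, a function on `J^{2r}`. -/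
noncomputable def LieEuler {r : ℕ} (σ : Fin m) (I : Fin n → ℕ) (L : Jet n m r → ℝ)
    (p : Jet n m (2*r)) : ℝ :=
  ∑ J : MD n r,
    if h : (∑ i, (I i + J.1 i)) ≤ r then
      (-1:ℝ)^(∑ i, J.1 i) * (∏ i, (Nat.choose (I i + J.1 i) (I i) : ℝ)) *
        formalDI J.1 (pdY σ (fun i => I i + J.1 i) L)
          (projJet (by have := J.2; omega) p)
    else 0

/-- The Euler–Lagrange expression `E_σ(L)`. -/
noncomputable def EL {r : ℕ} (σ : Fin m) (L : Jet n m r → ℝ) : Jet n m (2*r) → ℝ :=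
  LieEuler σ (fun _ => 0) L


/-- The sign of a tuple `(i_1,…,i_n)` as a permutation of `Fin n`
(`0` if two entries coincide). -/
noncomputable def epsSign {n : ℕ} (v : Fin n → Fin n) : ℝ :=
  if h : Function.Bijective v then ((Equiv.Perm.sign (Equiv.ofBijective v h) : ℤ) : ℝ) else 0

/-- The hyper-Jacobian `𝒥^{σ_1…σ_s, i_{s+1}…i_n}_{I_1…I_s}`, a function on `J^r`. -/
noncomputable def hyperJ {n m : ℕ} {r : ℕ} (s : ℕ) (hs : s ≤ n)
    (I : Fin s → (Fin n → ℕ)) (σs : Fin s → Fin m) (iv : Fin (n - s) → Fin n)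
    (p : Jet n m r) : ℝ :=
  ∑ w : Fin s → Fin n,
    epsSign (fun a : Fin n => Fin.append w iv (Fin.cast (by omega) a)) *
      ∏ l : Fin s, yc (σs l) (addE (I l) (w l)) p

/-- The truncated formal derivative `δ_i` on functions on `J^t`
(summing only over `|J| ≤ t − 1`). -/
noncomputable def truncD {n m : ℕ} {t : ℕ} (i : Fin n) (f : Jet n m t → ℝ)
    (p : Jet n m t) : ℝ :=
  pdX i f p + ∑ q : JIdx n m (t-1), yc q.1 (addE q.2.1 i) p * pdY q.1 q.2.1 f p

/-- Deleting the `k`-th entry of a tuple. -/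
def delTup {α : Type*} {s : ℕ} (k : Fin s) (f : Fin s → α) : Fin (s-1) → α :=
  fun j =>
    if h : (j : ℕ) < (k : ℕ) then f ⟨j, by have := j.isLt; omega⟩
    else f ⟨(j : ℕ) + 1, by have := j.isLt; omega⟩

/-- The type of families `A^{I_1…I_s}_{σ_1…σ_s, i_{s+1}…i_{n−1}}` of functions on
`J^{r−1}` (with `s` pairs and `n − s − 1` indices in `Fin n`). -/
def JetFam (n m r : ℕ) : Type :=
  (s : ℕ) → (Fin s → (Fin n → ℕ)) → (Fin s → Fin m) → (Fin (n - s - 1) → Fin n) →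
    Jet n m (r-1) → ℝ

/-- Alternating-symmetry of a family: any simultaneous permutation of the pairs and any
permutation of the `Fin n` indices multiplies it by the sign of the permutation. -/
def IsAltSym {n m r : ℕ} (A : JetFam n m r) : Prop :=
  ∀ (s : ℕ) (τ : Equiv.Perm (Fin s)) (ρ : Equiv.Perm (Fin (n - s - 1)))
    (I : Fin s → (Fin n → ℕ)) (σs : Fin s → Fin m) (iv : Fin (n - s - 1) → Fin n)
    (p : Jet n m (r-1)),
    A s (I ∘ τ) (σs ∘ τ) (iv ∘ ρ) p
      = ((Equiv.Perm.sign τ : ℤ) : ℝ) * ((Equiv.Perm.sign ρ : ℤ) : ℝ) * A s I σs iv p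

/-- The coefficients `ℒ^{I_1…I_s}_{σ_1…σ_s, i_{s+1}…i_n}` associated to a family `A`. -/
noncomputable def Lcoef {n m r : ℕ} (A : JetFam n m r) (s : ℕ)
    (I : Fin s → (Fin n → ℕ)) (σs : Fin s → Fin m) (iv : Fin (n - s) → Fin n)
    (p : Jet n m (r-1)) : ℝ :=
  (∑ k : Fin s, (-1:ℝ)^(k:ℕ) *
      pdY (σs k) (I k)
        (A (s-1) (delTup k I) (delTup k σs)
          (fun j : Fin (n - (s-1) - 1) =>
            iv (Fin.cast (by have := k.isLt; omega : n - (s-1) - 1 = n - s) j))) p)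
  + (∑ k : Fin (n - s), (-1:ℝ)^((s:ℕ) + (k:ℕ)) *
      truncD (iv k) (A s I σs (delTup k iv)) p)

/-- The type of coefficient families `C^{I_1…I_s}_{σ_1…σ_s, i_{s+1}…i_n}` of functions
on `J^{r−1}` (with `s` pairs and `n − s` indices in `Fin n`). -/
def CoefFam (n m r : ℕ) : Type :=
  (s : ℕ) → (Fin s → (Fin n → ℕ)) → (Fin s → Fin m) → (Fin (n - s) → Fin n) →
    Jet n m (r-1) → ℝ

/-- Alternating-symmetry for coefficient families. -/
def IsAltSymC {n m r : ℕ} (C : CoefFam n m r) : Prop :=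
  ∀ (s : ℕ) (τ : Equiv.Perm (Fin s)) (ρ : Equiv.Perm (Fin (n - s)))
    (I : Fin s → (Fin n → ℕ)) (σs : Fin s → Fin m) (iv : Fin (n - s) → Fin n)
    (p : Jet n m (r-1)),
    C s (I ∘ τ) (σs ∘ τ) (iv ∘ ρ) p
      = ((Equiv.Perm.sign τ : ℤ) : ℝ) * ((Equiv.Perm.sign ρ : ℤ) : ℝ) * C s I σs iv p

/-- The Lagrangian on `J^r` associated to a coefficient family, a hyper-Jacobian
polynomial in the highest-order derivatives. -/
noncomputable def LagC {n m r : ℕ} (C : CoefFam n m r) (p : Jet n m r) : ℝ :=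
  ∑ s : Fin (n+1),
    (((s:ℕ).factorial * (n - (s:ℕ)).factorial : ℕ) : ℝ)⁻¹ *
      ∑ I : Fin (s:ℕ) → MD n (r-1), ∑ σs : Fin (s:ℕ) → Fin m,
        ∑ iv : Fin (n - (s:ℕ)) → Fin n,
          (if ∀ l, (∑ i, (I l).1 i) = r - 1 then (1:ℝ) else 0) *
            C (s:ℕ) (fun l => (I l).1) σs iv (projJet (Nat.sub_le r 1) p) *
            hyperJ (s:ℕ) (by have := s.isLt; omega) (fun l => (I l).1) σs iv p

/-- The Lagrangian `L_A` associated to a family `A`. -/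
noncomputable def LagA {n m r : ℕ} (A : JetFam n m r) : Jet n m r → ℝ :=
  LagC (fun s I σs iv => Lcoef A s I σs iv)

/-- The open subset `D^t_W` of `J^t` lying over an open set `W` of the total space. -/
def Dset {n m : ℕ} (t : ℕ) (W : Set (((Fin n) → ℝ) × ((Fin m) → ℝ))) :
    Set (Jet n m t) :=
  {p | (p.1, fun σ => yc σ (fun _ => 0) p) ∈ W}

open scoped BigOperators
section Part1

namespace DL
open MvPolynomial

variable {t n : ℕ}

abbrev RR (t n : ℕ) : Type := MvPolynomial (Fin t × Fin n) ℝ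

noncomputable def EE (a b : Fin t) (T : RR t n) : RR t n :=
  ∑ x, X (a, x) * pderiv (b, x) T

noncomputable def NO : (l : ℕ) → (Fin l → Fin t) → (Fin l → Fin t) → RR t n → RR t n
  | 0, _, _, T => T
  | l + 1, a, b, T => ∑ x, X (a 0, x) * NO l (Fin.tail a) (Fin.tail b) (pderiv (b 0, x) T)

lemma NO_cons (l : ℕ) (a0 b0 : Fin t) (a b : Fin l → Fin t) (T : RR t n) :
    NO (l + 1) (Fin.cons a0 a : Fin (l+1) → Fin t) (Fin.cons b0 b : Fin (l+1) → Fin t) T =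
      ∑ x, X (a0, x) * NO l a b (pderiv (b0, x) T) := by
  simp [NO]

lemma NO_add (l : ℕ) (a b : Fin l → Fin t) (S T : RR t n) :
    NO l a b (S + T) = NO l a b S + NO l a b T := by
  induction l generalizing S T with
  | zero => rfl
  | succ l ih => simp [NO, ih, mul_add, Finset.sum_add_distrib]

lemma NO_smul (l : ℕ) (a b : Fin l → Fin t) (c : ℝ) (T : RR t n) :
    NO l a b (c • T) = c • NO l a b T := by
  induction l generalizing T with
  | zero => rfl
  | succ l ih => simp [NO, ih, Finset.smul_sum]

lemma NO_zero (l : ℕ) (a b : Fin l → Fin t) : NO l a b (0 : RR t n) = 0 := by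
  have := NO_smul l a b 0 (0 : RR t n)
  simpa using this

lemma NO_sum {ι : Type*} (s : Finset ι) (l : ℕ) (a b : Fin l → Fin t) (T : ι → RR t n) :
    NO l a b (∑ i ∈ s, T i) = ∑ i ∈ s, NO l a b (T i) := by
  classical
  induction s using Finset.induction_on with
  | empty => simp [NO_zero]
  | insert i s hi ih => rw [Finset.sum_insert hi, Finset.sum_insert hi, NO_add, ih]

lemma pderiv_comm' (i j : Fin t × Fin n) (T : RR t n) :
    pderiv i (pderiv j T) = pderiv j (pderiv i T) := by
  induction T using MvPolynomial.induction_on' with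
  | monomial u a =>
    by_cases h : i = j
    · subst h; rfl
    · rw [pderiv_monomial, pderiv_monomial, pderiv_monomial, pderiv_monomial]
      simp only [Finsupp.coe_tsub, Pi.sub_apply, Finsupp.single_apply, h, Ne.symm h, if_false,
        Nat.sub_zero]
      congr 1
      · rw [tsub_right_comm]
      · ring
  | add p q hp hq => simp [hp, hq]

lemma pderiv_X_mul (b c : Fin t) (x y : Fin n) (F : RR t n) :
    pderiv (b, x) (X (c, y) * F) =
      (if b = c then (if y = x then F else 0) else 0) + X (c, y) * pderiv (b, x) F := by
  rw [pderiv_mul, pderiv_X]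
  congr 1
  simp only [Pi.single_apply, Prod.mk.injEq]
  by_cases h : b = c <;> by_cases h' : y = x
  · simp [h, h']
  · simp [h, h']
  · simp [h, h', Ne.symm h]
  · simp [h, h']

lemma pderiv_EE (c d b : Fin t) (x : Fin n) (T : RR t n) :
    pderiv (b, x) (EE c d T) =
      (if b = c then pderiv (d, x) T else 0) + EE c d (pderiv (b, x) T) := by
  unfold EE
  rw [map_sum]
  simp only [pderiv_X_mul]
  rw [Finset.sum_add_distrib]
  refine congrArg₂ _ ?_ ?_
  · split_ifs with h
    · simp
    · simp
  · exact Finset.sum_congr rfl fun y _ => by rw [pderiv_comm']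

lemma EE_sum_X (c d a0 : Fin t) (F : Fin n → RR t n) :
    EE c d (∑ x, X (a0, x) * F x) =
      (if d = a0 then ∑ x, X (c, x) * F x else 0) + ∑ x, X (a0, x) * EE c d (F x) := by
  unfold EE
  simp only [map_sum, pderiv_X_mul, Finset.mul_sum]
  simp only [mul_add, Finset.sum_add_distrib]
  refine congrArg₂ _ ?_ ?_
  · split_ifs with h
    · simp
    · simp
  · rw [Finset.sum_comm]
    refine Finset.sum_congr rfl fun x _ => Finset.sum_congr rfl fun y _ => by ring

lemma EE_NO (l : ℕ) (a b : Fin l → Fin t) (c d : Fin t) (T : RR t n) :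
    EE c d (NO l a b T) =
      NO (l+1) (Fin.cons c a : Fin (l+1) → Fin t) (Fin.cons d b : Fin (l+1) → Fin t) T +
      ∑ j, if d = a j then NO l (Function.update a j c) b T else 0 := by
  induction l generalizing T with
  | zero => simp [NO, EE]
  | succ l ih =>
    rw [NO, EE_sum_X]
    simp only [ih]
    rw [NO_cons]
    simp only [mul_add, Finset.sum_add_distrib]
    rw [Fin.sum_univ_succ]
    have h1 : ∑ x, (X (a 0, x) : RR t n) * NO (l+1) (Fin.cons c (Fin.tail a) : Fin (l+1) → Fin t)
        (Fin.cons d (Fin.tail b) : Fin (l+1) → Fin t) (pderiv (b 0, x) T) =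
        ∑ x, X (c, x) * NO (l+1) a b (pderiv (d, x) T) := by
      simp only [NO_cons]
      simp only [NO, Finset.mul_sum]
      rw [Finset.sum_comm]
      refine Finset.sum_congr rfl fun x _ => Finset.sum_congr rfl fun y _ => ?_
      rw [pderiv_comm']
      ring
    have h2 : (∑ x, X (a 0, x) * ∑ j, if d = Fin.tail a j then
        NO l (Function.update (Fin.tail a) j c) (Fin.tail b) (pderiv (b 0, x) T) else 0) =
        ∑ j : Fin l, if d = a j.succ then NO (l+1) (Function.update a j.succ c) b T else 0 := by
      simp only [Finset.mul_sum]
      rw [Finset.sum_comm]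
      refine Finset.sum_congr rfl fun j _ => ?_
      by_cases h : d = a j.succ
      · simp only [Fin.tail, h, if_true]
        rw [NO]
        refine Finset.sum_congr rfl fun x _ => ?_
        rw [Function.update_of_ne (by exact (Fin.succ_ne_zero j).symm)]
        congr 2
        funext i
        simp only [Fin.tail, Function.update_apply, Fin.succ_inj]
      · simp [Fin.tail, h]
    have h3 : (if d = a 0 then ∑ x, X (c, x) * NO l (Fin.tail a) (Fin.tail b) (pderiv (b 0, x) T)
        else 0) = if d = a 0 then NO (l+1) (Function.update a 0 c) b T else 0 := by
      split_ifs with h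
      · rw [NO]
        simp
      · rfl
    rw [h1, h2, h3]
    ring

lemma NO_EE (l : ℕ) (a b : Fin l → Fin t) (c d : Fin t) (T : RR t n) :
    NO l a b (EE c d T) =
      NO (l+1) (Fin.cons c a : Fin (l+1) → Fin t) (Fin.cons d b : Fin (l+1) → Fin t) T +
      ∑ j, if b j = c then NO l a (Function.update b j d) T else 0 := by
  induction l generalizing T with
  | zero => simp [NO, EE]
  | succ l ih =>
    rw [NO]
    simp only [pderiv_EE, NO_add, ih]
    rw [NO_cons]
    simp only [mul_add, Finset.sum_add_distrib]
    rw [Fin.sum_univ_succ]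
    have h1 : ∑ x, (X (a 0, x) : RR t n) * NO (l+1) (Fin.cons c (Fin.tail a) : Fin (l+1) → Fin t)
        (Fin.cons d (Fin.tail b) : Fin (l+1) → Fin t) (pderiv (b 0, x) T) =
        ∑ x, X (c, x) * NO (l+1) a b (pderiv (d, x) T) := by
      simp only [NO_cons]
      simp only [NO, Finset.mul_sum]
      rw [Finset.sum_comm]
      refine Finset.sum_congr rfl fun x _ => Finset.sum_congr rfl fun y _ => ?_
      rw [pderiv_comm']
      ring
    have h2 : (∑ x, X (a 0, x) * ∑ j, if Fin.tail b j = c then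
        NO l (Fin.tail a) (Function.update (Fin.tail b) j d) (pderiv (b 0, x) T) else 0) =
        ∑ j : Fin l, if b j.succ = c then NO (l+1) a (Function.update b j.succ d) T else 0 := by
      simp only [Finset.mul_sum]
      rw [Finset.sum_comm]
      refine Finset.sum_congr rfl fun j _ => ?_
      by_cases h : b j.succ = c
      · simp only [Fin.tail, h, if_true]
        rw [NO]
        refine Finset.sum_congr rfl fun x _ => ?_
        rw [Function.update_of_ne (by exact (Fin.succ_ne_zero j).symm)]
        congr 2
        funext i
        simp only [Fin.tail, Function.update_apply, Fin.succ_inj]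
      · simp [Fin.tail, h]
    have h3 : (∑ x, X (a 0, x) * NO l (Fin.tail a) (Fin.tail b)
        (if b 0 = c then pderiv (d, x) T else 0))
         = if b 0 = c then NO (l+1) a (Function.update b 0 d) T else 0 := by
      split_ifs with h
      · rw [NO]
        simp
      · simp [NO_zero]
    rw [h1, h2, h3]
    ring

end DL
end Part1

open scoped BigOperators
section Part2

lemma sum_cons {α M : Type*} [Fintype α] [AddCommMonoid M] (l : ℕ) (f : (Fin (l+1) → α) → M) :
    ∑ w, f w = ∑ a, ∑ w : Fin l → α, f (Fin.cons a w : Fin (l+1) → α) := by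
  rw [← Fintype.sum_prod_type']
  exact (Fintype.sum_equiv (Fin.consEquiv fun _ : Fin (l+1) => α) _ _ (fun _ => rfl)).symm

namespace DL
open MvPolynomial

variable {t n : ℕ}

noncomputable def DV : (l : ℕ) → (Fin l → Fin t × Fin n) → RR t n → RR t n
  | 0, _, T => T
  | l + 1, v, T => DV l (Fin.tail v) (pderiv (v 0) T)

lemma DV_eq (l : ℕ) (v : Fin l → Fin t × Fin n) (T : RR t n) :
    DV l v T = (List.ofFn v).foldl (fun S i => pderiv i S) T := by
  induction l generalizing T with
  | zero => simp [DV]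
  | succ l ih => simp [DV, ih, List.ofFn_succ]; rfl

lemma DV_perm (l : ℕ) (v : Fin l → Fin t × Fin n) (τ : Equiv.Perm (Fin l)) (T : RR t n) :
    DV l (v ∘ τ) T = DV l v T := by
  rw [DV_eq, DV_eq]
  have : RightCommutative (fun (S : RR t n) (i : Fin t × Fin n) => pderiv i S) :=
    ⟨fun a b c => pderiv_comm' _ _ _⟩
  exact (Equiv.Perm.ofFn_comp_perm τ v).foldl_eq _

lemma NO_eq_DV (l : ℕ) (a b : Fin l → Fin t) (T : RR t n) :
    NO l a b T = ∑ x : Fin l → Fin n, (∏ j, X (a j, x j)) * DV l (fun j => (b j, x j)) T := by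
  induction l generalizing T with
  | zero => simp [NO, DV]
  | succ l ih =>
    rw [NO, sum_cons]
    refine Finset.sum_congr rfl fun x _ => ?_
    rw [ih, Finset.mul_sum]
    refine Finset.sum_congr rfl fun w _ => ?_
    rw [Fin.prod_univ_succ, DV, mul_assoc]
    simp only [Fin.cons_zero, Fin.cons_succ]
    rfl

/-- Sign of a permutation in `ℝ`. -/
def sg {l : ℕ} (π : Equiv.Perm (Fin l)) : ℝ := ((Equiv.Perm.sign π : ℤ) : ℝ)

lemma sg_mul {l : ℕ} (π τ : Equiv.Perm (Fin l)) : sg (π * τ) = sg π * sg τ := by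
  simp [sg]

lemma sg_inv {l : ℕ} (π : Equiv.Perm (Fin l)) : sg π⁻¹ = sg π := by
  simp [sg]

lemma sg_sq {l : ℕ} (π : Equiv.Perm (Fin l)) : sg π * sg π = 1 := by
  rw [sg]; norm_cast; simp

lemma sg_one {l : ℕ} : sg (1 : Equiv.Perm (Fin l)) = 1 := by simp [sg]

/-- The module of alternating combinations. -/
def II (t n : ℕ) : Submodule ℝ (RR t n) where
  carrier := {T | ∃ C : (Fin t → Fin n) → RR t n,
    (∀ w (τ : Equiv.Perm (Fin t)), C (w ∘ τ) = sg τ • C w) ∧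
    T = ∑ w, (∏ j, X (j, w j)) * C w}
  add_mem' := by
    rintro S T ⟨C, hC, rfl⟩ ⟨D, hD, rfl⟩
    refine ⟨C + D, fun w τ => by simp [hC, hD], ?_⟩
    simp [mul_add, Finset.sum_add_distrib]
  zero_mem' := ⟨0, by simp, by simp⟩
  smul_mem' := by
    rintro c T ⟨C, hC, rfl⟩
    refine ⟨c • C, fun w τ => by rw [Pi.smul_apply, Pi.smul_apply, hC, smul_comm], ?_⟩
    simp [Finset.smul_sum]

noncomputable def QQ (l : ℕ) (ρ : Fin l → Fin t) (T : RR t n) : RR t n :=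
  ∑ π : Equiv.Perm (Fin l), sg π • NO l ρ (ρ ∘ π) T

lemma QQ_id_mem (T : RR t n) : QQ t id T ∈ II t n := by
  refine ⟨fun w => ∑ π : Equiv.Perm (Fin t), sg π • DV t (fun j => (π j, w j)) T, ?_, ?_⟩
  · intro w τ
    refine (Equiv.sum_comp (Equiv.mulRight τ) _).symm.trans ?_
    rw [Finset.smul_sum]
    refine Finset.sum_congr rfl fun π _ => ?_
    rw [smul_smul, Equiv.coe_mulRight, sg_mul, mul_comm]
    congr 1
    exact DV_perm t (fun j => (π j, w j)) τ T
  · rw [QQ]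
    simp only [NO_eq_DV, Finset.smul_sum, Finset.mul_sum]
    rw [Finset.sum_comm]
    refine Finset.sum_congr rfl fun w _ => Finset.sum_congr rfl fun π _ => ?_
    simp

lemma EE_add (a b : Fin t) (S T : RR t n) : EE a b (S + T) = EE a b S + EE a b T := by
  simp [EE, mul_add, Finset.sum_add_distrib]

lemma EE_smul (a b : Fin t) (c : ℝ) (T : RR t n) : EE a b (c • T) = c • EE a b T := by
  simp [EE, Finset.smul_sum]

lemma EE_sum {ι : Type*} (s : Finset ι) (a b : Fin t) (T : ι → RR t n) :
    EE a b (∑ i ∈ s, T i) = ∑ i ∈ s, EE a b (T i) := by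
  simp only [EE, map_sum, Finset.mul_sum]
  rw [Finset.sum_comm]

lemma EE_mul (a b : Fin t) (S T : RR t n) : EE a b (S * T) = EE a b S * T + S * EE a b T := by
  simp only [EE, pderiv_mul, mul_add, Finset.sum_add_distrib, Finset.sum_mul, Finset.mul_sum]
  congr 1
  · exact Finset.sum_congr rfl fun _ _ => by ring
  · exact Finset.sum_congr rfl fun _ _ => by ring

lemma EE_X (a b c : Fin t) (x : Fin n) :
    EE a b (X (c, x) : RR t n) = if b = c then X (a, x) else 0 := by
  have := EE_sum_X a b c (fun y => if y = x then (1 : RR t n) else 0)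
  simp only [mul_ite, mul_one, mul_zero, Finset.sum_ite_eq', Finset.mem_univ, if_true] at this
  rw [this]
  conv_rhs => rw [← add_zero (ite _ _ _)]
  congr 1
  apply Finset.sum_eq_zero
  intro y _
  split_ifs <;> simp [EE]

lemma EE_prod (a b : Fin t) (w : Fin t → Fin n) :
    EE a b (∏ j, (X (j, w j) : RR t n)) =
      X (a, w b) * ∏ j ∈ Finset.univ.erase b, X (j, w j) := by
  rw [← Finset.mul_prod_erase _ _ (Finset.mem_univ b), EE_mul, EE_X, if_pos rfl]
  have : ∀ s : Finset (Fin t), b ∉ s → EE a b (∏ j ∈ s, (X (j, w j) : RR t n)) = 0 := by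
    intro s
    induction s using Finset.induction_on with
    | empty => intro _; simp [EE]
    | insert i s hi ih =>
      intro hb
      rw [Finset.prod_insert hi, EE_mul, ih (fun h => hb (Finset.mem_insert_of_mem h)), EE_X,
        if_neg (fun h : b = i => hb (by rw [h]; exact Finset.mem_insert_self _ _))]
      simp
  rw [this _ (Finset.notMem_erase _ _)]
  simp

lemma EE_mem (a b : Fin t) (T : RR t n) (hT : T ∈ II t n) : EE a b T ∈ II t n := by
  obtain ⟨C, hC, rfl⟩ := hT
  rw [EE_sum]
  simp only [EE_mul, Finset.sum_add_distrib]
  refine Submodule.add_mem _ ?_ ⟨fun w => EE a b (C w), fun w τ => by simp only [hC, EE_smul], rfl⟩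
  by_cases hab : a = b
  · subst hab
    refine ⟨C, hC, Finset.sum_congr rfl fun w _ => ?_⟩
    rw [EE_prod, Finset.mul_prod_erase _ (fun j => (X (j, w j) : RR t n)) (Finset.mem_univ a)]
  · have : ∑ w, EE a b (∏ j, (X (j, w j) : RR t n)) * C w = 0 := by
      set S := ∑ w, EE a b (∏ j, (X (j, w j) : RR t n)) * C w with hS
      have h : S = - S := by
        conv_lhs => rw [hS, ← Equiv.sum_comp (Equiv.arrowCongr (Equiv.swap a b) (Equiv.refl _))]
        rw [hS, ← Finset.sum_neg_distrib]
        refine Finset.sum_congr rfl fun w _ => ?_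
        have e1 : (Equiv.arrowCongr (Equiv.swap a b) (Equiv.refl (Fin n))) w
            = w ∘ Equiv.swap a b := by
          funext j; simp [Equiv.arrowCongr]
        rw [e1, hC, EE_prod, EE_prod]
        have e2 : sg (Equiv.swap a b) = -1 := by simp [sg, Equiv.Perm.sign_swap hab]
        have hmem : a ∈ Finset.univ.erase b := by simp [hab]
        rw [← Finset.mul_prod_erase _ _ hmem, ← Finset.mul_prod_erase _ _ hmem, e2]
        have e3 : ∏ j ∈ (Finset.univ.erase b).erase a,
            (X (j, (w ∘ Equiv.swap a b) j) : RR t n) =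
            ∏ j ∈ (Finset.univ.erase b).erase a, X (j, w j) := by
          refine Finset.prod_congr rfl fun j hj => ?_
          simp only [Finset.mem_erase] at hj
          simp [Equiv.swap_apply_of_ne_of_ne hj.1 hj.2.1]
        rw [e3]
        simp only [Function.comp, Equiv.swap_apply_left, Equiv.swap_apply_right, neg_smul, one_smul]
        ring
      have h2 : (2:ℝ) • S = 0 := by rw [two_smul]; nth_rewrite 1 [h]; simp
      simpa using h2
    rw [this]
    exact Submodule.zero_mem _

lemma NO_mem (l : ℕ) (a b : Fin l → Fin t) (T : RR t n) (hT : T ∈ II t n) :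
    NO l a b T ∈ II t n := by
  induction l with
  | zero => exact hT
  | succ l ih =>
    have h := EE_NO l (Fin.tail a) (Fin.tail b) (a 0) (b 0) T
    rw [Fin.cons_self_tail, Fin.cons_self_tail] at h
    rw [← sub_eq_iff_eq_add] at h
    rw [← h]
    refine Submodule.sub_mem _ (EE_mem _ _ _ (ih _ _)) (Submodule.sum_mem _ fun j _ => ?_)
    split_ifs
    · exact ih _ _
    · exact Submodule.zero_mem _

lemma QQ_succ (l : ℕ) (ρ : Fin (l+1) → Fin t) (hρ : Function.Injective ρ) (k : ℝ) (T : RR t n)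
    (hk : EE (ρ 0) (ρ 0) T = k • T)
    (hI : ∀ q : Fin l, EE (ρ 0) (ρ q.succ) T ∈ II t n) :
    QQ (l+1) ρ T - (k + l) • QQ l (Fin.tail ρ) T ∈ II t n := by
  have hsum : QQ (l+1) ρ T = ∑ p : Fin (l+1), ∑ e : Equiv.Perm (Fin l),
      sg (Equiv.Perm.decomposeFin.symm (p, e)) •
        NO (l+1) ρ (ρ ∘ Equiv.Perm.decomposeFin.symm (p, e)) T := by
    rw [QQ, ← Equiv.sum_comp Equiv.Perm.decomposeFin.symm, Fintype.sum_prod_type]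
  have hcons : (Fin.cons (ρ 0) (Fin.tail ρ) : Fin (l+1) → Fin t) = ρ := Fin.cons_self_tail ρ
  have h0 : ∀ e : Equiv.Perm (Fin l), sg (Equiv.Perm.decomposeFin.symm (0, e)) •
        NO (l+1) ρ (ρ ∘ Equiv.Perm.decomposeFin.symm (0, e)) T =
        k • (sg e • NO l (Fin.tail ρ) (Fin.tail ρ ∘ e) T) := by
    intro e
    have h := NO_EE l (Fin.tail ρ) (Fin.tail ρ ∘ e) (ρ 0) (ρ 0) T
    rw [hk, NO_smul, hcons] at h
    have e1 : (Fin.cons (ρ 0) (Fin.tail ρ ∘ e) : Fin (l+1) → Fin t) =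
        ρ ∘ Equiv.Perm.decomposeFin.symm (0, e) := by
      funext j
      refine Fin.cases ?_ (fun j => ?_) j
      · simp
      · simp [Fin.tail]
    have e2 : (∑ j, if (Fin.tail ρ ∘ e) j = ρ 0 then
        NO l (Fin.tail ρ) (Function.update (Fin.tail ρ ∘ e) j (ρ 0)) T else 0) = 0 := by
      refine Finset.sum_eq_zero fun j _ => ?_
      rw [if_neg]
      intro hh
      exact Fin.succ_ne_zero _ (hρ hh)
    rw [e1, e2, add_zero] at h
    rw [← h, smul_comm]
    congr 1
    simp [sg, Equiv.Perm.decomposeFin.symm_sign]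
  have h1 : ∀ (q : Fin l) (e : Equiv.Perm (Fin l)),
      sg (Equiv.Perm.decomposeFin.symm (q.succ, e)) •
        NO (l+1) ρ (ρ ∘ Equiv.Perm.decomposeFin.symm (q.succ, e)) T =
        sg e • NO l (Fin.tail ρ) (Fin.tail ρ ∘ e) T -
        sg e • NO l (Fin.tail ρ) (Function.update (Fin.tail ρ ∘ e) (e.symm q) (ρ 0))
          (EE (ρ 0) (ρ q.succ) T) := by
    intro q e
    set b' := Function.update (Fin.tail ρ ∘ e) (e.symm q) (ρ 0) with hb'
    have h := NO_EE l (Fin.tail ρ) b' (ρ 0) (ρ q.succ) T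
    rw [hcons] at h
    have e1 : (Fin.cons (ρ q.succ) b' : Fin (l+1) → Fin t) =
        ρ ∘ Equiv.Perm.decomposeFin.symm (q.succ, e) := by
      funext j
      refine Fin.cases ?_ (fun j => ?_) j
      · simp
      · simp only [Fin.cons_succ, hb', Function.comp, Equiv.Perm.decomposeFin_symm_apply_succ]
        by_cases hj : j = e.symm q
        · subst hj
          simp
        · rw [Function.update_of_ne hj, Equiv.swap_apply_of_ne_of_ne (Fin.succ_ne_zero _)]
          · rfl
          · intro hh
            exact hj (by rw [← Fin.succ_injective _ hh]; simp)
    have e2 : (∑ j, if b' j = ρ 0 then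
        NO l (Fin.tail ρ) (Function.update b' j (ρ q.succ)) T else 0) =
        NO l (Fin.tail ρ) (Fin.tail ρ ∘ e) T := by
      rw [Finset.sum_eq_single (e.symm q)]
      · rw [if_pos (by simp [hb'])]
        congr 1
        rw [hb', Function.update_idem]
        conv_rhs => rw [← Function.update_eq_self (e.symm q) (Fin.tail ρ ∘ e)]
        simp [Fin.tail]
      · intro j _ hj
        rw [if_neg]
        rw [hb', Function.update_of_ne hj]
        intro hh
        exact Fin.succ_ne_zero _ (hρ hh)
      · simp
    rw [e1, e2] at h
    rw [h]
    have e3 : sg (Equiv.Perm.decomposeFin.symm (q.succ, e)) = - sg e := by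
      simp [sg, Equiv.Perm.decomposeFin.symm_sign, Fin.succ_ne_zero]
    rw [e3, smul_add, neg_smul]
    abel
  rw [hsum, Fin.sum_univ_succ]
  simp only [h0, h1, Finset.sum_sub_distrib, ← Finset.smul_sum]
  have : (∑ e : Equiv.Perm (Fin l), sg e • NO l (Fin.tail ρ) (Fin.tail ρ ∘ e) T)
      = QQ l (Fin.tail ρ) T := rfl
  rw [this]
  simp only [Finset.sum_const, Finset.card_univ, Fintype.card_fin]
  have e4 : ∀ A : RR t n, k • QQ l (Fin.tail ρ) T + (l • QQ l (Fin.tail ρ) T - A) -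
      (k + (l:ℝ)) • QQ l (Fin.tail ρ) T = - A := by
    intro A
    rw [add_smul, Nat.cast_smul_eq_nsmul]
    abel
  rw [e4]
  refine Submodule.neg_mem _ (Submodule.sum_mem _ fun q _ => Submodule.sum_mem _ fun e _ => ?_)
  exact Submodule.smul_mem _ _ (NO_mem _ _ _ _ (hI q))

lemma QQ_strictMono (k : Fin t → ℕ) (T : RR t n)
    (hk : ∀ j, EE j j T = (k j : ℝ) • T) (hpos : ∀ j, 0 < k j)
    (hI : ∀ a b : Fin t, a < b → EE a b T ∈ II t n) (l : ℕ) (ρ : Fin l → Fin t)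
    (hρ : StrictMono ρ) : ∃ c : ℝ, 0 < c ∧ QQ l ρ T - c • T ∈ II t n := by
  induction l with
  | zero =>
    refine ⟨1, one_pos, ?_⟩
    simp [QQ, NO, sg]
  | succ l ih =>
    obtain ⟨c, hc, h⟩ := ih (Fin.tail ρ) (fun i j hij => hρ (Fin.succ_lt_succ_iff.mpr hij))
    have hp := hpos (ρ 0)
    have h2 := QQ_succ l ρ hρ.injective (k (ρ 0)) T (hk _)
      (fun q => hI _ _ (hρ (Fin.succ_pos q)))
    have hpr : (0:ℝ) < k (ρ 0) := by exact_mod_cast hp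
    refine ⟨(k (ρ 0) + l) * c, by positivity, ?_⟩
    have := Submodule.add_mem _ h2 (Submodule.smul_mem _ ((k (ρ 0) : ℝ) + l) h)
    rw [smul_sub, smul_smul, sub_add_sub_cancel] at this
    exact this

end DL
end Part2

open scoped BigOperators
section Part3
namespace DL
open MvPolynomial

variable {t n : ℕ}

def Van (T : RR t n) : Prop :=
  ∀ (ξ : Fin t → Fin n → ℝ) (c : Fin t → ℝ), c ≠ 0 → (∀ x, ∑ j, c j * ξ j x = 0) →
    eval (fun p : Fin t × Fin n => ξ p.1 p.2) T = 0

lemma hasDerivAt_eval (ξ η : Fin t × Fin n → ℝ) (T : RR t n) :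
    HasDerivAt (fun ε : ℝ => eval (fun p => ξ p + ε * η p) T)
      (∑ p, η p * eval ξ (pderiv p T)) 0 := by
  induction T using MvPolynomial.induction_on with
  | C a => simpa using hasDerivAt_const (0:ℝ) a
  | add p q hp hq =>
    simp only [map_add, mul_add, Finset.sum_add_distrib]
    exact hp.add hq
  | mul_X p i hp =>
    have h1 : HasDerivAt (fun ε : ℝ => ξ i + ε * η i) (η i) 0 := by
      simpa using ((hasDerivAt_id (0:ℝ)).mul_const (η i)).const_add (ξ i)
    have h2 := hp.mul h1
    have e : (fun ε : ℝ => eval (fun p => ξ p + ε * η p) (p * X i)) =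
        (fun ε : ℝ => eval (fun p => ξ p + ε * η p) p) * (fun ε : ℝ => ξ i + ε * η i) := by
      funext ε
      simp
    rw [e]
    refine h2.congr_deriv (Eq.symm ?_)
    simp only [zero_mul, add_zero, pderiv_mul, pderiv_X, map_add, map_mul, eval_X, mul_add,
      Finset.sum_add_distrib, Finset.sum_mul]
    congr 1
    · exact Finset.sum_congr rfl fun _ _ => by ring
    · rw [Finset.sum_eq_single i]
      · simp; ring
      · intro j _ hj
        simp [hj.symm]
      · simp

lemma Van_EE (a b : Fin t) (hab : a ≠ b) (T : RR t n) (hT : Van T) : Van (EE a b T) := by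
  intro ξ c hc h
  have hd := hasDerivAt_eval (fun p : Fin t × Fin n => ξ p.1 p.2)
    (fun p => if p.1 = b then ξ a p.2 else 0) T
  have hz : ∀ ε : ℝ, eval (fun p : Fin t × Fin n =>
      ξ p.1 p.2 + ε * (if p.1 = b then ξ a p.2 else 0)) T = 0 := by
    intro ε
    refine hT (fun j x => ξ j x + ε * (if j = b then ξ a x else 0))
      (fun j => c j - if j = a then ε * c b else 0) ?_ ?_
    · intro h0
      apply hc
      funext j
      have hb : c b = 0 := by
        have := congrFun h0 b
        simpa [Ne.symm hab] using this
      have := congrFun h0 j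
      simpa [hb] using this
    · intro x
      have e : ∀ j, (c j - if j = a then ε * c b else 0) *
          (ξ j x + ε * (if j = b then ξ a x else 0)) =
          c j * ξ j x + ((if j = b then ε * c b * ξ a x else 0)
            - (if j = a then ε * c b * ξ a x else 0)) := by
        intro j
        by_cases h1 : j = a
        · subst h1
          simp [hab]; ring
        · by_cases h2 : j = b
          · subst h2; simp [h1]; ring
          · simp [h1, h2]
      rw [Finset.sum_congr rfl fun j _ => e j]
      rw [Finset.sum_add_distrib, h, Finset.sum_sub_distrib]
      simp
  have h0 := hd.unique (by simp only [hz]; exact hasDerivAt_const 0 0)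
  rw [← h0, EE, map_sum]
  rw [Fintype.sum_prod_type, Finset.sum_eq_single b]
  · simp
  · intro j _ hj; simp [hj]
  · simp

lemma EE_comm (a b c d : Fin t) (T : RR t n) :
    EE c d (EE a b T) = EE a b (EE c d T) + (if d = a then EE c b T else 0)
      - (if b = c then EE a d T else 0) := by
  have h1 : EE c d (EE a b T) = (if d = a then EE c b T else 0)
      + ∑ x, X (c, x) * EE a b (pderiv (d, x) T) := by
    rw [EE.eq_def c d]
    simp only [pderiv_EE, mul_add, Finset.sum_add_distrib]
    congr 1
    split_ifs
    · rfl
    · simp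
  have h2 : EE a b (EE c d T) = (if b = c then EE a d T else 0)
      + ∑ x, X (c, x) * EE a b (pderiv (d, x) T) := by
    conv_lhs => rw [EE.eq_def c d]
    rw [EE_sum_X]
    rfl
  rw [h1, h2]
  abel

lemma coeff_EE_self (j : Fin t) (T : RR t n) (M : Fin t × Fin n →₀ ℕ) :
    coeff M (EE j j T) = (∑ x, (M (j, x) : ℝ)) * coeff M T := by
  induction T using MvPolynomial.induction_on' with
  | monomial u a =>
    simp only [EE, X_mul_pderiv_monomial, coeff_sum, coeff_monomial, coeff_smul]
    split_ifs with h
    · subst h; simp [Finset.sum_mul]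
    · simp
  | add p q hp hq => rw [EE_add, coeff_add, coeff_add, hp, hq]; ring

lemma EE_self_iff (j : Fin t) (T : RR t n) (k : ℕ) :
    EE j j T = (k : ℝ) • T ↔ ∀ M, coeff M T ≠ 0 → ∑ x, M (j, x) = k := by
  constructor
  · intro h M hM
    have := coeff_EE_self j T M
    rw [h, coeff_smul, smul_eq_mul] at this
    have := mul_right_cancel₀ hM this
    exact_mod_cast this.symm
  · intro h
    ext M
    rw [coeff_EE_self, coeff_smul, smul_eq_mul]
    by_cases hM : coeff M T = 0
    · simp [hM]
    · rw [← h M hM]; push_cast; ring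

lemma Van_zero (b : Fin t) (T : RR t n) (hT : Van T) (hk : EE b b T = ((0:ℕ):ℝ) • T) :
    T = 0 := by
  apply MvPolynomial.funext
  intro ξ
  have h := hT (fun j x => if j = b then 0 else ξ (j, x)) (Pi.single b 1)
    (by intro h; simpa using congrFun h b) (by
      intro x
      apply Finset.sum_eq_zero
      intro j _
      by_cases hj : j = b <;> simp [hj])
  rw [map_zero, ← h, eval_eq', eval_eq']
  refine Finset.sum_congr rfl fun M hM => ?_
  congr 1
  refine Finset.prod_congr rfl fun p _ => ?_
  obtain ⟨j, x⟩ := p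
  by_cases hj : j = b
  · subst hj
    have := (EE_self_iff j T 0).1 hk M (by simpa [mem_support_iff] using hM)
    have := (Finset.sum_eq_zero_iff.1 this) x (Finset.mem_univ _)
    simp [this]
  · simp [hj]

theorem DL_main (N : ℕ) : ∀ (k : Fin t → ℕ) (T : RR t n), (∑ j : Fin t, (j:ℕ) * k j = N) →
    (∀ j, EE j j T = (k j : ℝ) • T) → Van T → T ∈ II t n := by
  induction N using Nat.strong_induction_on with
  | _ N ih =>
    intro k T hN hk hV
    by_cases hpos : ∀ j, 0 < k j
    swap
    · push Not at hpos
      obtain ⟨b, hb⟩ := hpos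
      have hb0 : k b = 0 := by omega
      rw [Van_zero b T hV (by rw [hk, hb0])]
      exact Submodule.zero_mem _
    have hI : ∀ a b : Fin t, a < b → EE a b T ∈ II t n := by
      intro a b hab
      have hne : a ≠ b := hab.ne
      have hpb := hpos b
      set k' : Fin t → ℕ := fun j => if j = a then k a + 1 else if j = b then k b - 1 else k j
        with hk'
      have hval : (∑ j : Fin t, (j:ℕ) * k' j) + b = (∑ j : Fin t, (j:ℕ) * k j) + a := by
        have : ∀ j : Fin t, (j:ℕ) * k' j + (if j = b then (b:ℕ) else 0)
            = (j:ℕ) * k j + (if j = a then (a:ℕ) else 0) := by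
          intro j
          simp only [hk']
          by_cases h1 : j = a
          · subst h1; simp [hne]; ring
          · by_cases h2 : j = b
            · subst h2; simp only [h1, if_true, if_false]
              obtain ⟨q, hq⟩ := Nat.exists_eq_succ_of_ne_zero hpb.ne'
              rw [hq]; simp; ring
            · simp [h1, h2]
        have h2 := Finset.sum_congr rfl fun j (_ : j ∈ (Finset.univ : Finset (Fin t))) => this j
        simpa [Finset.sum_add_distrib] using h2
      refine ih (∑ j : Fin t, (j:ℕ) * k' j) ?_ k' _ rfl ?_ (Van_EE a b hne T hV)
      · have : (a:ℕ) < b := hab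
        omega
      · intro j
        rw [EE_comm, hk, EE_smul]
        simp only [hk']
        by_cases h1 : j = a
        · subst h1
          simp [hne.symm, add_smul]
        · by_cases h2 : j = b
          · subst h2
            have h3 : ((k j - 1 : ℕ) : ℝ) = (k j : ℝ) - 1 := by
              rw [Nat.cast_sub hpb]; simp
            simp [h1, h3, sub_smul]
          · simp [h1, h2, Ne.symm h2]
    obtain ⟨c, hc, h⟩ := QQ_strictMono k T hk hpos hI t id strictMono_id
    have h2 := Submodule.sub_mem _ (QQ_id_mem T) h
    rw [sub_sub_cancel] at h2
    have h3 := Submodule.smul_mem _ c⁻¹ h2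
    rwa [smul_smul, inv_mul_cancel₀ hc.ne', one_smul] at h3

/-- Coefficient form. -/
theorem DL_coeff (k : Fin t → ℕ) (T : RR t n)
    (hk : ∀ M j, coeff M T ≠ 0 → ∑ x, M (j, x) = k j) (hV : Van T) :
    ∃ c : (Fin t → Fin n) → (Fin t × Fin n →₀ ℕ) → ℝ,
      (∀ w (τ : Equiv.Perm (Fin t)) M, c (w ∘ τ) M = sg τ * c w M) ∧
      ∀ M, coeff M T = ∑ w, if (∑ j, Finsupp.single (j, w j) 1 : Fin t × Fin n →₀ ℕ) ≤ M
        then c w (M - ∑ j, Finsupp.single (j, w j) 1) else 0 := by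
  obtain ⟨C, hC, hT⟩ := DL_main _ k T rfl
    (fun j => (EE_self_iff j T (k j)).2 fun M hM => hk M j hM) hV
  refine ⟨fun w M => coeff M (C w), fun w τ M => by simp [hC], fun M => ?_⟩
  conv_lhs => rw [hT]
  rw [coeff_sum]
  refine Finset.sum_congr rfl fun w _ => ?_
  have : (∏ j, (X (j, w j) : RR t n)) = monomial (∑ j, Finsupp.single (j, w j) 1) 1 := by
    rw [monomial_sum_one]
    rfl
  rw [this, coeff_monomial_mul']
  simp

end DL
end Part3

open scoped BigOperators
section Part4

section Calc
variable {E F : Type*} [NormedAddCommGroup E] [NormedSpace ℝ E]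
  [NormedAddCommGroup F] [NormedSpace ℝ F]

abbrev Sm (f : E → F) (U : Set E) : Prop := ContDiffOn ℝ (⊤:ℕ∞) f U

/-- directional derivative -/
noncomputable def dd (v : E) (f : E → ℝ) (x : E) : ℝ := fderiv ℝ f x v

noncomputable def ddl : List E → (E → ℝ) → (E → ℝ)
  | [], f => f
  | v :: l, f => dd v (ddl l f)

lemma ddl_append (l₁ l₂ : List E) (f : E → ℝ) : ddl (l₁ ++ l₂) f = ddl l₁ (ddl l₂ f) := by
  induction l₁ with
  | nil => rfl
  | cons v l ih => simp [ddl, ih]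

lemma Sm.diffAt {f : E → F} {U : Set E} (h : Sm f U) (hU : IsOpen U) {x : E} (hx : x ∈ U) :
    DifferentiableAt ℝ f x :=
  (h.contDiffAt (hU.mem_nhds hx)).differentiableAt (by simp)

lemma Sm.fderiv {f : E → F} {U : Set E} (h : Sm f U) (hU : IsOpen U) :
    Sm (fderiv ℝ f) U := by
  refine ContDiffOn.fderiv_of_isOpen (n := (⊤:ℕ∞)) h hU ?_
  exact le_of_eq rfl

lemma Sm.dd {f : E → ℝ} {U : Set E} (h : Sm f U) (hU : IsOpen U) (v : E) :
    Sm (dd v f) U :=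
  (h.fderiv hU).clm_apply contDiffOn_const

lemma Sm.ddl {f : E → ℝ} {U : Set E} (h : Sm f U) (hU : IsOpen U) (l : List E) :
    Sm (ddl l f) U := by
  induction l with
  | nil => exact h
  | cons v l ih => exact ih.dd hU v

lemma dd_congr {f g : E → ℝ} {U : Set E} (hU : IsOpen U) (h : ∀ x ∈ U, f x = g x) (v : E) :
    ∀ x ∈ U, dd v f x = dd v g x := by
  intro x hx
  have : f =ᶠ[nhds x] g := Filter.eventually_of_mem (hU.mem_nhds hx) h
  rw [dd, dd, this.fderiv_eq]

lemma ddl_congr {f g : E → ℝ} {U : Set E} (hU : IsOpen U) (h : ∀ x ∈ U, f x = g x)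
    (l : List E) : ∀ x ∈ U, ddl l f x = ddl l g x := by
  induction l with
  | nil => exact h
  | cons v l ih => exact dd_congr hU ih v

lemma dd_comm {f : E → ℝ} {U : Set E} (hf : Sm f U) (hU : IsOpen U) (v w : E) :
    ∀ x ∈ U, dd v (dd w f) x = dd w (dd v f) x := by
  intro x hx
  have h1 : DifferentiableAt ℝ (fderiv ℝ f) x := (hf.fderiv hU).diffAt hU hx
  have key : ∀ a b : E, dd a (dd b f) x = fderiv ℝ (fderiv ℝ f) x a b := by
    intro a b
    have : fderiv ℝ (dd b f) x = _ := fderiv_clm_apply h1 (differentiableAt_const b)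
    rw [dd, this]
    simp
  rw [key, key]
  have hs : IsSymmSndFDerivAt ℝ f x :=
    (hf.contDiffAt (hU.mem_nhds hx)).isSymmSndFDerivAt (by
      simp only [minSmoothness_of_isRCLikeNormedField]
      exact WithTop.coe_le_coe.2 (le_top : (2:ℕ∞) ≤ ⊤))
  exact hs v w

lemma ddl_perm {f : E → ℝ} {U : Set E} (hf : Sm f U) (hU : IsOpen U) {l₁ l₂ : List E}
    (h : l₁.Perm l₂) : ∀ x ∈ U, ddl l₁ f x = ddl l₂ f x := by
  induction h with
  | nil => intro x _; rfl
  | cons v _ ih => exact dd_congr hU ih v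
  | swap v w l => exact dd_comm (hf.ddl hU l) hU _ _
  | trans _ _ ih1 ih2 => intro x hx; rw [ih1 x hx, ih2 x hx]

lemma dd_add {f g : E → ℝ} {U : Set E} (hf : Sm f U) (hg : Sm g U) (hU : IsOpen U) (v : E) :
    ∀ x ∈ U, dd v (fun y => f y + g y) x = dd v f x + dd v g x := by
  intro x hx
  have := fderiv_fun_add (hf.diffAt hU hx) (hg.diffAt hU hx)
  rw [dd, this]; rfl

lemma dd_sum {ι : Type*} (s : Finset ι) {f : ι → E → ℝ} {U : Set E} (hf : ∀ i ∈ s, Sm (f i) U)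
    (hU : IsOpen U) (v : E) :
    ∀ x ∈ U, dd v (fun y => ∑ i ∈ s, f i y) x = ∑ i ∈ s, dd v (f i) x := by
  intro x hx
  rw [dd, fderiv_fun_sum (fun i hi => (hf i hi).diffAt hU hx)]
  simp [dd]

lemma dd_mul {f g : E → ℝ} {U : Set E} (hf : Sm f U) (hg : Sm g U) (hU : IsOpen U) (v : E) :
    ∀ x ∈ U, dd v (fun y => f y * g y) x = dd v f x * g x + f x * dd v g x := by
  intro x hx
  have := fderiv_fun_mul (hf.diffAt hU hx) (hg.diffAt hU hx)
  rw [dd, this]; simp [dd]; ring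

lemma dd_const (c : ℝ) (v : E) (x : E) : dd v (fun _ => c) x = 0 := by
  simp [dd]

lemma dd_const_mul {f : E → ℝ} (c : ℝ) {x : E} (hf : DifferentiableAt ℝ f x) (v : E) :
    dd v (fun y => c * f y) x = c * dd v f x := by
  rw [dd, fderiv_const_mul hf]; rfl

lemma ddl_const_mul {f : E → ℝ} {U : Set E} (hf : Sm f U) (hU : IsOpen U) (c : ℝ) (l : List E) :
    ∀ x ∈ U, ddl l (fun y => c * f y) x = c * ddl l f x := by
  induction l with
  | nil => intro x _; rfl
  | cons v l ih =>
    intro x hx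
    rw [ddl, dd_congr hU ih v x hx, dd_const_mul c ((hf.ddl hU l).diffAt hU hx)]
    rfl

lemma ddl_sum {ι : Type*} (s : Finset ι) {f : ι → E → ℝ} {U : Set E} (hf : ∀ i ∈ s, Sm (f i) U)
    (hU : IsOpen U) (l : List E) :
    ∀ x ∈ U, ddl l (fun y => ∑ i ∈ s, f i y) x = ∑ i ∈ s, ddl l (f i) x := by
  induction l with
  | nil => intro x _; rfl
  | cons v l ih =>
    intro x hx
    rw [ddl, dd_congr hU ih v x hx, dd_sum s (fun i hi => (hf i hi).ddl hU l) hU v x hx]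
    rfl

lemma ddl_add {f g : E → ℝ} {U : Set E} (hf : Sm f U) (hg : Sm g U) (hU : IsOpen U) (l : List E) :
    ∀ x ∈ U, ddl l (fun y => f y + g y) x = ddl l f x + ddl l g x := by
  induction l with
  | nil => intro x _; rfl
  | cons v l ih =>
    intro x hx
    rw [ddl, dd_congr hU ih v x hx, dd_add (hf.ddl hU l) (hg.ddl hU l) hU v x hx]
    rfl

/-- composition with an affine map -/
lemma ddl_affine {f : F → ℝ} {U : Set F} (hf : Sm f U) (hU : IsOpen U) (A : E →L[ℝ] F) (b : F)
    (l : List E) :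
    ∀ x, b + A x ∈ U → ddl l (fun y => f (b + A y)) x = ddl (l.map A) f (b + A x) := by
  have hcont : Continuous fun y => b + A y := by fun_prop
  have hV : IsOpen {y : E | b + A y ∈ U} := hU.preimage hcont
  induction l with
  | nil => intro x _; rfl
  | cons v l ih =>
    intro x hx
    rw [ddl, dd_congr hV (g := fun y => ddl (l.map A) f (b + A y)) (fun y hy => ih y hy) v x hx]
    have hd : HasFDerivAt (fun y => b + A y) (A : E →L[ℝ] F) x := A.hasFDerivAt.const_add b
    have hg := ((hf.ddl hU (l.map A)).diffAt hU hx).hasFDerivAt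
    have := hg.comp x hd
    rw [dd]
    erw [this.fderiv]
    rfl

lemma dd_smul_dir (c : ℝ) (v : E) (f : E → ℝ) (x : E) : dd (c • v) f x = c * dd v f x := by
  simp [dd]

lemma dd_sum_dir {ι : Type*} (s : Finset ι) (v : ι → E) (f : E → ℝ) (x : E) :
    dd (∑ i ∈ s, v i) f x = ∑ i ∈ s, dd (v i) f x := by
  simp [dd]

/-- multilinear expansion -/
lemma ddl_expand {ι : Type*} [Fintype ι] {f : E → ℝ} {U : Set E} (hf : Sm f U) (hU : IsOpen U)
    (e : ι → E) (s : ℕ) (c : Fin s → ι → ℝ) :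
    ∀ x ∈ U, ddl (List.ofFn fun j => ∑ i, c j i • e i) f x =
      ∑ α : Fin s → ι, (∏ j, c j (α j)) * ddl (List.ofFn fun j => e (α j)) f x := by
  induction s with
  | zero => intro x _; simp [ddl]
  | succ s ih =>
    intro x hx
    rw [List.ofFn_succ, ddl, dd_congr hU (ih (fun j => c j.succ)) _ x hx, sum_cons,
      dd_sum_dir]
    refine Finset.sum_congr rfl fun i _ => ?_
    have hsm : ∀ α : Fin s → ι, Sm (ddl (List.ofFn fun j => e (α j)) f) U :=
      fun α => hf.ddl hU _
    rw [dd_smul_dir, dd_sum _ (fun α _ => contDiffOn_const.mul (hsm α)) hU _ x hx, Finset.mul_sum]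
    refine Finset.sum_congr rfl fun α _ => ?_
    rw [dd_const_mul _ ((hsm α).diffAt hU hx), Fin.prod_univ_succ, List.ofFn_succ, ddl]
    simp only [Fin.cons_zero, Fin.cons_succ]
    ring

lemma ddl_smul_dirs {f : E → ℝ} {U : Set E} (hf : Sm f U) (hU : IsOpen U) (c : ℝ) (l : List E) :
    ∀ x ∈ U, ddl (l.map (fun v => c • v)) f x = c ^ l.length * ddl l f x := by
  induction l with
  | nil => intro x _; simp [ddl]
  | cons v l ih =>
    intro x hx
    rw [List.map_cons, ddl, dd_congr hU ih _ x hx, dd_smul_dir,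
      dd_const_mul _ ((hf.ddl hU l).diffAt hU hx), List.length_cons, ddl]
    ring

end Calc
end Part4

open scoped BigOperators
section Part5

variable {n m : ℕ}

noncomputable def pdl (l : List (Fin n)) (f : (Fin n → ℝ) → ℝ) : (Fin n → ℝ) → ℝ :=
  ddl (l.map fun i => Pi.single i (1:ℝ)) f

noncomputable def pD (K : Fin n → ℕ) (f : (Fin n → ℝ) → ℝ) : (Fin n → ℝ) → ℝ :=
  pdl (mlist K) f

noncomputable def jet (N : ℕ) (u : (Fin n → ℝ) → (Fin m → ℝ)) (x : Fin n → ℝ) : Jet n m N :=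
  (x, fun q => pD q.2.1 (fun y => u y q.1) x)

lemma count_mlist (K : Fin n → ℕ) (i : Fin n) : (mlist K).count i = K i := by
  rw [mlist, List.count_flatMap]
  have : (List.count i ∘ fun j : Fin n => List.replicate (K j) j) =
      fun j => if j = i then K j else 0 := by
    funext j
    simp [List.count_replicate]
  rw [this, ← Fin.sum_univ_def]
  simp

lemma mlist_addE_perm (K : Fin n → ℕ) (i : Fin n) :
    (mlist (addE K i)).Perm (i :: mlist K) := by
  rw [List.perm_iff_count]
  intro j
  rw [count_mlist, List.count_cons, count_mlist, addE]
  by_cases h : j = i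
  · simp [h]
  · simp [h, Ne.symm h]

lemma mlist_zero : mlist (fun _ : Fin n => 0) = [] := by
  apply List.eq_nil_of_length_eq_zero
  rw [mlist_length]; simp

lemma pD_zero (f : (Fin n → ℝ) → ℝ) : pD (fun _ => 0) f = f := by
  rw [pD, mlist_zero]; rfl

lemma pD_addE {f : (Fin n → ℝ) → ℝ} {U : Set (Fin n → ℝ)} (hf : Sm f U) (hU : IsOpen U)
    (K : Fin n → ℕ) (i : Fin n) :
    ∀ x ∈ U, pD (addE K i) f x = dd (Pi.single i 1) (pD K f) x := by
  intro x hx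
  rw [pD, pdl, ddl_perm hf hU ((mlist_addE_perm K i).map _) x hx]
  rfl

lemma Sm.pdl {f : (Fin n → ℝ) → ℝ} {U : Set (Fin n → ℝ)} (hf : Sm f U) (hU : IsOpen U)
    (l : List (Fin n)) : Sm (pdl l f) U := hf.ddl hU _

lemma Sm.pD {f : (Fin n → ℝ) → ℝ} {U : Set (Fin n → ℝ)} (hf : Sm f U) (hU : IsOpen U)
    (K : Fin n → ℕ) : Sm (pD K f) U := hf.ddl hU _

lemma sum_addE (K : Fin n → ℕ) (i : Fin n) : ∑ j, addE K i j = (∑ j, K j) + 1 := by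
  simp [addE, Finset.sum_add_distrib]

lemma Dset_open (t : ℕ) {W : Set ((Fin n → ℝ) × (Fin m → ℝ))} (hW : IsOpen W) :
    IsOpen (Dset t W) := by
  refine hW.preimage ?_
  refine continuous_fst.prodMk (continuous_pi fun σ => ?_)
  simp only [yc, Finset.sum_const_zero, Nat.zero_le, dite_true]
  fun_prop

lemma yc_of_le (σ : Fin m) (J : Fin n → ℕ) {r : ℕ} (p : Jet n m r) (h : (∑ i, J i) ≤ r) :
    yc σ J p = p.2 (σ, ⟨J, h⟩) := by
  rw [yc, dif_pos h]

lemma yc_proj {r s : ℕ} (h : r ≤ s) (σ : Fin m) (J : Fin n → ℕ) (p : Jet n m s)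
    (hJ : (∑ i, J i) ≤ r) : yc σ J (projJet h p) = yc σ J p := by
  rw [yc_of_le _ _ _ hJ, yc_of_le _ _ _ (hJ.trans h)]; rfl

lemma mem_Dset_proj {r s : ℕ} (h : r ≤ s) (W : Set ((Fin n → ℝ) × (Fin m → ℝ)))
    (p : Jet n m s) : projJet h p ∈ Dset r W ↔ p ∈ Dset s W := by
  unfold Dset
  simp only [Set.mem_ofPred_eq]
  have : (fun σ => yc σ (fun _ => 0) (projJet h p)) = fun σ => yc σ (fun _ : Fin n => 0) p := by
    funext σ
    exact yc_proj h σ _ p (by simp)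
  rw [this]; rfl

lemma projJet_contDiff {r s : ℕ} (h : r ≤ s) :
    ContDiff ℝ (⊤:ℕ∞) (projJet h : Jet n m s → Jet n m r) := by
  unfold projJet
  fun_prop

lemma yc_contDiff (σ : Fin m) (J : Fin n → ℕ) (r : ℕ) :
    ContDiff ℝ (⊤:ℕ∞) (yc σ J : Jet n m r → ℝ) := by
  by_cases h : (∑ i, J i) ≤ r
  · have : (yc σ J : Jet n m r → ℝ) = fun p => p.2 (σ, ⟨J, h⟩) := by
      funext p; exact yc_of_le _ _ _ h
    rw [this]; fun_prop
  · have : (yc σ J : Jet n m r → ℝ) = fun p => 0 := by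
      funext p; rw [yc, dif_neg h]
    rw [this]; fun_prop

lemma yc_jet (N : ℕ) (u : (Fin n → ℝ) → (Fin m → ℝ)) (x : Fin n → ℝ) (σ : Fin m)
    (J : Fin n → ℕ) (h : (∑ i, J i) ≤ N) : yc σ J (jet N u x) = pD J (fun y => u y σ) x := by
  rw [yc_of_le _ _ _ h]; rfl

lemma proj_jet {r s : ℕ} (h : r ≤ s) (u : (Fin n → ℝ) → (Fin m → ℝ)) (x : Fin n → ℝ) :
    projJet h (jet s u x) = jet r u x := rfl

lemma jet_mem (N : ℕ) (u : (Fin n → ℝ) → (Fin m → ℝ)) (x : Fin n → ℝ)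
    (W : Set ((Fin n → ℝ) × (Fin m → ℝ))) : jet N u x ∈ Dset N W ↔ (x, u x) ∈ W := by
  unfold Dset
  simp only [Set.mem_ofPred_eq]
  have : (fun σ => yc σ (fun _ => 0) (jet N u x)) = u x := by
    funext σ
    rw [yc_jet _ _ _ _ _ (by simp), pD_zero]
  rw [this]; rfl

/-- direction of the formal derivative -/
def fdir (i : Fin n) {r : ℕ} (p : Jet n m (r+1)) : Jet n m r :=
  (Pi.single i 1, fun q => yc q.1 (addE q.2.1 i) p)

lemma vec_expand {r : ℕ} (a : Fin n → ℝ) (b : JIdx n m r → ℝ) :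
    ((a, b) : Jet n m r) = (a, 0) + ∑ q, b q • ((0, Pi.single q 1) : Jet n m r) := by
  refine Prod.ext ?_ ?_
  · simp [Prod.fst_sum]
  · simp only [Prod.snd_add, Prod.snd_sum, Prod.smul_snd, zero_add]
    funext q
    simp [Finset.sum_apply, Pi.single_apply]

lemma pdY_eq {r : ℕ} (q : JIdx n m r) (f : Jet n m r → ℝ) (p : Jet n m r) :
    pdY q.1 q.2.1 f p = dd (0, Pi.single q 1) f p := by
  rw [pdY, dif_pos q.2.2]; rfl

lemma formalD_eq (i : Fin n) {r : ℕ} (f : Jet n m r → ℝ) (p : Jet n m (r+1)) :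
    formalD i f p = fderiv ℝ f (projJet (Nat.le_succ r) p) (fdir i p) := by
  rw [fdir, vec_expand, map_add, map_sum, formalD]
  congr 1
  refine Finset.sum_congr rfl fun q _ => ?_
  rw [pdY_eq, map_smul]; rfl

lemma Sm.formalD {r : ℕ} {f : Jet n m r → ℝ} {W : Set ((Fin n → ℝ) × (Fin m → ℝ))}
    (hf : Sm f (Dset r W)) (hW : IsOpen W) (i : Fin n) : Sm (formalD i f) (Dset (r+1) W) := by
  have h1 : Sm (fun p : Jet n m (r+1) => _root_.fderiv ℝ f (projJet (Nat.le_succ r) p))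
      (Dset (r+1) W) :=
    (hf.fderiv (Dset_open r hW)).comp (projJet_contDiff _).contDiffOn
      (fun p hp => (mem_Dset_proj _ _ _).2 hp)
  have h2 : ContDiff ℝ (⊤:ℕ∞) (fun p : Jet n m (r+1) => (fdir i p : Jet n m r)) := by
    refine contDiff_const.prodMk (contDiff_pi.2 fun q => yc_contDiff _ _ _)
  have h3 := h1.clm_apply h2.contDiffOn
  refine h3.congr fun p _ => formalD_eq i f p

lemma Sm.formalDL {r : ℕ} {f : Jet n m r → ℝ} {W : Set ((Fin n → ℝ) × (Fin m → ℝ))}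
    (hf : Sm f (Dset r W)) (hW : IsOpen W) (l : List (Fin n)) :
    Sm (formalDL l f) (Dset (r+l.length) W) := by
  induction l with
  | nil => exact hf
  | cons i l ih => exact ih.formalD hW i

def SmSec (u : (Fin n → ℝ) → (Fin m → ℝ)) : Prop := ∀ σ, Sm (fun y => u y σ) Set.univ

lemma SmSec.cont {u : (Fin n → ℝ) → (Fin m → ℝ)} (hu : SmSec u) : Continuous u :=
  continuous_pi fun σ => continuousOn_univ.1 (hu σ).continuousOn

def Udom (W : Set ((Fin n → ℝ) × (Fin m → ℝ))) (u : (Fin n → ℝ) → (Fin m → ℝ)) :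
    Set (Fin n → ℝ) := {x | (x, u x) ∈ W}

lemma Udom_open {W : Set ((Fin n → ℝ) × (Fin m → ℝ))} (hW : IsOpen W)
    {u : (Fin n → ℝ) → (Fin m → ℝ)} (hu : SmSec u) : IsOpen (Udom W u) :=
  hW.preimage (continuous_id.prodMk hu.cont)

lemma jet_contDiff (N : ℕ) {u : (Fin n → ℝ) → (Fin m → ℝ)} (hu : SmSec u) :
    ContDiff ℝ (⊤:ℕ∞) (jet N u) := by
  refine contDiff_id.prodMk (contDiff_pi.2 fun q => ?_)
  exact contDiffOn_univ.1 ((hu q.1).pD isOpen_univ _)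

lemma Sm.comp_jet {N : ℕ} {f : Jet n m N → ℝ} {W : Set ((Fin n → ℝ) × (Fin m → ℝ))}
    (hf : Sm f (Dset N W)) {u : (Fin n → ℝ) → (Fin m → ℝ)} (hu : SmSec u) :
    Sm (fun x => f (jet N u x)) (Udom W u) :=
  hf.comp (jet_contDiff N hu).contDiffOn (fun x hx => (jet_mem N u x W).2 hx)

lemma fderiv_jet (N : ℕ) {u : (Fin n → ℝ) → (Fin m → ℝ)} (hu : SmSec u) (x : Fin n → ℝ)
    (i : Fin n) : fderiv ℝ (jet N u) x (Pi.single i 1) = fdir i (jet (N+1) u x) := by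
  have h : ∀ q : JIdx n m N, HasFDerivAt (fun y => (jet N u y).2 q)
      (fderiv ℝ (fun y => (jet N u y).2 q) x) x := by
    intro q
    exact (((hu q.1).pD isOpen_univ q.2.1).diffAt isOpen_univ (Set.mem_univ x)).hasFDerivAt
  have h2 : HasFDerivAt (jet N u) _ x := (hasFDerivAt_id x).prodMk (hasFDerivAt_pi.2 h)
  rw [h2.fderiv]
  refine Prod.ext rfl ?_
  funext q
  change fderiv ℝ (fun y => (jet N u y).2 q) x (Pi.single i 1) = yc q.1 (addE q.2.1 i) _
  rw [yc_jet _ _ _ _ _ (by rw [sum_addE]; exact Nat.succ_le_succ q.2.2),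
    pD_addE (hu q.1) isOpen_univ _ _ x (Set.mem_univ x)]
  rfl

lemma chain_jet {N : ℕ} {f : Jet n m N → ℝ} {W : Set ((Fin n → ℝ) × (Fin m → ℝ))}
    (hf : Sm f (Dset N W)) (hW : IsOpen W) {u : (Fin n → ℝ) → (Fin m → ℝ)} (hu : SmSec u)
    (i : Fin n) : ∀ x ∈ Udom W u,
    formalD i f (jet (N+1) u x) = dd (Pi.single i 1) (fun y => f (jet N u y)) x := by
  intro x hx
  rw [formalD_eq, proj_jet, ← fderiv_jet N hu, dd]
  have h1 := hf.diffAt (Dset_open N hW) ((jet_mem N u x W).2 hx)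
  have h2 := (jet_contDiff N hu).differentiable (by simp) x
  have := fderiv_comp x h1 h2
  have h3 : (fun y => f (jet N u y)) = f ∘ jet N u := rfl
  rw [h3, this]; rfl

lemma chain_jetL {N : ℕ} {f : Jet n m N → ℝ} {W : Set ((Fin n → ℝ) × (Fin m → ℝ))}
    (hf : Sm f (Dset N W)) (hW : IsOpen W) {u : (Fin n → ℝ) → (Fin m → ℝ)} (hu : SmSec u)
    (l : List (Fin n)) : ∀ x ∈ Udom W u,
    formalDL l f (jet (N+l.length) u x) = pdl l (fun y => f (jet N u y)) x := by
  induction l with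
  | nil => intro x _; rfl
  | cons i l ih =>
    intro x hx
    have := chain_jet (hf.formalDL hW l) hW hu i x hx
    refine this.trans ?_
    exact dd_congr (Udom_open hW hu) ih _ x hx

/-- the null condition -/
def Null (r k : ℕ) (W : Set ((Fin n → ℝ) × (Fin m → ℝ))) (G : (Fin n → ℕ) → Jet n m r → ℝ) :
    Prop :=
  ∀ u : (Fin n → ℝ) → (Fin m → ℝ), SmSec u → ∀ x ∈ Udom W u,
    ∑ K : MD n k, (-1:ℝ)^(∑ i, K.1 i) * pD K.1 (fun y => G K.1 (jet r u y)) x = 0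

lemma Sm.pdY {r : ℕ} {f : Jet n m r → ℝ} {W : Set ((Fin n → ℝ) × (Fin m → ℝ))}
    (hf : Sm f (Dset r W)) (hW : IsOpen W) (σ : Fin m) (K : Fin n → ℕ) :
    Sm (pdY σ K f) (Dset r W) := by
  by_cases h : (∑ i, K i) ≤ r
  · have : JetVar.pdY σ K f = JetVar.dd (0, Pi.single (σ, (⟨K, h⟩ : MD n r)) 1) f := by
      funext p
      exact pdY_eq (σ, (⟨K, h⟩ : MD n r)) f p
    rw [this]
    exact hf.dd (Dset_open r hW) _
  · have : JetVar.pdY σ K f = fun _ => 0 := by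
      funext p
      rw [JetVar.pdY, dif_neg h]
    rw [this]; exact contDiffOn_const

lemma EL_null {r : ℕ} {W : Set ((Fin n → ℝ) × (Fin m → ℝ))} (hW : IsOpen W)
    {L : Jet n m r → ℝ} (hL : Sm L (Dset r W)) (σ : Fin m)
    (h : ∀ p ∈ Dset (n := n) (m := m) (2*r) W, EL σ L p = 0) :
    Null r r W (fun K => pdY σ K L) := by
  intro u hu x hx
  have h1 := h (jet (2*r) u x) ((jet_mem _ u x W).2 hx)
  rw [EL, LieEuler] at h1
  rw [← h1]
  refine Finset.sum_congr rfl fun K _ => ?_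
  have hz : (fun i => 0 + K.1 i) = K.1 := by funext i; simp
  rw [dif_pos (by simpa using K.2)]
  simp only [Nat.choose_zero_right, Nat.cast_one, Finset.prod_const_one, mul_one]
  congr 1
  rw [hz, formalDI, proj_jet, proj_jet]
  exact (chain_jetL (hL.pdY hW σ K.1) hW hu (mlist K.1) x hx).symm

end Part5

open scoped BigOperators
section Part6

variable {n m : ℕ}

noncomputable def mon (x0 : Fin n → ℝ) (K : Fin n → ℕ) (x : Fin n → ℝ) : ℝ :=
  ∏ i, (x i - x0 i) ^ (K i) / ((K i).factorial : ℝ)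

lemma mon_contDiff (x0 : Fin n → ℝ) (K : Fin n → ℕ) : ContDiff ℝ (⊤:ℕ∞) (mon x0 K) := by
  unfold mon
  fun_prop

lemma dd_mon (x0 : Fin n → ℝ) (K : Fin n → ℕ) (i : Fin n) (x : Fin n → ℝ) :
    dd (Pi.single i 1) (mon x0 K) x = if K i = 0 then 0 else mon x0 (subE K i) x := by
  have hd : DifferentiableAt ℝ (mon x0 K) x := (mon_contDiff x0 K).differentiable (by simp) x
  rw [dd, ← hd.lineDeriv_eq_fderiv, lineDeriv]
  have e : (fun s : ℝ => mon x0 K (x + s • Pi.single i 1)) =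
      fun s => (x i + s - x0 i) ^ (K i) / ((K i).factorial : ℝ) *
        ∏ j ∈ Finset.univ.erase i, (x j - x0 j) ^ (K j) / ((K j).factorial : ℝ) := by
    funext s
    rw [mon, ← Finset.mul_prod_erase _ _ (Finset.mem_univ i)]
    congr 1
    · simp
    · refine Finset.prod_congr rfl fun j hj => ?_
      simp [Finset.ne_of_mem_erase hj]
  rw [e]
  have h1 : HasDerivAt (fun s : ℝ => x i + s - x0 i) 1 0 := by
    simpa using ((hasDerivAt_id (0:ℝ)).const_add (x i)).sub_const (x0 i)
  have h2 := ((h1.pow (K i)).div_const ((K i).factorial : ℝ)).mul_const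
    (∏ j ∈ Finset.univ.erase i, (x j - x0 j) ^ (K j) / ((K j).factorial : ℝ))
  have h3 := h2.deriv
  simp only [Pi.pow_apply] at h3
  rw [h3]
  split_ifs with hK
  · simp [hK]
  · rw [mon, ← Finset.mul_prod_erase _ _ (Finset.mem_univ i)]
    congr 1
    · obtain ⟨a, ha⟩ := Nat.exists_eq_succ_of_ne_zero hK
      have hf : ((a.factorial : ℕ) : ℝ) ≠ 0 := by positivity
      have hs : ((a : ℝ) + 1) ≠ 0 := by positivity
      simp only [subE, ha, if_true, Nat.succ_eq_add_one, Nat.add_sub_cancel, Nat.factorial_succ]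
      push_cast
      field_simp
      simp
    · refine Finset.prod_congr rfl fun j hj => ?_
      simp [subE, Finset.ne_of_mem_erase hj]

lemma pdl_mon (x0 : Fin n → ℝ) (K : Fin n → ℕ) (l : List (Fin n)) :
    pdl l (mon x0 K) = if ∀ i, l.count i ≤ K i then mon x0 (fun i => K i - l.count i)
      else fun _ => 0 := by
  induction l with
  | nil => simp [pdl, ddl]
  | cons a l ih =>
    have h0 : pdl (a :: l) (mon x0 K) = dd (Pi.single a 1) (pdl l (mon x0 K)) := rfl
    rw [h0, ih]
    by_cases h : ∀ i, l.count i ≤ K i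
    · rw [if_pos h]
      funext x
      rw [dd_mon]
      by_cases h2 : K a - l.count a = 0
      · rw [if_pos h2, if_neg]
        intro h3
        have := h3 a
        simp at this
        omega
      · rw [if_neg h2, if_pos]
        · congr 1
          funext i
          simp only [subE, List.count_cons]
          by_cases hi : i = a
          · subst hi; simp; omega
          · simp [hi, Ne.symm hi]
        · intro i
          rw [List.count_cons]
          have := h i
          by_cases hi : i = a
          · subst hi; simp; omega
          · simpa [Ne.symm hi] using this
    · rw [if_neg h, if_neg]
      · funext x; simp [dd]
      · intro h3
        apply h
        intro i
        refine le_trans ?_ (h3 i)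
        rw [List.count_cons]; omega

lemma pD_mon (x0 : Fin n → ℝ) (K J : Fin n → ℕ) :
    pD J (mon x0 K) x0 = if J = K then 1 else 0 := by
  rw [pD, pdl_mon]
  simp only [count_mlist]
  by_cases h : J = K
  · subst h; simp [mon]
  · rw [if_neg h]
    split_ifs with h1
    · obtain ⟨i, hi⟩ := Function.ne_iff.1 h
      rw [mon]
      apply Finset.prod_eq_zero (Finset.mem_univ i)
      have := h1 i
      have h2 : K i - J i ≠ 0 := by omega
      simp [h2]
    · rfl

lemma exists_section (r : ℕ) (q : Jet n m r) :
    ∃ u : (Fin n → ℝ) → (Fin m → ℝ), SmSec u ∧ jet r u q.1 = q := by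
  refine ⟨fun x σ => ∑ K : MD n r, q.2 (σ, K) * mon q.1 K.1 x, ?_, ?_⟩
  · intro σ
    refine ContDiff.contDiffOn ?_
    exact ContDiff.sum fun K _ => contDiff_const.mul (mon_contDiff _ _)
  · refine Prod.ext rfl ?_
    funext κ
    change pD κ.2.1 (fun y => ∑ K : MD n r, q.2 (κ.1, K) * mon q.1 K.1 y) q.1 = q.2 κ
    rw [pD, pdl, ddl_sum (U := Set.univ) _ (fun K _ => ContDiff.contDiffOn
      (contDiff_const.mul (mon_contDiff _ _))) isOpen_univ _ _ (Set.mem_univ _)]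
    have : ∀ K : MD n r, ddl ((mlist κ.2.1).map fun i => Pi.single i (1:ℝ))
        (fun y => q.2 (κ.1, K) * mon q.1 K.1 y) q.1 =
        if K = κ.2 then q.2 κ else 0 := by
      intro K
      rw [ddl_const_mul (U := Set.univ) (mon_contDiff _ _).contDiffOn isOpen_univ _ _ _
        (Set.mem_univ _)]
      have h2 := pD_mon q.1 K.1 κ.2.1
      rw [pD, pdl] at h2
      rw [h2]
      by_cases hK : K = κ.2
      · subst hK; simp
      · have : κ.2.1 ≠ K.1 := fun h => hK (Subtype.ext h.symm)
        simp [hK, this]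
    rw [Finset.sum_congr rfl fun K _ => this K]
    simp

/-- top part of the jet -/
noncomputable def topJ (r : ℕ) (φ : (Fin n → ℝ) → (Fin m → ℝ)) (z : Fin n → ℝ) : Jet n m r :=
  (0, fun κ => if (∑ i, κ.2.1 i) = r then pD κ.2.1 (fun y => φ y κ.1) z else 0)

lemma pdl_scale {f : (Fin n → ℝ) → ℝ} {U : Set (Fin n → ℝ)} (hf : Sm f U) (hU : IsOpen U)
    (b : Fin n → ℝ) (c : ℝ) (K : Fin n → ℕ) (x : Fin n → ℝ) (hx : b + c • x ∈ U) :
    pD K (fun y => f (b + c • y)) x = c ^ (∑ i, K i) * pD K f (b + c • x) := by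
  have := ddl_affine hf hU (c • ContinuousLinearMap.id ℝ (Fin n → ℝ)) b
    ((mlist K).map fun i => Pi.single i (1:ℝ)) x hx
  rw [pD, pdl]
  refine this.trans ?_
  have h2 := ddl_smul_dirs hf hU c ((mlist K).map fun i => Pi.single i (1:ℝ)) (b + c • x) hx
  rw [List.length_map, mlist_length] at h2
  exact h2

lemma symbol_limit {r k : ℕ} (hr : 1 ≤ r) {W : Set ((Fin n → ℝ) × (Fin m → ℝ))} (hW : IsOpen W)
    {G : (Fin n → ℕ) → Jet n m r → ℝ} (hG : ∀ K, Sm (G K) (Dset r W)) (hN : Null r k W G)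
    (q : Jet n m r) (hq : q ∈ Dset r W) (φ : (Fin n → ℝ) → (Fin m → ℝ)) (hφ : SmSec φ) :
    ∑ K : MD n k, (if (∑ i, K.1 i) = k then pD K.1 (fun z => G K.1 (q + topJ r φ z)) 0 else 0)
      = 0 := by
  obtain ⟨u0, hu0, hj⟩ := exists_section r q
  set x0 := q.1 with hx0
  set Q : ℝ × (Fin n → ℝ) → Jet n m r := fun p =>
    (x0 + p.1 • p.2, fun κ => pD κ.2.1 (fun y => u0 y κ.1) (x0 + p.1 • p.2) +
      p.1 ^ (r - ∑ i, κ.2.1 i) * pD κ.2.1 (fun y => φ y κ.1) p.2) with hQ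
  have hQs : ContDiff ℝ (⊤:ℕ∞) Q := by
    have h1 : ContDiff ℝ (⊤:ℕ∞) (fun p : ℝ × (Fin n → ℝ) => x0 + p.1 • p.2) :=
      contDiff_const.add (contDiff_fst.smul contDiff_snd)
    refine h1.prodMk (contDiff_pi.2 fun κ => ?_)
    have h2 := contDiffOn_univ.1 ((hu0 κ.1).pD isOpen_univ κ.2.1)
    have h3 := contDiffOn_univ.1 ((hφ κ.1).pD isOpen_univ κ.2.1)
    exact (h2.comp h1).add ((contDiff_fst.pow _).mul (h3.comp contDiff_snd))
  have hQ0 : ∀ z, Q (0, z) = q + topJ r φ z := by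
    intro z
    refine Prod.ext ?_ ?_
    · simp [hQ, topJ, hx0]
    · funext κ
      have h1 : pD κ.2.1 (fun y => u0 y κ.1) x0 = q.2 κ := by
        conv_rhs => rw [← hj]
        rfl
      have h2 := κ.2.2
      simp only [hQ, topJ, zero_smul, add_zero, h1, Prod.snd_add, Pi.add_apply]
      by_cases hκ : (∑ i, κ.2.1 i) = r
      · simp [hκ]
      · have : r - ∑ i, κ.2.1 i ≠ 0 := by omega
        simp [hκ, this]
  have hmem0 : Q (0, 0) ∈ Dset r W := by
    rw [hQ0]
    unfold Dset at hq ⊢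
    simp only [Set.mem_ofPred_eq] at hq ⊢
    have e : (fun σ => yc σ (fun _ => 0) (q + topJ r φ 0)) = fun σ => yc σ (fun _ : Fin n => 0) q := by
      funext σ
      rw [yc_of_le _ _ _ (by simp), yc_of_le _ _ _ (by simp)]
      have : (0:ℕ) ≠ r := by omega
      simp [topJ, this]
    rw [e]
    simpa [topJ] using hq
  set Ω : Set (ℝ × (Fin n → ℝ)) := Q ⁻¹' (Dset r W) with hΩ
  have hΩo : IsOpen Ω := (Dset_open r hW).preimage hQs.continuous
  have hg : ∀ K, Sm (fun p => G K (Q p)) Ω := fun K =>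
    (hG K).comp hQs.contDiffOn (fun p hp => hp)
  set zd : (Fin n → ℕ) → List (ℝ × (Fin n → ℝ)) := fun K =>
    (((mlist K).map fun i => Pi.single i (1:ℝ)).map (ContinuousLinearMap.inr ℝ ℝ (Fin n → ℝ)))
    with hzd
  have hslice : ∀ K (ε : ℝ), (ε, (0 : Fin n → ℝ)) ∈ Ω →
      ddl (zd K) (fun p => G K (Q p)) (ε, 0) = pD K (fun z => G K (Q (ε, z))) 0 := by
    intro K ε hε
    have h := ddl_affine (hg K) hΩo (ContinuousLinearMap.inr ℝ ℝ (Fin n → ℝ)) (ε, 0)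
      ((mlist K).map fun i => Pi.single i (1:ℝ)) 0 (by simpa using hε)
    simp only [ContinuousLinearMap.inr_apply, Prod.mk_add_mk, add_zero, zero_add] at h
    rw [pD, pdl, h]
  set f : ℝ → ℝ := fun ε => ∑ K : MD n k, (-1:ℝ) ^ (∑ i, K.1 i) *
    (ε ^ (k - ∑ i, K.1 i) * ddl (zd K.1) (fun p => G K.1 (Q p)) (ε, 0)) with hf
  have hfz : ∀ ε : ℝ, ε ≠ 0 → (ε, (0 : Fin n → ℝ)) ∈ Ω → f ε = 0 := by
    intro ε hε hm
    set u : (Fin n → ℝ) → (Fin m → ℝ) := fun y σ =>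
      u0 y σ + ε ^ r * φ ((-ε⁻¹) • x0 + ε⁻¹ • y) σ with hu
    have hφs : ∀ σ, Sm (fun y => φ ((-ε⁻¹) • x0 + ε⁻¹ • y) σ) Set.univ := by
      intro σ
      have := contDiffOn_univ.1 (hφ σ)
      refine ContDiff.contDiffOn (this.comp (g := fun y => φ y σ)
        (f := fun y => (-ε⁻¹) • x0 + ε⁻¹ • y) ?_)
      fun_prop
    have hus : SmSec u := fun σ => (hu0 σ).add (contDiffOn_const.mul (hφs σ))
    have hjet : ∀ z, jet r u (x0 + ε • z) = Q (ε, z) := by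
      intro z
      refine Prod.ext rfl ?_
      funext κ
      change pD κ.2.1 (fun y => u0 y κ.1 + ε ^ r * φ ((-ε⁻¹) • x0 + ε⁻¹ • y) κ.1) _ = _
      have hz : (-ε⁻¹) • x0 + ε⁻¹ • (x0 + ε • z) = z := by
        rw [smul_add, smul_smul, inv_mul_cancel₀ hε, one_smul, neg_smul, neg_add_cancel_left]
      rw [pD, pdl, ddl_add (hu0 κ.1) (contDiffOn_const.mul (hφs κ.1)) isOpen_univ _ _
        (Set.mem_univ _), ddl_const_mul (hφs κ.1) isOpen_univ _ _ _ (Set.mem_univ _)]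
      have h2 := pdl_scale (hφ κ.1) isOpen_univ ((-ε⁻¹) • x0) ε⁻¹ κ.2.1 (x0 + ε • z)
        (Set.mem_univ _)
      rw [pD, pdl] at h2
      rw [h2, hz, ← mul_assoc]
      congr 2
      have h3 := κ.2.2
      rw [pow_sub₀ ε hε h3, inv_pow]
    have hx : x0 ∈ Udom W u := by
      rw [Udom, Set.mem_ofPred_eq, ← jet_mem r u x0 W]
      have := hjet 0
      rw [smul_zero, add_zero] at this
      rw [this]; exact hm
    have hnull := hN u hus x0 hx
    have hterm : ∀ K : MD n k, ε ^ (k - ∑ i, K.1 i) *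
        ddl (zd K.1) (fun p => G K.1 (Q p)) (ε, 0) =
        ε ^ k * pD K.1 (fun y => G K.1 (jet r u y)) x0 := by
      intro K
      rw [hslice _ _ hm]
      have h2 := pdl_scale ((hG K.1).comp_jet hus) (Udom_open hW hus) x0 ε K.1 0
        (by simpa using hx)
      simp only [hjet, smul_zero, add_zero] at h2
      rw [h2, ← mul_assoc, ← pow_add, Nat.sub_add_cancel K.2]
    simp only [hf, hterm]
    have : ∀ K : MD n k, (-1:ℝ) ^ (∑ i, K.1 i) *
        (ε ^ k * pD K.1 (fun y => G K.1 (jet r u y)) x0) =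
        ε ^ k * ((-1:ℝ) ^ (∑ i, K.1 i) * pD K.1 (fun y => G K.1 (jet r u y)) x0) := by
      intro K; ring
    rw [Finset.sum_congr rfl fun K _ => this K, ← Finset.mul_sum, hnull, mul_zero]
  have hι : Continuous (fun ε : ℝ => (ε, (0 : Fin n → ℝ))) := by fun_prop
  have hfc : ContinuousAt f 0 := by
    have hterm : ∀ K : MD n k, ContinuousAt
        (fun ε : ℝ => ddl (zd K.1) (fun p => G K.1 (Q p)) (ε, 0)) 0 := by
      intro K
      have h1 := ((hg K.1).ddl hΩo (zd K.1)).continuousOn.continuousAt (hΩo.mem_nhds hmem0)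
      exact ContinuousAt.comp (f := fun ε : ℝ => (ε, (0 : Fin n → ℝ))) h1 hι.continuousAt
    refine tendsto_finsetSum _ fun K _ => ?_
    exact (continuousAt_const.mul ((continuousAt_id.pow _).mul (hterm K)))
  have hf0 : f 0 = 0 := by
    have h1 : Filter.Tendsto f (nhdsWithin 0 {0}ᶜ) (nhds (f 0)) :=
      hfc.tendsto.mono_left nhdsWithin_le_nhds
    have h2 : Filter.Tendsto f (nhdsWithin 0 {0}ᶜ) (nhds 0) := by
      refine tendsto_const_nhds.congr' ?_
      have : ∀ᶠ ε in nhds (0:ℝ), (ε, (0 : Fin n → ℝ)) ∈ Ω :=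
        hι.continuousAt.eventually (hΩo.mem_nhds hmem0)
      filter_upwards [nhdsWithin_le_nhds this, self_mem_nhdsWithin] with ε h3 h4
      exact (hfz ε h4 h3).symm
    exact tendsto_nhds_unique h1 h2
  have hfin : f 0 = (-1:ℝ) ^ k * ∑ K : MD n k,
      (if (∑ i, K.1 i) = k then pD K.1 (fun z => G K.1 (q + topJ r φ z)) 0 else 0) := by
    rw [Finset.mul_sum]
    refine Finset.sum_congr rfl fun K _ => ?_
    by_cases hK : (∑ i, K.1 i) = k
    · rw [if_pos hK, hK, hslice _ _ hmem0]
      simp [hQ0]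
    · have h3 := K.2
      have : k - ∑ i, K.1 i ≠ 0 := by omega
      simp [hK, this]
  rw [hf0] at hfin
  have h1 : (-1:ℝ) ^ k ≠ 0 := pow_ne_zero _ (by norm_num)
  exact (mul_eq_zero.1 hfin.symm).resolve_left h1

end Part6

open scoped BigOperators
section Part7

variable {n m : ℕ}

noncomputable def xpow (ξ : Fin n → ℝ) (K : Fin n → ℕ) : ℝ := ∏ i, ξ i ^ K i

noncomputable def ex (ξ z : Fin n → ℝ) : ℝ := Real.exp (∑ i, ξ i * z i)

lemma ex_contDiff (ξ : Fin n → ℝ) : ContDiff ℝ (⊤:ℕ∞) (ex ξ) := by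
  unfold ex; fun_prop

lemma dd_ex (ξ : Fin n → ℝ) (i : Fin n) (x : Fin n → ℝ) :
    dd (Pi.single i 1) (ex ξ) x = ξ i * ex ξ x := by
  have hd : DifferentiableAt ℝ (ex ξ) x := (ex_contDiff ξ).differentiable (by simp) x
  rw [dd, ← hd.lineDeriv_eq_fderiv, lineDeriv]
  have e : (fun s : ℝ => ex ξ (x + s • Pi.single i 1)) =
      fun s => Real.exp ((∑ j, ξ j * x j) + s * ξ i) := by
    funext s
    rw [ex]
    congr 1
    simp only [Pi.add_apply, Pi.smul_apply, smul_eq_mul, mul_add, Finset.sum_add_distrib]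
    congr 1
    rw [Finset.sum_eq_single i]
    · simp; ring
    · intro j _ hj; simp [hj]
    · simp
  rw [e]
  have h1 : HasDerivAt (fun s : ℝ => (∑ j, ξ j * x j) + s * ξ i) (ξ i) 0 := by
    simpa using ((hasDerivAt_id (0:ℝ)).mul_const (ξ i)).const_add (∑ j, ξ j * x j)
  rw [h1.exp.deriv, ex]
  simp; ring

lemma pdl_ex (ξ : Fin n → ℝ) (l : List (Fin n)) :
    pdl l (ex ξ) = fun z => (l.map ξ).prod * ex ξ z := by
  induction l with
  | nil => funext z; simp [pdl, ddl]
  | cons a l ih =>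
    have h0 : pdl (a :: l) (ex ξ) = dd (Pi.single a 1) (pdl l (ex ξ)) := rfl
    rw [h0, ih]
    funext z
    rw [dd_const_mul _ ((ex_contDiff ξ).differentiable (by simp) z), dd_ex]
    simp; ring

lemma mlist_prod (ξ : Fin n → ℝ) (K : Fin n → ℕ) : ((mlist K).map ξ).prod = xpow ξ K := by
  rw [Finset.prod_list_map_count, xpow]
  simp only [count_mlist]
  refine Finset.prod_subset (Finset.subset_univ _) fun i _ hi => ?_
  have : (mlist K).count i = 0 := List.count_eq_zero.2 (by simpa using hi)
  rw [count_mlist] at this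
  simp [this]

lemma pD_ex (ξ : Fin n → ℝ) (K : Fin n → ℕ) : pD K (ex ξ) = fun z => xpow ξ K * ex ξ z := by
  rw [pD, pdl_ex, mlist_prod]

/-- basis directions of the jet space -/
def eY {r : ℕ} (κ : JIdx n m r) : Jet n m r := (0, Pi.single κ 1)

noncomputable def vcoef {r : ℕ} (σ : Fin m) (ξ : Fin n → ℝ) (κ : JIdx n m r) : ℝ :=
  if κ.1 = σ ∧ (∑ i, κ.2.1 i) = r then xpow ξ κ.2.1 else 0

lemma mem_Dset_top {r : ℕ} (hr : 1 ≤ r) {W : Set ((Fin n → ℝ) × (Fin m → ℝ))}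
    {q : Jet n m r} (hq : q ∈ Dset r W) (v : Jet n m r) (hv1 : v.1 = 0)
    (hv : ∀ κ : JIdx n m r, (∑ i, κ.2.1 i) ≠ r → v.2 κ = 0) : q + v ∈ Dset r W := by
  unfold Dset at hq ⊢
  simp only [Set.mem_ofPred_eq] at hq ⊢
  have e : (fun σ => yc σ (fun _ => 0) (q + v)) = fun σ => yc σ (fun _ : Fin n => 0) q := by
    funext σ
    rw [yc_of_le _ _ _ (by simp), yc_of_le _ _ _ (by simp)]
    have : (0:ℕ) ≠ r := by omega
    simp [hv (σ, ⟨fun _ => 0, by simp⟩) (by simpa using this)]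
  rw [e]
  simpa [hv1] using hq

lemma symbol_alg {r k : ℕ} (hr : 1 ≤ r) {W : Set ((Fin n → ℝ) × (Fin m → ℝ))} (hW : IsOpen W)
    {G : (Fin n → ℕ) → Jet n m r → ℝ} (hG : ∀ K, Sm (G K) (Dset r W)) (hN : Null r k W G)
    (q : Jet n m r) (hq : q ∈ Dset r W) (s : ℕ) (σs : Fin s → Fin m) (ξ : Fin s → Fin n → ℝ) :
    ∑ K : MD n k, (if (∑ i, K.1 i) = k then xpow (∑ j, ξ j) K.1 *
      ∑ α : Fin s → JIdx n m r, (∏ j, vcoef (σs j) (ξ j) (α j)) *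
        ddl (List.ofFn fun j => eY (α j)) (G K.1) q else 0) = 0 := by
  set v : Fin s → Jet n m r := fun j => ∑ κ, vcoef (σs j) (ξ j) κ • eY κ with hv
  have hv2 : ∀ j κ, (v j).2 κ = vcoef (σs j) (ξ j) κ := by
    intro j κ
    simp [hv, Prod.snd_sum, eY, Finset.sum_apply, Pi.single_apply]
  have hv1 : ∀ j, (v j).1 = 0 := by
    intro j; simp [hv, Prod.fst_sum, eY]
  set Φ : (Fin s → ℝ) × (Fin n → ℝ) → Jet n m r :=
    fun p => q + ∑ j, p.1 j • (ex (ξ j) p.2 • v j) with hΦ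
  have hΦs : ContDiff ℝ (⊤:ℕ∞) Φ := by
    refine contDiff_const.add (ContDiff.sum fun j _ => ?_)
    have h1 : ContDiff ℝ (⊤:ℕ∞) (fun p : (Fin s → ℝ) × (Fin n → ℝ) => p.1 j) := by fun_prop
    exact h1.smul (((ex_contDiff (ξ j)).comp contDiff_snd).smul contDiff_const)
  have hΦD : ∀ p, Φ p ∈ Dset r W := by
    intro p
    refine mem_Dset_top hr hq _ ?_ ?_
    · simp [Prod.fst_sum, hv1]
    · intro κ hκ
      simp [Prod.snd_sum, Finset.sum_apply, hv2, vcoef, hκ]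
  have hH : ∀ K, Sm (fun p => G K (Φ p)) Set.univ := fun K =>
    (hG K).comp hΦs.contDiffOn (fun p _ => hΦD p)
  set zd : (Fin n → ℕ) → List ((Fin s → ℝ) × (Fin n → ℝ)) := fun K =>
    (((mlist K).map fun i => Pi.single i (1:ℝ)).map
      (ContinuousLinearMap.inr ℝ (Fin s → ℝ) (Fin n → ℝ))) with hzd
  set td0 : List (Fin s → ℝ) := List.ofFn fun j => Pi.single j 1 with htd0
  set td : List ((Fin s → ℝ) × (Fin n → ℝ)) :=
    td0.map (ContinuousLinearMap.inl ℝ (Fin s → ℝ) (Fin n → ℝ)) with htd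
  have hzslice : ∀ K (f : (Fin s → ℝ) × (Fin n → ℝ) → ℝ), Sm f Set.univ → ∀ t,
      ddl (zd K) f (t, 0) = pD K (fun z => f (t, z)) 0 := by
    intro K f hf t
    have h := ddl_affine hf isOpen_univ (ContinuousLinearMap.inr ℝ (Fin s → ℝ) (Fin n → ℝ)) (t, 0)
      ((mlist K).map fun i => Pi.single i (1:ℝ)) 0 (Set.mem_univ _)
    simp only [ContinuousLinearMap.inr_apply, Prod.mk_add_mk, add_zero, zero_add] at h
    rw [pD, pdl, h]
  have htslice : ∀ (f : (Fin s → ℝ) × (Fin n → ℝ) → ℝ), Sm f Set.univ → ∀ z,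
      ddl td f (0, z) = ddl td0 (fun t => f (t, z)) 0 := by
    intro f hf z
    have h := ddl_affine hf isOpen_univ (ContinuousLinearMap.inl ℝ (Fin s → ℝ) (Fin n → ℝ)) (0, z)
      td0 0 (Set.mem_univ _)
    simp only [ContinuousLinearMap.inl_apply, Prod.mk_add_mk, add_zero, zero_add] at h
    rw [h]
  have fact1 : ∀ t : Fin s → ℝ, ∑ K : MD n k, (if (∑ i, K.1 i) = k then
      ddl (zd K.1) (fun p => G K.1 (Φ p)) (t, 0) else 0) = 0 := by
    intro t
    set φ : (Fin n → ℝ) → (Fin m → ℝ) := fun z σ =>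
      ∑ j, (if σ = σs j then t j else 0) * ex (ξ j) z with hφ
    have hφs : SmSec φ := fun σ => ContDiff.contDiffOn
      (ContDiff.sum fun j _ => contDiff_const.mul (ex_contDiff _))
    have h := symbol_limit hr hW hG hN q hq φ hφs
    have htop : ∀ z, q + topJ r φ z = Φ (t, z) := by
      intro z
      rw [hΦ]
      congr 1
      refine Prod.ext ?_ ?_
      · simp [topJ, Prod.fst_sum, hv1]
      · funext κ
        simp only [topJ, Prod.snd_sum, Finset.sum_apply, Prod.smul_snd, Pi.smul_apply, hv2,
          smul_eq_mul, vcoef]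
        by_cases hκ : (∑ i, κ.2.1 i) = r
        · simp only [hκ, if_true, and_true]
          rw [hφ, pD, pdl, ddl_sum (U := Set.univ) _ (fun j _ => ContDiff.contDiffOn
            (contDiff_const.mul (ex_contDiff _))) isOpen_univ _ _ (Set.mem_univ _)]
          refine Finset.sum_congr rfl fun j _ => ?_
          rw [ddl_const_mul (U := Set.univ) (ex_contDiff _).contDiffOn isOpen_univ _ _ _
            (Set.mem_univ _)]
          have h2 := congrFun (pD_ex (ξ j) κ.2.1) z
          rw [pD, pdl] at h2
          rw [h2]
          split_ifs <;> ring
        · simp [hκ]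
    refine Eq.trans ?_ h
    refine Finset.sum_congr rfl fun K _ => ?_
    rw [hzslice _ _ (hH K.1)]
    simp only [htop]
  -- differentiate in t
  have fact2 : ∑ K : MD n k, (if (∑ i, K.1 i) = k then
      ddl td (ddl (zd K.1) (fun p => G K.1 (Φ p))) (0, 0) else 0) = 0 := by
    have hsm : ∀ K : MD n k, Sm (fun p => if (∑ i, K.1 i) = k then
      ddl (zd K.1) (fun p => G K.1 (Φ p)) p else 0) Set.univ := by
      intro K
      split_ifs
      · exact (hH K.1).ddl isOpen_univ _
      · exact contDiffOn_const
    have h1 := ddl_sum (U := Set.univ) Finset.univ (fun K _ => hsm K) isOpen_univ td (0, 0)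
      (Set.mem_univ _)
    have h2 : ddl td (fun p => ∑ K : MD n k, (if (∑ i, K.1 i) = k then
      ddl (zd K.1) (fun p => G K.1 (Φ p)) p else 0)) (0, 0) = 0 := by
      rw [htslice _ (ContDiffOn.sum fun K _ => hsm K)]
      simp only [fact1]
      have : ∀ l : List (Fin s → ℝ), ddl l (fun _ : Fin s → ℝ => (0:ℝ)) = fun _ => 0 := by
        intro l
        induction l with
        | nil => rfl
        | cons a l ih => rw [ddl, ih]; funext x; exact dd_const _ _ _
      rw [this]
    refine Eq.trans ?_ (h1.symm.trans h2)
    refine Finset.sum_congr rfl fun K _ => ?_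
    split_ifs
    · rfl
    · have := htslice (fun _ => 0) contDiffOn_const 0
      have h3 : ∀ l : List ((Fin s → ℝ) × (Fin n → ℝ)),
          ddl l (fun _ => (0:ℝ)) = fun _ => 0 := by
        intro l
        induction l with
        | nil => rfl
        | cons a l ih => rw [ddl, ih]; funext x; exact dd_const _ _ _
      rw [h3]
  refine Eq.trans ?_ fact2
  refine Finset.sum_congr rfl fun K _ => ?_
  split_ifs with hK
  swap
  · rfl
  rw [← ddl_append, ddl_perm (hH K.1) isOpen_univ List.perm_append_comm _ (Set.mem_univ _),
    ddl_append, hzslice _ _ ((hH K.1).ddl isOpen_univ _)]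
  set tK := ∑ α : Fin s → JIdx n m r, (∏ j, vcoef (σs j) (ξ j) (α j)) *
        ddl (List.ofFn fun j => eY (α j)) (G K.1) q with htK
  have hinner : ∀ z, ddl td (fun p => G K.1 (Φ p)) (0, z) = tK * ex (∑ j, ξ j) z := by
    intro z
    rw [htslice _ (hH K.1)]
    set A : (Fin s → ℝ) →L[ℝ] Jet n m r :=
      ∑ j, (ContinuousLinearMap.proj (R := ℝ) (φ := fun _ : Fin s => ℝ) j).smulRight
        (ex (ξ j) z • v j) with hA
    have hAe : ∀ t : Fin s → ℝ, Φ (t, z) = q + A t := by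
      intro t
      simp [hΦ, hA]
    simp only [hAe]
    have hq0 : q + A 0 ∈ Dset r W := by simpa using hq
    rw [ddl_affine (hG K.1) (Dset_open r hW) A q td0 0 hq0, map_zero, add_zero]
    have hdirs : td0.map A = List.ofFn fun j => ∑ κ, (ex (ξ j) z * vcoef (σs j) (ξ j) κ) • eY κ := by
      rw [htd0, List.map_ofFn]
      congr 1
      funext j
      simp only [Function.comp, hA, sum_apply,
        ContinuousLinearMap.smulRight_apply, ContinuousLinearMap.proj_apply, Pi.single_apply]
      rw [Finset.sum_eq_single j]
      · simp [hv, Finset.smul_sum, smul_smul]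
      · intro i _ hi; simp [hi]
      · simp
    rw [hdirs, ddl_expand (hG K.1) (Dset_open r hW) _ s _ q hq, htK, Finset.sum_mul]
    refine Finset.sum_congr rfl fun α _ => ?_
    have : ex (∑ j, ξ j) z = ∏ j, ex (ξ j) z := by
      unfold ex
      rw [← Real.exp_sum]
      congr 1
      simp only [Finset.sum_apply, Finset.sum_mul]
      rw [Finset.sum_comm]
    rw [this, Finset.prod_mul_distrib]
    ring
  simp only [hinner]
  rw [pD, pdl, ddl_const_mul (U := Set.univ) (ex_contDiff _).contDiffOn isOpen_univ _ _ _
            (Set.mem_univ _)]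
  have h2 := congrFun (pD_ex (∑ j, ξ j) K.1) 0
  rw [pD, pdl] at h2
  rw [h2]
  have h3 : ex (∑ j, ξ j) (0 : Fin n → ℝ) = 1 := by simp [ex]
  rw [h3]
  ring

end Part7

open scoped BigOperators
section Part8

variable {n m : ℕ}

namespace DL

lemma eval_scale {t n : ℕ} (kk : Fin t → ℕ) (T : RR t n)
    (hk : ∀ M j, MvPolynomial.coeff M T ≠ 0 → ∑ x, M (j,x) = kk j) (a : Fin t → ℝ)
    (ξ : Fin t → Fin n → ℝ) :
    MvPolynomial.eval (fun p => a p.1 * ξ p.1 p.2) T =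
      (∏ j, a j ^ kk j) * MvPolynomial.eval (fun p => ξ p.1 p.2) T := by
  rw [MvPolynomial.eval_eq', MvPolynomial.eval_eq', Finset.mul_sum]
  refine Finset.sum_congr rfl fun M hM => ?_
  simp only [mul_pow, Finset.prod_mul_distrib]
  have : ∏ p : Fin t × Fin n, a p.1 ^ M p = ∏ j, a j ^ kk j := by
    rw [Fintype.prod_prod_type]
    refine Finset.prod_congr rfl fun j _ => ?_
    change ∏ y, a j ^ M (j, y) = _
    rw [Finset.prod_pow_eq_pow_sum, hk M j (MvPolynomial.mem_support_iff.1 hM)]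
  rw [this]; ring

lemma van_of_sum {s n : ℕ} (kk : Fin (s+1) → ℕ) (T : RR (s+1) n)
    (hk : ∀ M j, MvPolynomial.coeff M T ≠ 0 → ∑ x, M (j,x) = kk j)
    (h : ∀ ξ : Fin s → Fin n → ℝ, MvPolynomial.eval
      (fun p => (Fin.cons (∑ j, ξ j) ξ : Fin (s+1) → Fin n → ℝ) p.1 p.2) T = 0) : Van T := by
  have step1 : ∀ (ξ : Fin (s+1) → Fin n → ℝ) (c : Fin (s+1) → ℝ), (∀ j, c j ≠ 0) →
      (∀ x, ∑ j, c j * ξ j x = 0) → MvPolynomial.eval (fun p => ξ p.1 p.2) T = 0 := by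
    intro ξ c hc h0
    set a : Fin (s+1) → ℝ := Fin.cons (c 0) (fun j => - c j.succ) with ha
    have h1 := eval_scale kk T hk a ξ
    have h2 := h (fun j x => - c j.succ * ξ j.succ x)
    have e : (fun p : Fin (s+1) × Fin n => a p.1 * ξ p.1 p.2) = fun p =>
        (Fin.cons (∑ j, fun x => - c (Fin.succ j) * ξ j.succ x)
          (fun j x => - c j.succ * ξ j.succ x) : Fin (s+1) → Fin n → ℝ) p.1 p.2 := by
      funext ⟨j, x⟩
      refine Fin.cases ?_ (fun j => ?_) j
      · have := h0 x
        rw [Fin.sum_univ_succ] at this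
        simp only [ha, Fin.cons_zero, Finset.sum_apply, neg_mul, Finset.sum_neg_distrib]
        linarith
      · simp [ha]
    rw [e, h2] at h1
    have h3 : (∏ j, a j ^ kk j) ≠ 0 := by
      refine Finset.prod_ne_zero_iff.2 fun j _ => pow_ne_zero _ ?_
      refine Fin.cases ?_ (fun j => ?_) j
      · simpa [ha] using hc 0
      · simpa [ha] using hc j.succ
    rcases mul_eq_zero.1 h1.symm with h4 | h4
    · exact absurd h4 h3
    · exact h4
  intro ξ c hc h0
  obtain ⟨j0, hj0⟩ : ∃ j, c j ≠ 0 := by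
    by_contra hcon
    push Not at hcon
    exact hc (funext hcon)
  set ρ : Fin n → ℝ := fun x => ∑ j, (if c j = 0 then ξ j x else 0) with hρ
  set F : ℝ → ℝ := fun ε => MvPolynomial.eval
    (fun p : Fin (s+1) × Fin n => ξ p.1 p.2 - (if p.1 = j0 then ε / c j0 * ρ p.2 else 0)) T with hF
  have hcont : Continuous F := by
    have : F = fun ε => ∑ d ∈ T.support, MvPolynomial.coeff d T * ∏ p : Fin (s+1) × Fin n,
      (ξ p.1 p.2 - (if p.1 = j0 then ε / c j0 * ρ p.2 else 0)) ^ d p := by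
      funext ε; rw [hF]; simp only [MvPolynomial.eval_eq']
    rw [this]
    refine continuous_finsetSum _ fun M _ => continuous_const.mul
      (continuous_finsetProd _ fun p _ => Continuous.pow ?_ _)
    by_cases hp : p.1 = j0
    · simp only [hp, if_true]; fun_prop
    · simp only [hp, if_false]; fun_prop
  have hz : ∀ ε, ε ≠ 0 → F ε = 0 := by
    intro ε hε
    refine step1 (fun j x => ξ j x - (if j = j0 then ε / c j0 * ρ x else 0))
      (fun j => if c j = 0 then ε else c j) ?_ ?_
    · intro j; split_ifs with hj
      · exact hε
      · exact hj
    · intro x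
      have e1 : ∀ j, (if c j = 0 then ε else c j) * (ξ j x - (if j = j0 then ε / c j0 * ρ x else 0))
          = (c j * ξ j x + ε * (if c j = 0 then ξ j x else 0)) - (if j = j0 then ε * ρ x else 0) := by
        intro j
        by_cases hj : j = j0
        · subst hj
          simp only [hj0, if_false, if_true]
          field_simp
          ring
        · simp only [hj, if_false]
          by_cases hcj : c j = 0
          · simp [hcj]
          · simp [hcj]
      simp only [e1, Finset.sum_sub_distrib, Finset.sum_add_distrib, h0, ← Finset.mul_sum]
      rw [Finset.sum_ite_eq' Finset.univ j0]
      simp [hρ]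
  have hF0 : F 0 = 0 := by
    have hd : F = fun _ => 0 := by
      refine hcont.ext_on (s := {0}ᶜ) (dense_compl_singleton 0) continuous_const fun ε hε => hz ε hε
    rw [hd]
  simpa [hF] using hF0


noncomputable def expo {s n : ℕ} (K : Fin n → ℕ) (Ks : Fin s → Fin n → ℕ) :
    Fin (s+1) × Fin n →₀ ℕ :=
  Finsupp.equivFunOnFinite.symm fun p => (Fin.cons K Ks : Fin (s+1) → Fin n → ℕ) p.1 p.2

lemma expo_zero {s n : ℕ} (K : Fin n → ℕ) (Ks : Fin s → Fin n → ℕ) (x : Fin n) :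
    expo K Ks (0, x) = K x := rfl

lemma expo_succ {s n : ℕ} (K : Fin n → ℕ) (Ks : Fin s → Fin n → ℕ) (j : Fin s) (x : Fin n) :
    expo K Ks (j.succ, x) = Ks j x := rfl

lemma DL_fun {s n k r : ℕ} (t : MD n k → (Fin s → MD n r) → ℝ)
    (ht : ∀ K Ks, t K Ks ≠ 0 → (∑ i, K.1 i) = k ∧ ∀ j, (∑ i, (Ks j).1 i) = r)
    (h : ∀ ξ : Fin s → Fin n → ℝ, ∑ K, ∑ Ks, t K Ks *
      (xpow (∑ j, ξ j) K.1 * ∏ j, xpow (ξ j) (Ks j).1) = 0) :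
    ∃ c : (Fin (s+1) → Fin n) → (Fin n → ℕ) → (Fin s → Fin n → ℕ) → ℝ,
      (∀ w (τ : Equiv.Perm (Fin (s+1))) N Ns, c (w ∘ τ) N Ns = sg τ * c w N Ns) ∧
      ∀ K Ks, t K Ks = ∑ i, ∑ w : Fin s → Fin n,
        if 1 ≤ K.1 i ∧ ∀ j, 1 ≤ (Ks j).1 (w j) then
          c (Fin.cons i w) (subE K.1 i) (fun j => subE (Ks j).1 (w j)) else 0 := by
  classical
  set T : RR (s+1) n := ∑ K : MD n k, ∑ Ks : Fin s → MD n r,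
    MvPolynomial.monomial (expo K.1 (fun j => (Ks j).1)) (t K Ks) with hT
  have hinj : ∀ (K K' : MD n k) (Ks Ks' : Fin s → MD n r),
      expo K.1 (fun j => (Ks j).1) = expo K'.1 (fun j => (Ks' j).1) → K' = K ∧ Ks' = Ks := by
    intro K K' Ks Ks' h
    constructor
    · apply Subtype.ext
      funext x
      have := DFunLike.congr_fun h (0, x)
      rw [expo_zero, expo_zero] at this
      exact this.symm
    · funext j
      apply Subtype.ext
      funext x
      have := DFunLike.congr_fun h (j.succ, x)
      rw [expo_succ, expo_succ] at this
      exact this.symm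
  have hcoeff : ∀ K Ks, MvPolynomial.coeff (expo K.1 (fun j => (Ks j).1)) T = t K Ks := by
    intro K Ks
    rw [hT]
    simp only [MvPolynomial.coeff_sum, MvPolynomial.coeff_monomial]
    rw [Finset.sum_eq_single K, Finset.sum_eq_single Ks]
    · simp
    · intro Ks' _ hne
      rw [if_neg]
      intro he
      exact hne (hinj K K Ks Ks' he.symm).2
    · simp
    · intro K' _ hne
      refine Finset.sum_eq_zero fun Ks' _ => ?_
      rw [if_neg]
      intro he
      exact hne (hinj K K' Ks Ks' he.symm).1
    · simp
  have hk : ∀ M j, MvPolynomial.coeff M T ≠ 0 →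
      ∑ x, M (j,x) = (Fin.cons k (fun _ => r) : Fin (s+1) → ℕ) j := by
    intro M j hM
    rw [hT] at hM
    simp only [MvPolynomial.coeff_sum, MvPolynomial.coeff_monomial] at hM
    obtain ⟨K, _, hM⟩ := Finset.exists_ne_zero_of_sum_ne_zero hM
    obtain ⟨Ks, _, hM2⟩ := Finset.exists_ne_zero_of_sum_ne_zero hM
    split_ifs at hM2 with he
    · clear hM
      subst he
      obtain ⟨h1, h2⟩ := ht _ _ hM2
      refine Fin.cases ?_ (fun j => ?_) j
      · simpa only [expo_zero, Fin.cons_zero] using h1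
      · simpa only [expo_succ, Fin.cons_succ] using h2 j
    · exact absurd rfl hM2
  have hV : Van T := by
    refine van_of_sum _ T hk fun ξ => ?_
    refine Eq.trans ?_ (h ξ)
    rw [hT]
    simp only [map_sum, MvPolynomial.eval_monomial]
    refine Finset.sum_congr rfl fun K _ => Finset.sum_congr rfl fun Ks _ => ?_
    congr 1
    rw [Finsupp.prod_fintype _ _ (by simp), Fintype.prod_prod_type, Fin.prod_univ_succ]
    rfl
  obtain ⟨c, hc1, hc2⟩ := DL_coeff _ T hk hV
  refine ⟨fun w N Ns => c w (expo N Ns), fun w τ N Ns => hc1 w τ _, fun K Ks => ?_⟩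
  rw [← hcoeff, hc2, sum_cons]
  refine Finset.sum_congr rfl fun i _ => Finset.sum_congr rfl fun w _ => ?_
  have hs0 : ∀ x, (∑ j : Fin (s+1), Finsupp.single
      (j, (Fin.cons i w : Fin (s+1) → Fin n) j) 1) (0, x) = if x = i then 1 else 0 := by
    intro x
    rw [Finsupp.finsetSum_apply, Fin.sum_univ_succ]
    simp [Finsupp.single_apply, eq_comm]
  have hs1 : ∀ j0 x, (∑ j : Fin (s+1), Finsupp.single
      (j, (Fin.cons i w : Fin (s+1) → Fin n) j) 1) (Fin.succ j0, x) = if x = w j0 then 1 else 0 := by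
    intro j0 x
    rw [Finsupp.finsetSum_apply, Finset.sum_eq_single j0.succ]
    · simp [Finsupp.single_apply, eq_comm]
    · intro j _ hj
      rw [Finsupp.single_apply, if_neg]
      intro he
      exact hj (congrArg Prod.fst he)
    · simp
  have hle : (∑ j : Fin (s+1), Finsupp.single (j, (Fin.cons i w : Fin (s+1) → Fin n) j) 1) ≤
      expo K.1 (fun j => (Ks j).1) ↔ (1 ≤ K.1 i ∧ ∀ j, 1 ≤ (Ks j).1 (w j)) := by
    constructor
    · intro hl
      constructor
      · have := hl (0, i)
        rw [hs0] at this
        simpa [expo_zero] using this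
      · intro j
        have := hl (j.succ, w j)
        rw [hs1] at this
        simpa [expo_succ] using this
    · rintro ⟨h1, h2⟩ ⟨j, x⟩
      refine Fin.cases ?_ (fun j => ?_) j
      · rw [hs0, expo_zero]
        split_ifs with hx
        · rw [hx]; exact h1
        · omega
      · rw [hs1, expo_succ]
        split_ifs with hx
        · rw [hx]; exact h2 j
        · omega
  by_cases hcond : (1 ≤ K.1 i ∧ ∀ j, 1 ≤ (Ks j).1 (w j))
  · rw [if_pos (hle.2 hcond), if_pos hcond]
    congr 1
    ext ⟨j, x⟩
    rw [Finsupp.tsub_apply]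
    refine Fin.cases ?_ (fun j => ?_) j
    · rw [hs0, expo_zero, expo_zero]; rfl
    · rw [hs1, expo_succ, expo_succ]; rfl
  · rw [if_neg (fun hh => hcond (hle.1 hh)), if_neg hcond]

end DL

end Part8

open scoped BigOperators
section Part9

variable {n m : ℕ}

lemma taylor_zero (N : ℕ) (f : ℕ → ℝ → ℝ) (hf : ∀ s τ, HasDerivAt (f s) (f (s+1) τ) τ)
    (h0 : ∀ τ, f N τ = 0) (τ : ℝ) :
    f 0 τ = ∑ s ∈ Finset.range N, (s.factorial : ℝ)⁻¹ * τ ^ s * f s 0 := by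
  induction N generalizing f τ with
  | zero => simpa using h0 τ
  | succ N ih =>
    have ih' := ih (fun s => f (s+1)) (fun s τ => hf (s+1) τ) h0
    set g : ℝ → ℝ := fun τ => f 0 τ - ∑ s ∈ Finset.range N,
      (((s+1).factorial : ℝ)⁻¹ * f (s+1) 0) * τ ^ (s+1) with hg
    have hd : ∀ τ, HasDerivAt g 0 τ := by
      intro τ
      have h1 : HasDerivAt (fun τ : ℝ => ∑ s ∈ Finset.range N,
        (((s+1).factorial : ℝ)⁻¹ * f (s+1) 0) * τ ^ (s+1))
        (∑ s ∈ Finset.range N, (((s+1).factorial : ℝ)⁻¹ * f (s+1) 0) * (((s+1 : ℕ) : ℝ) * τ ^ s)) τ := by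
        refine HasDerivAt.fun_sum fun s _ => ?_
        simpa using (hasDerivAt_pow (s+1) τ).const_mul (((s+1).factorial : ℝ)⁻¹ * f (s+1) 0)
      refine ((hf 0 τ).sub h1).congr_deriv ?_
      rw [ih' τ, sub_eq_zero]
      refine Finset.sum_congr rfl fun s _ => ?_
      rw [Nat.factorial_succ]
      have : (s.factorial : ℝ) ≠ 0 := by positivity
      push_cast
      field_simp
    have hc := is_const_of_deriv_eq_zero (fun x => (hd x).differentiableAt) (fun x => (hd x).deriv) τ 0
    rw [hg] at hc
    simp only [ne_eq, Nat.add_eq_zero_iff, one_ne_zero, and_false, not_false_eq_true, zero_pow, mul_zero,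
      Finset.sum_const_zero, sub_zero] at hc
    rw [Finset.sum_range_succ']
    simp only [Nat.factorial_zero, Nat.cast_one, inv_one, pow_zero, one_mul]
    rw [← hc]
    have : ∀ s, ((s+1).factorial : ℝ)⁻¹ * τ ^ (s+1) * f (s+1) 0 =
      ((s+1).factorial : ℝ)⁻¹ * f (s+1) 0 * τ ^ (s+1) := fun s => by ring
    simp only [this]
    ring

lemma alt_zero {t : ℕ} {c : (Fin t → Fin n) → ℝ}
    (hc : ∀ w (τ : Equiv.Perm (Fin t)), c (w ∘ τ) = DL.sg τ * c w) (ht : n < t) (w : Fin t → Fin n) :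
    c w = 0 := by
  obtain ⟨a, b, hab, hw⟩ := Fintype.exists_ne_map_eq_of_card_lt w (by simpa using ht)
  have h1 := hc w (Equiv.swap a b)
  have h2 : w ∘ (Equiv.swap a b) = w := by
    funext x
    simp only [Function.comp]
    rcases eq_or_ne x a with rfl | hxa
    · rw [Equiv.swap_apply_left, hw]
    · rcases eq_or_ne x b with rfl | hxb
      · rw [Equiv.swap_apply_right, hw]
      · rw [Equiv.swap_apply_of_ne_of_ne hxa hxb]
  rw [h2] at h1
  have h3 : DL.sg (Equiv.swap a b) = -1 := by
    simp [DL.sg, Equiv.Perm.sign_swap hab]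
  rw [h3] at h1
  linarith

section sel
variable (n) (s k d : ℕ)

abbrev XT : Type := (Fin (s+1) → Fin n) → MD n k → (Fin s → MD n d) → ℝ
abbrev YT : Type := MD n (k+1) → (Fin s → MD n (d+1)) → ℝ

def XA : Submodule ℝ (XT n s k d) where
  carrier := {x | (∀ w (τ : Equiv.Perm (Fin (s+1))) J I, x (w ∘ τ) J I = DL.sg τ * x w J I) ∧
    ∀ w J I, ¬ ((∑ i, J.1 i) = k ∧ ∀ j, (∑ i, (I j).1 i) = d) → x w J I = 0}
  zero_mem' := by
    constructor
    · intros; simp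
    · intros; rfl
  add_mem' := by
    rintro x y ⟨h1, h2⟩ ⟨h3, h4⟩
    constructor
    · intro w τ J I
      simp only [Pi.add_apply, h1, h3]; ring
    · intro w J I h
      simp only [Pi.add_apply, h2 w J I h, h4 w J I h, add_zero]
  smul_mem' := by
    rintro c x ⟨h1, h2⟩
    constructor
    · intro w τ J I
      simp only [Pi.smul_apply, h1, smul_eq_mul]; ring
    · intro w J I h
      simp only [Pi.smul_apply, h2 w J I h, smul_zero]

open Classical in
noncomputable def BM : XT n s k d →ₗ[ℝ] YT n s k d where
  toFun x K Ks := ∑ i, ∑ w : Fin s → Fin n, ∑ J : MD n k, ∑ I : Fin s → MD n d,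
    if addE J.1 i = K.1 ∧ ∀ j, addE (I j).1 (w j) = (Ks j).1 then x (Fin.cons i w) J I else 0
  map_add' x y := by
    funext K Ks
    simp only [Pi.add_apply, ← Finset.sum_add_distrib]
    refine Finset.sum_congr rfl fun i _ => Finset.sum_congr rfl fun w _ =>
      Finset.sum_congr rfl fun J _ => Finset.sum_congr rfl fun I _ => ?_
    split_ifs <;> simp
  map_smul' c x := by
    funext K Ks
    simp only [Pi.smul_apply, smul_eq_mul, Finset.mul_sum, RingHom.id_apply]
    refine Finset.sum_congr rfl fun i _ => Finset.sum_congr rfl fun w _ =>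
      Finset.sum_congr rfl fun J _ => Finset.sum_congr rfl fun I _ => ?_
    split_ifs <;> simp

open Classical in
lemma BM_apply (x : XT n s k d) (K : MD n (k+1)) (Ks : Fin s → MD n (d+1)) :
    BM n s k d x K Ks = ∑ i, ∑ w : Fin s → Fin n, ∑ J : MD n k, ∑ I : Fin s → MD n d,
    if addE J.1 i = K.1 ∧ ∀ j, addE (I j).1 (w j) = (Ks j).1 then x (Fin.cons i w) J I else 0 := rfl

lemma exists_sel : ∃ R : YT n s k d →ₗ[ℝ] XA n s k d, ∀ x ∈ XA n s k d,
    BM n s k d (R (BM n s k d x)).1 = BM n s k d x := by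
  set B := (BM n s k d).comp (XA n s k d).subtype with hB
  obtain ⟨R0, hR0⟩ := LinearMap.exists_rightInverse_of_surjective B.rangeRestrict
    (LinearMap.range_eq_top.2 B.surjective_rangeRestrict)
  obtain ⟨R, hR⟩ := LinearMap.exists_extend R0
  refine ⟨R, fun x hx => ?_⟩
  have h1 : R (B ⟨x, hx⟩) = R0 (B.rangeRestrict ⟨x, hx⟩) := by
    rw [← hR]; rfl
  have h2 : B.rangeRestrict (R0 (B.rangeRestrict ⟨x, hx⟩)) = B.rangeRestrict ⟨x, hx⟩ :=
    LinearMap.congr_fun hR0 _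
  have h3 := congrArg Subtype.val h2
  have h4 : BM n s k d x = B ⟨x, hx⟩ := rfl
  rw [h4, h1]
  exact h3

end sel

lemma sum_subE {K : Fin n → ℕ} {i : Fin n} (h : 1 ≤ K i) : ∑ j, subE K i j + 1 = ∑ j, K j := by
  have e : addE (subE K i) i = K := by
    funext j
    simp only [addE, subE]
    split_ifs with hj
    · subst hj; omega
    · omega
  rw [← sum_addE, e]

lemma addE_subE {K : Fin n → ℕ} {i : Fin n} (h : 1 ≤ K i) : addE (subE K i) i = K := by
  funext j
  simp only [addE, subE]
  split_ifs with hj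
  · subst hj; omega
  · omega

lemma subE_addE (K : Fin n → ℕ) (i : Fin n) : subE (addE K i) i = K := by
  funext j
  simp only [addE, subE]
  omega

open Classical in
lemma DL_range {s k d : ℕ} (t : YT n s k d)
    (ht : ∀ K Ks, t K Ks ≠ 0 → (∑ i, K.1 i) = k+1 ∧ ∀ j, (∑ i, (Ks j).1 i) = d+1)
    (h : ∀ ξ : Fin s → Fin n → ℝ, ∑ K, ∑ Ks, t K Ks *
      (xpow (∑ j, ξ j) K.1 * ∏ j, xpow (ξ j) (Ks j).1) = 0) :
    ∃ x ∈ XA n s k d, BM n s k d x = t := by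
  obtain ⟨c, hc1, hc2⟩ := DL.DL_fun t ht h
  refine ⟨fun w J I => if (∑ i, J.1 i) = k ∧ ∀ j, (∑ i, (I j).1 i) = d then
    c w J.1 (fun j => (I j).1) else 0, ⟨?_, ?_⟩, ?_⟩
  · intro w τ J I
    dsimp only
    split_ifs
    · exact hc1 w τ _ _
    · simp
  · intro w J I hh
    simp only [if_neg hh]
  · funext K Ks
    by_cases htop : (∑ i, K.1 i) = k+1 ∧ ∀ j, (∑ i, (Ks j).1 i) = d+1
    · rw [hc2, BM_apply]
      refine Finset.sum_congr rfl fun i _ => Finset.sum_congr rfl fun w _ => ?_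
      by_cases hc : 1 ≤ K.1 i ∧ ∀ j, 1 ≤ (Ks j).1 (w j)
      · have hJ : ∑ x, subE K.1 i x = k := by have := sum_subE hc.1; omega
        have hI : ∀ j, ∑ x, subE (Ks j).1 (w j) x = d := fun j => by
          have := sum_subE (hc.2 j); have := htop.2 j; omega
        rw [if_pos hc, Finset.sum_eq_single ⟨subE K.1 i, hJ.le⟩,
          Finset.sum_eq_single (fun j => ⟨subE (Ks j).1 (w j), (hI j).le⟩)]
        · rw [if_pos ⟨addE_subE hc.1, fun j => addE_subE (hc.2 j)⟩, if_pos ⟨hJ, hI⟩]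
        · intro I _ hne
          rw [if_neg]
          rintro ⟨_, h2⟩
          refine hne (funext fun j => Subtype.ext ?_)
          dsimp only
          rw [← h2 j, subE_addE]
        · simp
        · intro J _ hne
          refine Finset.sum_eq_zero fun I _ => ?_
          rw [if_neg]
          rintro ⟨h1, h2⟩
          refine hne (Subtype.ext ?_)
          dsimp only
          rw [← h1, subE_addE]
        · simp
      · rw [if_neg hc]
        refine Finset.sum_eq_zero fun J _ => Finset.sum_eq_zero fun I _ => ?_
        rw [if_neg]
        rintro ⟨h1, h2⟩
        refine hc ⟨?_, fun j => ?_⟩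
        · rw [← h1]; simp [addE]
        · rw [← h2]; simp [addE]
    · have h0 : t K Ks = 0 := by
        by_contra hne
        exact htop (ht K Ks hne)
      rw [h0, BM_apply]
      refine Finset.sum_eq_zero fun i _ => Finset.sum_eq_zero fun w _ =>
        Finset.sum_eq_zero fun J _ => Finset.sum_eq_zero fun I _ => ?_
      split_ifs with h1 h2
      · exfalso
        refine htop ⟨?_, fun j => ?_⟩
        · rw [← h1.1, sum_addE, h2.1]
        · rw [← h1.2 j, sum_addE, h2.2 j]
      · rfl
      · rfl

end Part9

open scoped BigOperators
section Part10

variable {n m : ℕ}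

abbrev Fam (n m d : ℕ) : Type :=
  (s : ℕ) → (Fin s → JIdx n m d) → (Fin (s+1) → Fin n) → Jet n m d → ℝ

noncomputable def yprod {d s : ℕ} (α : Fin s → JIdx n m d) (w : Fin s → Fin n)
    (p : Jet n m (d+1)) : ℝ := ∏ l, yc (α l).1 (addE (α l).2.1 (w l)) p

noncomputable def FF {d : ℕ} (c : Fam n m d) (i : Fin n) (p : Jet n m (d+1)) : ℝ :=
  ∑ s ∈ Finset.range n, (s.factorial : ℝ)⁻¹ * ∑ α : Fin s → JIdx n m d, ∑ w : Fin s → Fin n,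
    c s α (Fin.cons i w) (projJet (Nat.le_succ d) p) * yprod α w p

noncomputable def HH {d : ℕ} (c : Fam n m d) (p : Jet n m (d+1)) : ℝ :=
  ∑ s ∈ Finset.range n, (s.factorial : ℝ)⁻¹ * ∑ α : Fin s → JIdx n m d, ∑ w : Fin s → Fin n,
    (∑ i, formalD i (c s α (Fin.cons i w)) p) * yprod α w p

structure Good {d : ℕ} (W : Set ((Fin n → ℝ) × (Fin m → ℝ))) (c : Fam n m d) : Prop where
  sm : ∀ s α w, Sm (c s α w) (Dset d W)
  alt : ∀ s α w (τ : Equiv.Perm (Fin (s+1))) p, c s α (w ∘ τ) p = DL.sg τ * c s α w p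
  top : ∀ s α w p, (¬ ∀ l, (∑ i, (α l).2.1 i) = d) → c s α w p = 0

/-- extension of a jet by zero -/
noncomputable def iota0 {d : ℕ} (q : Jet n m d) : Jet n m (d+1) := (q.1, fun κ => yc κ.1 κ.2.1 q)

lemma iota0_contDiff (d : ℕ) : ContDiff ℝ (⊤:ℕ∞) (iota0 : Jet n m d → Jet n m (d+1)) :=
  contDiff_fst.prodMk (contDiff_pi.2 fun κ => yc_contDiff κ.1 κ.2.1 d)

lemma proj_iota0 {d : ℕ} (q : Jet n m d) : projJet (Nat.le_succ d) (iota0 q) = q := by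
  refine Prod.ext rfl ?_
  funext κ
  exact yc_of_le _ _ _ κ.2.2

lemma iota0_mem {d : ℕ} {W : Set ((Fin n → ℝ) × (Fin m → ℝ))} {q : Jet n m d}
    (hq : q ∈ Dset d W) : iota0 q ∈ Dset (d+1) W := by
  rw [← mem_Dset_proj (Nat.le_succ d), proj_iota0]; exact hq

open Classical in
noncomputable def tfun (s k d : ℕ) (G : (Fin n → ℕ) → Jet n m (d+1) → ℝ) (σs : Fin s → Fin m)
    (q : Jet n m (d+1)) : YT n s k d := fun K Ks =>
  if (∑ i, K.1 i) = k+1 ∧ ∀ j, (∑ i, (Ks j).1 i) = d+1 then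
    ddl (List.ofFn fun j => eY (σs j, Ks j)) (G K.1) q else 0

lemma sum_arrow_prod {s : ℕ} {A B : Type*} [Fintype A] [Fintype B] (f : (Fin s → A × B) → ℝ) :
    ∑ α, f α = ∑ a : Fin s → A, ∑ b : Fin s → B, f (fun j => (a j, b j)) := by
  rw [← Fintype.sum_prod_type' (f := fun (a : Fin s → A) (b : Fin s → B) => f (fun j => (a j, b j)))]
  exact Fintype.sum_equiv (Equiv.arrowProdEquivProdArrow (Fin s) (fun _ => A) (fun _ => B)) _ _ (fun α => rfl)

lemma tfun_range {s k d : ℕ} {W : Set ((Fin n → ℝ) × (Fin m → ℝ))} (hW : IsOpen W)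
    {G : (Fin n → ℕ) → Jet n m (d+1) → ℝ} (hG : ∀ K, Sm (G K) (Dset (d+1) W))
    (hN : Null (d+1) (k+1) W G) (σs : Fin s → Fin m) (q : Jet n m (d+1)) (hq : q ∈ Dset (d+1) W) :
    ∃ x ∈ XA n s k d, BM n s k d x = tfun s k d G σs q := by
  classical
  refine DL_range _ ?_ ?_
  · intro K Ks h
    by_contra hne
    exact h (by rw [tfun, if_neg hne])
  · intro ξ
    refine Eq.trans ?_ (symbol_alg (by omega) hW hG hN q hq s σs ξ)
    refine Finset.sum_congr rfl fun K _ => ?_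
    split_ifs with hK
    · rw [sum_arrow_prod, Finset.sum_eq_single σs, Finset.mul_sum]
      · refine Finset.sum_congr rfl fun Ks _ => ?_
        rw [tfun]
        by_cases hKs : ∀ j, (∑ i, (Ks j).1 i) = d+1
        · rw [if_pos ⟨hK, hKs⟩]
          have : ∏ j, vcoef (σs j) (ξ j) (σs j, Ks j) = ∏ j, xpow (ξ j) (Ks j).1 := by
            refine Finset.prod_congr rfl fun j _ => ?_
            simp [vcoef, hKs j]
          rw [this]; ring
        · rw [if_neg (fun h => hKs h.2)]
          push Not at hKs
          obtain ⟨j, hj⟩ := hKs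
          have : ∏ j, vcoef (σs j) (ξ j) (σs j, Ks j) = 0 :=
            Finset.prod_eq_zero (Finset.mem_univ j) (by simp [vcoef, hj])
          rw [this]; ring
      · intro σ' _ hne
        refine Finset.sum_eq_zero fun Ks _ => ?_
        obtain ⟨j, hj⟩ := Function.ne_iff.1 hne
        have : ∏ j, vcoef (σs j) (ξ j) (σ' j, Ks j) = 0 :=
            Finset.prod_eq_zero (Finset.mem_univ j) (by simp [vcoef, hj])
        rw [this]; ring
      · simp
    · refine Finset.sum_eq_zero fun Ks _ => ?_
      rw [tfun, if_neg (fun h => hK h.1)]; ring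

open Classical in
lemma structure_step {k d : ℕ} {W : Set ((Fin n → ℝ) × (Fin m → ℝ))} (hW : IsOpen W)
    {G : (Fin n → ℕ) → Jet n m (d+1) → ℝ} (hG : ∀ K, Sm (G K) (Dset (d+1) W))
    (hN : Null (d+1) (k+1) W G) :
    ∃ c : MD n k → Fam n m d, (∀ J, Good W (c J)) ∧
      (∀ J : MD n k, (∑ i, J.1 i) ≠ k → ∀ s α w p, c J s α w p = 0) ∧
      ∀ K : MD n (k+1), (∑ i, K.1 i) = k+1 → ∀ p ∈ Dset (d+1) W,
        G K.1 p = ∑ i, ∑ J : MD n k, if addE J.1 i = K.1 then FF (c J) i p else 0 := by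
  choose R hR using fun s => exists_sel n s k d
  have hRt : ∀ s (σs : Fin s → Fin m) (q : Jet n m (d+1)), q ∈ Dset (d+1) W →
      BM n s k d (R s (tfun s k d G σs q)).1 = tfun s k d G σs q := by
    intro s σs q hq
    obtain ⟨x, hx, he⟩ := tfun_range hW hG hN σs q hq
    rw [← he]; exact hR s x hx
  set c : MD n k → Fam n m d := fun J s α w q' =>
    (R s (tfun s k d G (fun j => (α j).1) (iota0 q'))).1 w J (fun j => (α j).2) with hc
  have hD := Dset_open (n := n) (m := m) (d+1) hW
  refine ⟨c, ?_, ?_, ?_⟩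
  · intro J
    refine ⟨?_, ?_, ?_⟩
    · intro s α w
      set ℓ : YT n s k d →ₗ[ℝ] ℝ :=
        (LinearMap.proj (fun j => (α j).2)).comp ((LinearMap.proj J).comp
          ((LinearMap.proj w).comp ((XA n s k d).subtype.comp (R s)))) with hℓ
      have h1 : ContDiff ℝ (⊤:ℕ∞) ℓ := (LinearMap.toContinuousLinearMap ℓ).contDiff
      have h2 : ContDiffOn ℝ (⊤:ℕ∞) (fun q' : Jet n m d => tfun s k d G (fun j => (α j).1) (iota0 q'))
          (Dset d W) := by
        refine contDiffOn_pi.2 fun K => contDiffOn_pi.2 fun Ks => ?_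
        unfold tfun
        split_ifs
        · exact ((hG K.1).ddl hD _).comp (iota0_contDiff d).contDiffOn (fun q hq => iota0_mem hq)
        · exact contDiffOn_const
      exact h1.comp_contDiffOn h2
    · intro s α w τ p
      exact (R s _).2.1 w τ J _
    · intro s α w p h
      exact (R s _).2.2 w J _ (fun hh => h hh.2)
  · intro J hJ s α w p
    exact (R s _).2.2 w J _ (fun hh => hJ hh.1)
  · intro K hK p hp
    set q0 : Jet n m (d+1) := iota0 (projJet (Nat.le_succ d) p) with hq0
    have hq0D : q0 ∈ Dset (d+1) W := iota0_mem ((mem_Dset_proj _ _ _).2 hp)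
    set vc : JIdx n m (d+1) → ℝ := fun κ => if (∑ i, κ.2.1 i) = d+1 then p.2 κ else 0 with hvc
    set v : Jet n m (d+1) := ∑ κ, vc κ • eY κ with hv
    have hv2 : ∀ κ, v.2 κ = vc κ := by
      intro κ
      simp [hv, Prod.snd_sum, eY, Finset.sum_apply, Pi.single_apply]
    have hv1 : v.1 = 0 := by
      simp [hv, Prod.fst_sum, eY]
    have hpq : q0 + (1:ℝ) • v = p := by
      refine Prod.ext ?_ ?_
      · rw [one_smul, Prod.fst_add, hv1, add_zero]; rfl
      · funext κ
        rw [one_smul, Prod.snd_add, Pi.add_apply, hv2, hvc]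
        change yc κ.1 κ.2.1 (projJet (Nat.le_succ d) p) + _ = _
        dsimp only
        split_ifs with h
        · rw [yc, dif_neg (by omega), zero_add]
        · have h' := κ.2.2
          rw [yc_of_le _ _ _ (by omega), add_zero]; rfl
    have hline : ∀ τ : ℝ, q0 + τ • v ∈ Dset (d+1) W := by
      intro τ
      refine mem_Dset_top (by omega) hq0D _ (by simp [hv1]) ?_
      intro κ hκ
      simp [hv2, hvc, hκ]
    set f : ℕ → ℝ → ℝ := fun s τ => ddl (List.ofFn fun _ : Fin s => v) (G K.1) (q0 + τ • v) with hf
    have hexp : ∀ s τ, f s τ = ∑ σs : Fin s → Fin m, ∑ Ks : Fin s → MD n (d+1),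
        (∏ j, p.2 (σs j, Ks j)) * tfun s k d G σs (q0 + τ • v) K Ks := by
      intro s τ
      rw [hf]
      dsimp only
      rw [hv, ddl_expand (hG K.1) hD _ s (fun _ => vc) _ (hline τ), sum_arrow_prod]
      refine Finset.sum_congr rfl fun σs _ => Finset.sum_congr rfl fun Ks _ => ?_
      rw [tfun]
      by_cases hKs : ∀ j, (∑ i, (Ks j).1 i) = d+1
      · rw [if_pos ⟨hK, hKs⟩]
        congr 1
        refine Finset.prod_congr rfl fun j _ => ?_
        simp [hvc, hKs j]
      · rw [if_neg (fun h => hKs h.2)]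
        push Not at hKs
        obtain ⟨j, hj⟩ := hKs
        rw [Finset.prod_eq_zero (Finset.mem_univ j) (by simp [hvc, hj])]; ring
    have hder : ∀ s τ, HasDerivAt (f s) (f (s+1) τ) τ := by
      intro s τ
      have h1 := (((hG K.1).ddl hD (List.ofFn fun _ : Fin s => v)).diffAt hD (hline τ)).hasFDerivAt
      have h2 : HasDerivAt (fun τ : ℝ => q0 + τ • v) v τ := by
        simpa using ((hasDerivAt_id τ).smul_const v).const_add q0
      have h3 := h1.comp_hasDerivAt τ h2
      refine h3.congr_deriv ?_
      rw [hf]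
      dsimp only
      rw [List.ofFn_succ, ddl]
      rfl
    have hzero : ∀ τ, f n τ = 0 := by
      intro τ
      rw [hexp]
      refine Finset.sum_eq_zero fun σs _ => Finset.sum_eq_zero fun Ks _ => ?_
      rw [← hRt _ _ _ (hline τ), BM_apply]
      refine mul_eq_zero_of_right _ ?_
      refine Finset.sum_eq_zero fun i _ => Finset.sum_eq_zero fun w _ =>
        Finset.sum_eq_zero fun J _ => Finset.sum_eq_zero fun I _ => ?_
      split_ifs
      · exact alt_zero (c := fun w => (R n (tfun n k d G σs (q0 + τ • v))).1 w J I)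
          (fun w τ' => (R n _).2.1 w τ' J I) (by omega) _
      · rfl
    have ht := taylor_zero n f hder hzero 1
    have hGp : G K.1 p = f 0 1 := by
      rw [hf]
      simp only [List.ofFn_zero, ddl]
      rw [hpq]
    rw [hGp, ht]
    simp only [FF, Finset.mul_sum]
    have hs : ∀ s, f s 0 = ∑ i, ∑ J : MD n k, if addE J.1 i = K.1 then
        ∑ α : Fin s → JIdx n m d, ∑ w : Fin s → Fin n,
          c J s α (Fin.cons i w) (projJet (Nat.le_succ d) p) * yprod α w p else 0 := by
      intro s
      rw [hexp]
      simp only [zero_smul, add_zero]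
      have e1 : ∀ σs : Fin s → Fin m, ∑ Ks : Fin s → MD n (d+1),
        (∏ j, p.2 (σs j, Ks j)) * tfun s k d G σs q0 K Ks = ∑ i, ∑ J : MD n k,
        if addE J.1 i = K.1 then ∑ I : Fin s → MD n d, ∑ w : Fin s → Fin n,
          c J s (fun j => (σs j, I j)) (Fin.cons i w) (projJet (Nat.le_succ d) p) *
            yprod (fun j => (σs j, I j)) w p else 0 := by
        intro σs
        have h0 := hRt s σs q0 hq0D
        have e2 : ∀ Ks, (∏ j, p.2 (σs j, Ks j)) * tfun s k d G σs q0 K Ks =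
          ∑ i, ∑ J : MD n k, ∑ I : Fin s → MD n d, ∑ w : Fin s → Fin n,
          if addE J.1 i = K.1 then (if ∀ j, addE (I j).1 (w j) = (Ks j).1 then
            (∏ j, p.2 (σs j, Ks j)) * (R s (tfun s k d G σs q0)).1 (Fin.cons i w) J I else 0) else 0 := by
          intro Ks
          rw [← congrFun (congrFun h0 K) Ks, BM_apply]
          simp only [Finset.mul_sum]
          refine Finset.sum_congr rfl fun i _ => ?_
          rw [Finset.sum_comm]
          refine Finset.sum_congr rfl fun J _ => ?_
          rw [Finset.sum_comm]
          refine Finset.sum_congr rfl fun I _ => ?_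
          refine Finset.sum_congr rfl fun w _ => ?_
          by_cases h1 : addE J.1 i = K.1
          · by_cases h2 : ∀ j, addE (I j).1 (w j) = (Ks j).1
            · rw [if_pos ⟨h1, h2⟩, if_pos h1, if_pos h2]
            · rw [if_neg (fun h => h2 h.2), if_pos h1, if_neg h2, mul_zero]
          · rw [if_neg (fun h => h1 h.1), if_neg h1, mul_zero]
        simp only [e2]
        rw [Finset.sum_comm]
        refine Finset.sum_congr rfl fun i _ => ?_
        rw [Finset.sum_comm]
        refine Finset.sum_congr rfl fun J _ => ?_
        by_cases h1 : addE J.1 i = K.1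
        · simp only [if_pos h1]
          rw [Finset.sum_comm]
          refine Finset.sum_congr rfl fun I _ => ?_
          rw [Finset.sum_comm]
          refine Finset.sum_congr rfl fun w _ => ?_
          have hle : ∀ j, ∑ x, addE (I j).1 (w j) x ≤ d+1 := fun j => by
            rw [sum_addE]; have := (I j).2; omega
          rw [Finset.sum_eq_single (fun j => ⟨addE (I j).1 (w j), hle j⟩)]
          · rw [if_pos (fun j => rfl), mul_comm]
            congr 1
            refine Finset.prod_congr rfl fun j _ => ?_
            exact (yc_of_le _ _ _ _).symm
          · intro Ks _ hne
            rw [if_neg]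
            intro hh
            exact hne (funext fun j => Subtype.ext (hh j).symm)
          · simp
        · simp only [if_neg h1, Finset.sum_const_zero]
      simp only [e1]
      rw [Finset.sum_comm]
      refine Finset.sum_congr rfl fun i _ => ?_
      rw [Finset.sum_comm]
      refine Finset.sum_congr rfl fun J _ => ?_
      by_cases h1 : addE J.1 i = K.1
      · simp only [if_pos h1]
        rw [sum_arrow_prod]
      · simp only [if_neg h1, Finset.sum_const_zero]
    simp only [hs, one_pow, mul_one]
    simp only [Finset.mul_sum]
    rw [Finset.sum_comm]
    refine Finset.sum_congr rfl fun i _ => ?_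
    rw [Finset.sum_comm]
    refine Finset.sum_congr rfl fun J _ => ?_
    split_ifs with h1
    · refine Finset.sum_congr rfl fun s _ => ?_
      simp only [Finset.mul_sum]
    · simp

end Part10

open scoped BigOperators
section Part11

variable {n m : ℕ}

lemma dd_prod {E : Type*} [NormedAddCommGroup E] [NormedSpace ℝ E] {ι : Type*} [DecidableEq ι]
    (u : Finset ι) {f : ι → E → ℝ} (x : E)
    (hf : ∀ i ∈ u, DifferentiableAt ℝ (f i) x) (v : E) :
    dd v (fun y => ∏ i ∈ u, f i y) x = ∑ i ∈ u, (∏ j ∈ u.erase i, f j x) * dd v (f i) x := by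
  have h := HasFDerivAt.finsetProd (u := u) (x := x) (fun i hi => (hf i hi).hasFDerivAt)
  rw [dd, h.fderiv]
  simp [dd, sum_apply]

lemma sum_perm_arg {t : ℕ} (τ : Equiv.Perm (Fin t)) (f : (Fin t → Fin n) → ℝ) :
    ∑ v, f (v ∘ τ) = ∑ v, f v :=
  Equiv.sum_comp (Equiv.arrowCongr τ.symm (Equiv.refl (Fin n))) f

lemma alt_cancel {s : ℕ} (c : (Fin (s+1) → Fin n) → ℝ)
    (hc : ∀ w (τ : Equiv.Perm (Fin (s+1))), c (w ∘ τ) = DL.sg τ * c w)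
    (Y : Fin s → Fin n → ℝ) (Z : Fin s → Fin n → Fin n → ℝ) (hZ : ∀ l a b, Z l a b = Z l b a) :
    ∑ i, ∑ w : Fin s → Fin n, c (Fin.cons i w) *
      ∑ l, (∏ l' ∈ Finset.univ.erase l, Y l' (w l')) * Z l (w l) i = 0 := by
  simp only [Finset.mul_sum]
  have h1 : ∀ i, ∑ w : Fin s → Fin n, ∑ l, c (Fin.cons i w) *
      ((∏ l' ∈ Finset.univ.erase l, Y l' (w l')) * Z l (w l) i) = ∑ l, ∑ w : Fin s → Fin n,
      c (Fin.cons i w) * ((∏ l' ∈ Finset.univ.erase l, Y l' (w l')) * Z l (w l) i) :=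
    fun i => Finset.sum_comm
  simp only [h1]
  rw [Finset.sum_comm]
  refine Finset.sum_eq_zero fun l _ => ?_
  set F : (Fin (s+1) → Fin n) → ℝ := fun v => c v *
    ((∏ l' ∈ Finset.univ.erase l, Y l' (v l'.succ)) * Z l (v l.succ) (v 0)) with hF
  have h2 : ∑ v, F v = 0 := by
    have h3 := sum_perm_arg (Equiv.swap 0 l.succ) F
    have h4 : ∀ v, F (v ∘ (Equiv.swap 0 l.succ)) = - F v := by
      intro v
      simp only [hF, hc]
      have hs : DL.sg (Equiv.swap (0 : Fin (s+1)) l.succ) = -1 := by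
        simp [DL.sg, Equiv.Perm.sign_swap (Fin.succ_ne_zero l).symm]
      have hp : ∏ l' ∈ Finset.univ.erase l, Y l' ((v ∘ (Equiv.swap 0 l.succ)) l'.succ) =
          ∏ l' ∈ Finset.univ.erase l, Y l' (v l'.succ) := by
        refine Finset.prod_congr rfl fun l' hl' => ?_
        have : l' ≠ l := (Finset.mem_erase.1 hl').1
        simp only [Function.comp]
        rw [Equiv.swap_apply_of_ne_of_ne (Fin.succ_ne_zero _) (fun h => this (Fin.succ_injective _ h))]
      rw [hp, hs]
      simp only [Function.comp, Equiv.swap_apply_left, Equiv.swap_apply_right]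
      rw [hZ l (v 0)]
      ring
    simp only [h4, Finset.sum_neg_distrib] at h3
    linarith
  rw [sum_cons] at h2
  simpa [hF] using h2

lemma addE_comm (J : Fin n → ℕ) (a b : Fin n) : addE (addE J a) b = addE (addE J b) a := by
  funext j; simp only [addE]; omega

lemma FF_sm {d : ℕ} {W : Set ((Fin n → ℝ) × (Fin m → ℝ))} {c : Fam n m d}
    (hc : Good W c) (i : Fin n) : Sm (FF c i) (Dset (d+1) W) := by
  unfold FF
  refine ContDiffOn.sum fun s _ => contDiffOn_const.mul (ContDiffOn.sum fun α _ =>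
    ContDiffOn.sum fun w _ => ContDiffOn.mul ?_ ?_)
  · exact (hc.sm s α _).comp (projJet_contDiff _).contDiffOn (fun p hp => (mem_Dset_proj _ _ _).2 hp)
  · unfold yprod
    exact (contDiff_prod fun l _ => yc_contDiff _ _ _).contDiffOn

lemma HH_sm {d : ℕ} {W : Set ((Fin n → ℝ) × (Fin m → ℝ))} (hW : IsOpen W) {c : Fam n m d}
    (hc : Good W c) : Sm (HH c) (Dset (d+1) W) := by
  unfold HH
  refine ContDiffOn.sum fun s _ => contDiffOn_const.mul (ContDiffOn.sum fun α _ =>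
    ContDiffOn.sum fun w _ => ContDiffOn.mul ?_ ?_)
  · exact ContDiffOn.sum fun i _ => Sm.formalD (hc.sm s α _) hW i
  · unfold yprod
    exact (contDiff_prod fun l _ => yc_contDiff _ _ _).contDiffOn

lemma div_FF {d : ℕ} {W : Set ((Fin n → ℝ) × (Fin m → ℝ))} (hW : IsOpen W) {c : Fam n m d}
    (hc : Good W c) {u : (Fin n → ℝ) → (Fin m → ℝ)} (hu : SmSec u) : ∀ x ∈ Udom W u,
    ∑ i, dd (Pi.single i 1) (fun y => FF c i (jet (d+1) u y)) x = HH c (jet (d+1) u x) := by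
  intro x hx
  have hU := Udom_open hW hu
  have hle : ∀ {s : ℕ} (α : Fin s → JIdx n m d) (w : Fin s → Fin n) l,
      ∑ j, addE (α l).2.1 (w l) j ≤ d + 1 := fun α w l => by
    rw [sum_addE]; have := (α l).2.2; omega
  have hyp : ∀ {s : ℕ} (α : Fin s → JIdx n m d) (w : Fin s → Fin n),
      (fun y => yprod α w (jet (d+1) u y)) =
        fun y => ∏ l, pD (addE (α l).2.1 (w l)) (fun z => u z (α l).1) y := by
    intro s α w
    funext y
    unfold yprod
    exact Finset.prod_congr rfl fun l _ => yc_jet _ _ _ _ _ (hle α w l)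
  have hpsm : ∀ K σ, Sm (pD K (fun z => u z σ)) Set.univ := fun K σ =>
    Sm.pD (hu σ) isOpen_univ K
  have hysm : ∀ {s : ℕ} (α : Fin s → JIdx n m d) (w : Fin s → Fin n),
      Sm (fun y => yprod α w (jet (d+1) u y)) (Udom W u) := by
    intro s α w
    rw [hyp]
    exact contDiffOn_prod fun l _ => (hpsm _ _).mono (Set.subset_univ _)
  have hcsm : ∀ s α w, Sm (fun y => c s α w (jet d u y)) (Udom W u) := fun s α w =>
    (hc.sm s α w).comp_jet hu
  have key : ∀ i, dd (Pi.single i 1) (fun y => FF c i (jet (d+1) u y)) x =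
      ∑ s ∈ Finset.range n, (s.factorial : ℝ)⁻¹ * ∑ α : Fin s → JIdx n m d, ∑ w : Fin s → Fin n,
      (formalD i (c s α (Fin.cons i w)) (jet (d+1) u x) * yprod α w (jet (d+1) u x) +
        c s α (Fin.cons i w) (jet d u x) * ∑ l,
          (∏ l' ∈ Finset.univ.erase l, pD (addE (α l').2.1 (w l')) (fun z => u z (α l').1) x) *
          pD (addE (addE (α l).2.1 (w l)) i) (fun z => u z (α l).1) x) := by
    intro i
    have e0 : (fun y => FF c i (jet (d+1) u y)) = fun y => ∑ s ∈ Finset.range n,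
      (s.factorial : ℝ)⁻¹ * ∑ α : Fin s → JIdx n m d, ∑ w : Fin s → Fin n,
      c s α (Fin.cons i w) (jet d u y) * yprod α w (jet (d+1) u y) := rfl
    have hterm : ∀ (s : ℕ) α w, Sm (fun y => c s α (Fin.cons i w) (jet d u y) *
      yprod α w (jet (d+1) u y)) (Udom W u) := fun s α w => (hcsm s α _).mul (hysm α w)
    rw [e0, dd_sum _ (fun s _ => contDiffOn_const.mul (ContDiffOn.sum fun α _ =>
      ContDiffOn.sum fun w _ => hterm s α w)) hU _ x hx]
    refine Finset.sum_congr rfl fun s _ => ?_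
    rw [dd_const_mul _ (Sm.diffAt (ContDiffOn.sum fun α _ =>
      ContDiffOn.sum fun w _ => hterm s α w) hU hx)]
    congr 1
    rw [dd_sum _ (fun α _ => ContDiffOn.sum fun w _ => hterm s α w) hU _ x hx]
    refine Finset.sum_congr rfl fun α _ => ?_
    rw [dd_sum _ (fun w _ => hterm s α w) hU _ x hx]
    refine Finset.sum_congr rfl fun w _ => ?_
    rw [dd_mul (hcsm s α _) (hysm α w) hU _ x hx, chain_jet (hc.sm s α _) hW hu i x hx]
    have e1 : dd (Pi.single i 1) (fun y => yprod α w (jet (d+1) u y)) x = ∑ l,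
          (∏ l' ∈ Finset.univ.erase l, pD (addE (α l').2.1 (w l')) (fun z => u z (α l').1) x) *
          pD (addE (addE (α l).2.1 (w l)) i) (fun z => u z (α l).1) x := by
      rw [hyp, dd_prod]
      · refine Finset.sum_congr rfl fun l _ => ?_
        rw [pD_addE (hu _) isOpen_univ _ i x (Set.mem_univ _)]
      · intro l _
        exact (hpsm _ _).diffAt isOpen_univ (Set.mem_univ x)
    rw [e1]
  simp only [key]
  rw [Finset.sum_comm, HH]
  refine Finset.sum_congr rfl fun s _ => ?_
  rw [← Finset.mul_sum]
  congr 1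
  rw [Finset.sum_comm]
  refine Finset.sum_congr rfl fun α _ => ?_
  simp only [Finset.sum_add_distrib]
  rw [alt_cancel (fun v => c s α v (jet d u x)) (fun w τ => hc.alt s α w τ _)
    (fun l a => pD (addE (α l).2.1 a) (fun z => u z (α l).1) x)
    (fun l a b => pD (addE (addE (α l).2.1 a) b) (fun z => u z (α l).1) x)
    (fun l a b => by rw [addE_comm]), add_zero, Finset.sum_comm]
  refine Finset.sum_congr rfl fun w _ => ?_
  rw [Finset.sum_mul]

end Part11

open scoped BigOperators
section Part12

variable {n m : ℕ}

lemma sum_MD_succ (k : ℕ) (f : (Fin n → ℕ) → ℝ) :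
    ∑ K : MD n (k+1), f K.1 = ∑ J : MD n k, f J.1 +
      ∑ K : MD n (k+1), if (∑ i, K.1 i) = k+1 then f K.1 else 0 := by
  have h1 : ∑ J : MD n k, f J.1 = ∑ K : MD n (k+1), if (∑ i, K.1 i) = k+1 then 0 else f K.1 := by
    refine Fintype.sum_of_injective (fun J : MD n k => (⟨J.1, J.2.trans (Nat.le_succ k)⟩ : MD n (k+1)))
      (fun a b h => Subtype.ext (congrArg (fun z : MD n (k+1) => z.1) h)) _ _ ?_ ?_
    · intro K hK
      rw [if_pos]
      by_contra hne
      have := K.2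
      exact hK ⟨⟨K.1, by omega⟩, rfl⟩
    · intro J
      have := J.2
      rw [if_neg (by simp only; omega)]
  rw [h1, ← Finset.sum_add_distrib]
  refine Finset.sum_congr rfl fun K _ => ?_
  split_ifs <;> simp

lemma pD_addE' {f : (Fin n → ℝ) → ℝ} {U : Set (Fin n → ℝ)} (hf : Sm f U) (hU : IsOpen U)
    (K : Fin n → ℕ) (i : Fin n) : ∀ x ∈ U, pD (addE K i) f x = pD K (dd (Pi.single i 1) f) x := by
  intro x hx
  rw [pD, pdl, pD, pdl]
  have h1 : (mlist (addE K i)).Perm (mlist K ++ [i]) :=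
    (mlist_addE_perm K i).trans (List.perm_append_singleton i (mlist K)).symm
  rw [ddl_perm hf hU (h1.map _) x hx, List.map_append, ddl_append]
  rfl

open Classical in
noncomputable def Gred {k d : ℕ} (G : (Fin n → ℕ) → Jet n m (d+1) → ℝ) (c : MD n k → Fam n m d) :
    (Fin n → ℕ) → Jet n m (d+1) → ℝ := fun K p =>
  if h : (∑ i, K i) = k then G K p - HH (c ⟨K, h.le⟩) p else G K p

open Classical in
lemma Gred_null {k d : ℕ} {W : Set ((Fin n → ℝ) × (Fin m → ℝ))} (hW : IsOpen W)
    {G : (Fin n → ℕ) → Jet n m (d+1) → ℝ} (hG : ∀ K, Sm (G K) (Dset (d+1) W))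
    (hN : Null (d+1) (k+1) W G) (c : MD n k → Fam n m d) (hc : ∀ J, Good W (c J))
    (hc0 : ∀ J : MD n k, (∑ i, J.1 i) ≠ k → ∀ s α w p, c J s α w p = 0)
    (hGc : ∀ K : MD n (k+1), (∑ i, K.1 i) = k+1 → ∀ p ∈ Dset (d+1) W,
        G K.1 p = ∑ i, ∑ J : MD n k, if addE J.1 i = K.1 then FF (c J) i p else 0) :
    Null (d+1) k W (Gred G c) := by
  intro u hu x hx
  have hU := Udom_open hW hu
  have h1 := hN u hu x hx
  rw [sum_MD_succ k (fun K => (-1:ℝ)^(∑ i, K i) * pD K (fun y => G K (jet (d+1) u y)) x)] at h1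
  have hFs : ∀ J i, Sm (fun y => FF (c J) i (jet (d+1) u y)) (Udom W u) := fun J i =>
    (FF_sm (hc J) i).comp_jet hu
  have hHs : ∀ J, Sm (fun y => HH (c J) (jet (d+1) u y)) (Udom W u) := fun J =>
    (HH_sm hW (hc J)).comp_jet hu
  have hGs : ∀ K, Sm (fun y => G K (jet (d+1) u y)) (Udom W u) := fun K =>
    (hG K).comp_jet hu
  have hzeroF : ∀ J : MD n k, (∑ i, J.1 i) ≠ k → ∀ i p, FF (c J) i p = 0 := by
    intro J hJ i p
    simp [FF, hc0 J hJ]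
  have h2 : ∑ K : MD n (k+1), (if (∑ i, K.1 i) = k+1 then
      (-1:ℝ)^(∑ i, K.1 i) * pD K.1 (fun y => G K.1 (jet (d+1) u y)) x else 0) =
      ∑ J : MD n k, if (∑ i, J.1 i) = k then
        (-1:ℝ)^(k+1) * pD J.1 (fun y => HH (c J) (jet (d+1) u y)) x else 0 := by
    have e1 : ∀ K : MD n (k+1), (if (∑ i, K.1 i) = k+1 then
      (-1:ℝ)^(∑ i, K.1 i) * pD K.1 (fun y => G K.1 (jet (d+1) u y)) x else 0) =
      ∑ J : MD n k, ∑ i, if (∑ i, J.1 i) = k then (if addE J.1 i = K.1 then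
        (-1:ℝ)^(k+1) * pD (addE J.1 i) (fun y => FF (c J) i (jet (d+1) u y)) x else 0) else 0 := by
      intro K
      split_ifs with hK
      · have e2 : pD K.1 (fun y => G K.1 (jet (d+1) u y)) x = pD K.1 (fun y => ∑ i, ∑ J : MD n k,
            (if addE J.1 i = K.1 then 1 else 0) * FF (c J) i (jet (d+1) u y)) x := by
          refine ddl_congr hU (fun y hy => ?_) _ x hx
          rw [hGc K hK _ ((jet_mem _ u y W).2 hy)]
          simp only [ite_mul, one_mul, zero_mul]
        rw [e2, pD, pdl, ddl_sum _ (fun i _ => ContDiffOn.sum fun J _ =>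
          contDiffOn_const.mul (hFs J i)) hU _ x hx, hK, Finset.mul_sum, Finset.sum_comm]
        refine Finset.sum_congr rfl fun i _ => ?_
        rw [ddl_sum _ (fun J _ => contDiffOn_const.mul (hFs J i)) hU _ x hx, Finset.mul_sum]
        refine Finset.sum_congr rfl fun J _ => ?_
        rw [ddl_const_mul (hFs J i) hU _ _ x hx]
        by_cases hJi : addE J.1 i = K.1
        · have hJ : (∑ i, J.1 i) = k := by
            have := sum_addE J.1 i
            rw [hJi] at this
            omega
          rw [if_pos hJi, if_pos hJ, if_pos hJi, hJi, pD, pdl]; ring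
        · rw [if_neg hJi, if_neg hJi]
          simp
      · symm
        refine Finset.sum_eq_zero fun J _ => Finset.sum_eq_zero fun i _ => ?_
        split_ifs with hJ hJi
        · exfalso
          apply hK
          rw [← hJi, sum_addE, hJ]
        · rfl
        · rfl
    simp only [e1]
    rw [Finset.sum_comm]
    refine Finset.sum_congr rfl fun J _ => ?_
    rw [Finset.sum_comm]
    split_ifs with hJ
    · have e3 : pD J.1 (fun y => HH (c J) (jet (d+1) u y)) x =
          ∑ i, pD (addE J.1 i) (fun y => FF (c J) i (jet (d+1) u y)) x := by
        have e4 : pD J.1 (fun y => HH (c J) (jet (d+1) u y)) x =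
          pD J.1 (fun y => ∑ i, dd (Pi.single i 1) (fun y => FF (c J) i (jet (d+1) u y)) y) x :=
          ddl_congr hU (fun y hy => (div_FF hW (hc J) hu y hy).symm) _ x hx
        rw [e4, pD, pdl, ddl_sum _ (fun i _ => (hFs J i).dd hU _) hU _ x hx]
        refine Finset.sum_congr rfl fun i _ => ?_
        rw [pD_addE' (hFs J i) hU _ _ x hx]
        rfl
      rw [e3, Finset.mul_sum]
      refine Finset.sum_congr rfl fun i _ => ?_
      have hle : ∑ x, addE J.1 i x ≤ k+1 := by rw [sum_addE]; omega
      rw [Finset.sum_eq_single ⟨addE J.1 i, hle⟩]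
      · rw [if_pos rfl]
      · intro K _ hne
        rw [if_neg]
        intro hh
        exact hne (Subtype.ext hh.symm)
      · simp
    · simp
  rw [h2, ← Finset.sum_add_distrib] at h1
  refine Eq.trans ?_ h1
  refine Finset.sum_congr rfl fun K _ => ?_
  by_cases hK : (∑ i, K.1 i) = k
  · rw [if_pos hK]
    have e5 : (fun y => Gred G c K.1 (jet (d+1) u y)) =
        fun y => G K.1 (jet (d+1) u y) + (-1) * HH (c K) (jet (d+1) u y) := by
      funext y
      rw [Gred, dif_pos hK]
      ring
    rw [e5, pD, pdl, ddl_add (hGs K.1) (contDiffOn_const.mul (hHs K)) hU _ x hx,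
      ddl_const_mul (hHs K) hU _ _ x hx, pD, pdl, pD, pdl, hK, pow_succ]
    ring
  · rw [if_neg hK, add_zero]
    have e5 : (fun y => Gred G c K.1 (jet (d+1) u y)) = fun y => G K.1 (jet (d+1) u y) := by
      funext y
      rw [Gred, dif_neg hK]
    rw [e5]

lemma Gred_sm {k d : ℕ} {W : Set ((Fin n → ℝ) × (Fin m → ℝ))} (hW : IsOpen W)
    {G : (Fin n → ℕ) → Jet n m (d+1) → ℝ} (hG : ∀ K, Sm (G K) (Dset (d+1) W))
    (c : MD n k → Fam n m d) (hc : ∀ J, Good W (c J)) (K : Fin n → ℕ) :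
    Sm (Gred G c K) (Dset (d+1) W) := by
  by_cases hK : (∑ i, K i) = k
  · have : Gred G c K = fun p => G K p - HH (c ⟨K, hK.le⟩) p := by
      funext p; rw [Gred, dif_pos hK]
    rw [this]
    exact (hG K).sub (HH_sm hW (hc _))
  · have : Gred G c K = G K := by
      funext p; rw [Gred, dif_neg hK]
    rw [this]; exact hG K

lemma formalD_zero {d : ℕ} (i : Fin n) {f : Jet n m d → ℝ} (hf : ∀ p, f p = 0) (p) :
    formalD i f p = 0 := by
  have : f = fun _ => 0 := funext hf
  rw [formalD_eq, this]; simp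

lemma HH_zero {d : ℕ} {c : Fam n m d} (hc : ∀ s α w p, c s α w p = 0) (p) : HH c p = 0 := by
  unfold HH
  refine Finset.sum_eq_zero fun s _ => ?_
  simp only [formalD_zero _ (hc s _ _)]
  simp

lemma FF_zero {d : ℕ} {c : Fam n m d} (hc : ∀ s α w p, c s α w p = 0) (i p) : FF c i p = 0 := by
  simp [FF, hc]

open Classical in
lemma descent {d : ℕ} {W : Set ((Fin n → ℝ) × (Fin m → ℝ))} (hW : IsOpen W) (k : ℕ) :
    ∀ (G : (Fin n → ℕ) → Jet n m (d+1) → ℝ), (∀ K, Sm (G K) (Dset (d+1) W)) →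
    Null (d+1) k W G →
    ∃ c : (Fin n → ℕ) → Fam n m d, (∀ J, Good W (c J)) ∧
      (∀ J : Fin n → ℕ, k ≤ (∑ i, J i) → ∀ s α w p, c J s α w p = 0) ∧
      ∀ K : Fin n → ℕ, (∑ i, K i) ≤ k → ∀ p ∈ Dset (d+1) W,
        G K p = HH (c K) p + ∑ i, if 1 ≤ K i then FF (c (subE K i)) i p else 0 := by
  induction k with
  | zero =>
    intro G hG hN
    refine ⟨fun _ _ _ _ _ => 0, fun J => ⟨fun s α w => contDiffOn_const, by simp, by simp⟩, by simp, ?_⟩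
    intro K hK p hp
    rw [HH_zero (by simp)]
    simp only [FF_zero (d := d) (c := fun _ _ _ _ => 0) (by simp)]
    obtain ⟨u, hu, hju⟩ := exists_section (d+1) p
    have hx : p.1 ∈ Udom W u := by
      rw [← hju] at hp
      exact (jet_mem _ _ _ _).1 hp
    have h := hN u hu p.1 hx
    have hK0 : K = fun _ => 0 := by
      funext i
      have := Finset.single_le_sum (fun j _ => Nat.zero_le (K j)) (Finset.mem_univ i)
      omega
    subst hK0
    rw [Finset.sum_eq_single ⟨fun _ => 0, by simp⟩] at h
    · simp only [Finset.sum_const_zero, pow_zero, one_mul, pD_zero, hju] at h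
      simp [h]
    · intro b _ hb
      exfalso
      apply hb
      apply Subtype.ext
      funext i
      have := Finset.single_le_sum (fun j _ => Nat.zero_le (b.1 j)) (Finset.mem_univ i)
      have := b.2
      change b.1 i = 0
      omega
    · simp
  | succ k ih =>
    intro G hG hN
    obtain ⟨c1, hc1, hc10, hGc⟩ := structure_step hW hG hN
    obtain ⟨c2, hc2, hc20, hG2⟩ := ih (Gred G c1) (Gred_sm hW hG c1 hc1)
      (Gred_null hW hG hN c1 hc1 hc10 hGc)
    set c : (Fin n → ℕ) → Fam n m d := fun J => if h : (∑ i, J i) = k then c1 ⟨J, h.le⟩ else c2 J with hcdef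
    have hck : ∀ J (h : (∑ i, J i) = k), c J = c1 ⟨J, h.le⟩ := fun J h => by rw [hcdef]; simp only [dif_pos h]
    have hcn : ∀ J (h : (∑ i, J i) ≠ k), c J = c2 J := fun J h => by rw [hcdef]; simp only [dif_neg h]
    refine ⟨c, ?_, ?_, ?_⟩
    · intro J
      by_cases h : (∑ i, J i) = k
      · rw [hck J h]; exact hc1 _
      · rw [hcn J h]; exact hc2 _
    · intro J hJ
      rw [hcn J (by omega)]
      exact hc20 J (by omega)
    · intro K hK p hp
      rcases Nat.lt_or_ge k (∑ i, K i) with hlt | hge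
      · have hKk : (∑ i, K i) = k+1 := by omega
        rw [hcn K (by omega), HH_zero (hc20 K (by omega)), zero_add, hGc ⟨K, hK⟩ hKk p hp]
        refine Finset.sum_congr rfl fun i _ => ?_
        split_ifs with hi
        · have hs : (∑ j, subE K i j) = k := by have := sum_subE hi; omega
          rw [hck _ hs, Finset.sum_eq_single ⟨subE K i, hs.le⟩]
          · rw [if_pos (addE_subE hi)]
          · intro J _ hne
            rw [if_neg]
            intro hh
            apply hne
            apply Subtype.ext
            dsimp only at hh ⊢
            rw [← hh, subE_addE]
          · simp
        · refine Finset.sum_eq_zero fun J _ => ?_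
          rw [if_neg]
          intro hh
          apply hi
          dsimp only at hh
          rw [← hh]; simp [addE]
      · have h2 := hG2 K hge p hp
        have hs : ∀ i, (if 1 ≤ K i then FF (c (subE K i)) i p else 0) =
            if 1 ≤ K i then FF (c2 (subE K i)) i p else 0 := by
          intro i
          split_ifs with hi
          · rw [hcn]
            have := sum_subE hi; omega
          · rfl
        simp only [hs]
        rcases Nat.lt_or_ge (∑ i, K i) k with hlt2 | hge2
        · rw [hcn K (by omega), ← h2, Gred, dif_neg (by omega)]
        · have hKk : (∑ i, K i) = k := by omega
          rw [Gred, dif_pos hKk, HH_zero (hc20 K hge2), zero_add] at h2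
          rw [hck K hKk, ← h2]
          ring

end Part12

open scoped BigOperators
section Part13

section ParamInt
set_option linter.unusedSectionVars false
open MeasureTheory Set
variable {E F : Type} [NormedAddCommGroup E] [NormedSpace ℝ E] [FiniteDimensional ℝ E]
  [NormedAddCommGroup F] [NormedSpace ℝ F]

lemma slice_cont {Φ : ℝ × E → F} {V : Set (ℝ × E)} {U : Set E} (hΦ : ContinuousOn Φ V)
    (hVU : ∀ t ∈ Icc (0:ℝ) 1, ∀ x ∈ U, (t, x) ∈ V) {x : E} (hx : x ∈ U) :
    ContinuousOn (fun t => Φ (t, x)) (Icc 0 1) :=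
  hΦ.comp (by fun_prop) (fun t ht => hVU t ht x hx)

lemma slice_ii {Φ : ℝ × E → F} {V : Set (ℝ × E)} {U : Set E} (hΦ : ContinuousOn Φ V)
    (hVU : ∀ t ∈ Icc (0:ℝ) 1, ∀ x ∈ U, (t, x) ∈ V) {x : E} (hx : x ∈ U) :
    IntervalIntegrable (fun t => Φ (t, x)) volume 0 1 := by
  refine ContinuousOn.intervalIntegrable ?_
  rw [uIcc_of_le zero_le_one]
  exact slice_cont hΦ hVU hx

/-- derivative in the second variable -/
noncomputable def fd2 (Φ : ℝ × E → F) (q : ℝ × E) : E →L[ℝ] F :=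
  (fderiv ℝ Φ q).comp (ContinuousLinearMap.inr ℝ ℝ E)

lemma fd2_sm {Φ : ℝ × E → F} {V : Set (ℝ × E)} (hΦ : Sm Φ V) (hV : IsOpen V) :
    Sm (fd2 Φ) V :=
  (hΦ.fderiv hV).clm_comp contDiffOn_const

lemma fd2_has {Φ : ℝ × E → F} {V : Set (ℝ × E)} (hΦ : Sm Φ V) (hV : IsOpen V) {t : ℝ} {x : E}
    (h : (t, x) ∈ V) : HasFDerivAt (fun y => Φ (t, y)) (fd2 Φ (t, x)) x := by
  have h1 := (hΦ.diffAt hV h).hasFDerivAt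
  exact h1.comp x (hasFDerivAt_prodMk_right t x)

lemma pint_has {Φ : ℝ × E → F} {V : Set (ℝ × E)} {U : Set E} (hΦ : Sm Φ V) (hV : IsOpen V)
    (hU : IsOpen U) (hVU : ∀ t ∈ Icc (0:ℝ) 1, ∀ x ∈ U, (t, x) ∈ V) {x : E} (hx : x ∈ U) :
    HasFDerivAt (fun y => ∫ t in (0:ℝ)..1, Φ (t, y)) (∫ t in (0:ℝ)..1, fd2 Φ (t, x)) x := by
  have : ProperSpace E := FiniteDimensional.proper ℝ E
  obtain ⟨ε, hε, hball⟩ := Metric.nhds_basis_closedBall.mem_iff.1 (hU.mem_nhds hx)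
  have hc : ContinuousOn (fd2 Φ) V := (fd2_sm hΦ hV).continuousOn
  have hcomp : IsCompact (Icc (0:ℝ) 1 ×ˢ Metric.closedBall x ε) :=
    isCompact_Icc.prod (isCompact_closedBall x ε)
  obtain ⟨C, hC⟩ := hcomp.exists_bound_of_continuousOn
    (hc.mono (fun q hq => hVU q.1 hq.1 q.2 (hball hq.2)))
  have hsub : ∀ t ∈ uIoc (0:ℝ) 1, t ∈ Icc (0:ℝ) 1 := by
    intro t ht
    rw [uIoc_of_le zero_le_one] at ht
    exact ⟨ht.1.le, ht.2⟩
  refine intervalIntegral.hasFDerivAt_integral_of_dominated_of_fderiv_le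
    (F := fun y t => Φ (t, y)) (F' := fun y t => fd2 Φ (t, y)) (bound := fun _ => C)
    (s := Metric.closedBall x ε)
    (Metric.closedBall_mem_nhds x hε) ?_ ?_ ?_ ?_ ?_ ?_
  · filter_upwards [hU.mem_nhds hx] with y hy
    exact (intervalIntegrable_iff.1 (slice_ii hΦ.continuousOn hVU hy)).aestronglyMeasurable
  · exact slice_ii hΦ.continuousOn hVU hx
  · exact (intervalIntegrable_iff.1 (slice_ii hc hVU hx)).aestronglyMeasurable
  · refine Filter.Eventually.of_forall fun t ht y hy => hC (t, y) ⟨hsub t ht, hy⟩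
  · exact intervalIntegrable_const
  · refine Filter.Eventually.of_forall fun t ht y hy => fd2_has hΦ hV (hVU t (hsub t ht) y (hball hy))

lemma pint_contDiff (k : ℕ) {U : Set E} (hU : IsOpen U) {V : Set (ℝ × E)} (hV : IsOpen V)
    (hVU : ∀ t ∈ Icc (0:ℝ) 1, ∀ x ∈ U, (t, x) ∈ V) :
    ∀ (F : Type) [NormedAddCommGroup F] [NormedSpace ℝ F] (Φ : ℝ × E → F), Sm Φ V →
      ContDiffOn ℝ k (fun y => ∫ t in (0:ℝ)..1, Φ (t, y)) U := by
  induction k with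
  | zero =>
    intro F _ _ Φ hΦ
    refine contDiffOn_zero.2 fun x hx => ?_
    exact (pint_has hΦ hV hU hVU hx).continuousAt.continuousWithinAt
  | succ k ih =>
    intro F _ _ Φ hΦ
    have : ((k + 1 : ℕ) : WithTop ℕ∞) = (k : WithTop ℕ∞) + 1 := by simp
    rw [this, contDiffOn_succ_iff_fderiv_of_isOpen hU]
    refine ⟨fun x hx => (pint_has hΦ hV hU hVU hx).differentiableAt.differentiableWithinAt,
      fun h => ?_, ?_⟩
    · exact absurd h (by simp)
    · refine (ih _ (fd2 Φ) (fd2_sm hΦ hV)).congr fun x hx => (pint_has hΦ hV hU hVU hx).fderiv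

lemma pint_sm {U : Set E} (hU : IsOpen U) {V : Set (ℝ × E)} (hV : IsOpen V)
    (hVU : ∀ t ∈ Icc (0:ℝ) 1, ∀ x ∈ U, (t, x) ∈ V) {F : Type} [NormedAddCommGroup F]
    [NormedSpace ℝ F] {Φ : ℝ × E → F} (hΦ : Sm Φ V) :
    Sm (fun y => ∫ t in (0:ℝ)..1, Φ (t, y)) U := by
  refine contDiffOn_infty.2 fun k => pint_contDiff k hU hV hVU F Φ hΦ

lemma pint_dd {U : Set E} (hU : IsOpen U) {V : Set (ℝ × E)} (hV : IsOpen V)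
    (hVU : ∀ t ∈ Icc (0:ℝ) 1, ∀ x ∈ U, (t, x) ∈ V) {Φ : ℝ × E → ℝ} (hΦ : Sm Φ V) {x : E}
    (hx : x ∈ U) (v : E) :
    fderiv ℝ (fun y => ∫ t in (0:ℝ)..1, Φ (t, y)) x v =
      ∫ t in (0:ℝ)..1, fderiv ℝ (fun y => Φ (t, y)) x v := by
  rw [(pint_has hΦ hV hU hVU hx).fderiv]
  rw [ContinuousLinearMap.intervalIntegral_apply (slice_ii (fd2_sm hΦ hV).continuousOn hVU hx)]
  refine intervalIntegral.integral_congr fun t ht => ?_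
  rw [uIcc_of_le zero_le_one] at ht
  change _ = fderiv ℝ (fun y => Φ (t, y)) x v
  rw [(fd2_has hΦ hV (hVU t ht x hx)).fderiv]

lemma pint_ii {U : Set E} {V : Set (ℝ × E)} (hV : IsOpen V)
    (hVU : ∀ t ∈ Icc (0:ℝ) 1, ∀ x ∈ U, (t, x) ∈ V) {Φ : ℝ × E → ℝ} (hΦ : Sm Φ V) {x : E}
    (hx : x ∈ U) (v : E) :
    IntervalIntegrable (fun t => fderiv ℝ (fun y => Φ (t, y)) x v) volume 0 1 := by
  have h : Sm (fun q => fd2 Φ q v) V := (fd2_sm hΦ hV).clm_apply contDiffOn_const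
  refine (slice_ii h.continuousOn hVU hx).congr ?_
  intro t ht
  rw [uIoc_of_le zero_le_one] at ht
  change fd2 Φ (t, x) v = fderiv ℝ (fun y => Φ (t, y)) x v
  rw [(fd2_has hΦ hV (hVU t ⟨ht.1.le, ht.2⟩ x hx)).fderiv]

end ParamInt
end Part13

open scoped BigOperators
section Part14
variable {n m : ℕ}
open MeasureTheory

noncomputable def zeta (zy : Fin m → ℝ) {r : ℕ} (q : JIdx n m r) : ℝ :=
  if (∑ i, q.2.1 i) = 0 then zy q.1 else 0

noncomputable def chi (zy : Fin m → ℝ) (t : ℝ) {r : ℕ} (p : Jet n m r) : Jet n m r :=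
  (p.1, fun q => zeta zy q + t * (p.2 q - zeta zy q))

lemma chi_proj (zy : Fin m → ℝ) (t : ℝ) {r s : ℕ} (h : r ≤ s) (p : Jet n m s) :
    projJet h (chi zy t p) = chi zy t (projJet h p) := rfl

lemma chi_one (zy : Fin m → ℝ) {r : ℕ} (p : Jet n m r) : chi zy 1 p = p := by
  refine Prod.ext rfl ?_
  funext q
  simp [chi]

lemma yc_chi (zy : Fin m → ℝ) (t : ℝ) {r : ℕ} (p : Jet n m r) (σ : Fin m) (K : Fin n → ℕ)
    (hK : 1 ≤ ∑ i, K i) : yc σ K (chi zy t p) = t * yc σ K p := by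
  by_cases h : (∑ i, K i) ≤ r
  · rw [yc_of_le _ _ _ h, yc_of_le _ _ _ h]
    have : (∑ i, K i) ≠ 0 := by omega
    simp only [chi, zeta, if_neg this]; ring
  · rw [yc, yc, dif_neg h, dif_neg h, mul_zero]

lemma chi_contDiff (zy : Fin m → ℝ) (r : ℕ) :
    ContDiff ℝ (⊤:ℕ∞) (fun q : ℝ × Jet n m r => chi zy q.1 q.2) := by
  unfold chi
  fun_prop

lemma yc_chi_zero (zy : Fin m → ℝ) (t : ℝ) {r : ℕ} (p : Jet n m r) (σ : Fin m) :
    yc σ (fun _ => 0) (chi zy t p) = zy σ + t * (yc σ (fun _ => 0) p - zy σ) := by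
  rw [yc_of_le _ _ _ (by simp), yc_of_le _ _ _ (by simp)]
  simp [chi, zeta]

lemma chi_mem (z : (Fin n → ℝ) × (Fin m → ℝ)) (ε : ℝ) {t : ℝ} (ht : t ∈ Set.Icc (0:ℝ) 1)
    {r : ℕ} {p : Jet n m r} (hp : p ∈ Dset r (Metric.ball z ε)) :
    chi z.2 t p ∈ Dset r (Metric.ball z ε) := by
  unfold Dset at hp ⊢
  simp only [Set.mem_ofPred_eq] at hp ⊢
  rw [Metric.mem_ball, Prod.dist_eq, max_lt_iff] at hp ⊢
  refine ⟨hp.1, ?_⟩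
  have hε : 0 < ε := dist_nonneg.trans_lt hp.1
  have h2 := hp.2
  simp only at h2 ⊢
  rw [dist_pi_lt_iff hε] at h2 ⊢
  intro σ
  refine lt_of_le_of_lt ?_ (h2 σ)
  rw [yc_chi_zero, Real.dist_eq, Real.dist_eq, add_sub_cancel_left, abs_mul, abs_of_nonneg ht.1]
  exact mul_le_of_le_one_left (abs_nonneg _) ht.2

lemma chi_has (zy : Fin m → ℝ) (t : ℝ) {r : ℕ} (p : Jet n m r) :
    HasFDerivAt (chi zy t : Jet n m r → Jet n m r)
      ((ContinuousLinearMap.fst ℝ _ _).prod (t • ContinuousLinearMap.snd ℝ _ _)) p := by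
  have h2 : HasFDerivAt (fun p : Jet n m r => fun q => zeta zy q + t * (p.2 q - zeta zy q))
      (t • ContinuousLinearMap.snd ℝ _ _) p := by
    have h3 := ((((hasFDerivAt_snd (𝕜 := ℝ) (p := p)).sub_const (zeta zy)).const_smul t).const_add
      (zeta zy))
    exact h3
  exact hasFDerivAt_fst.prodMk h2

lemma formalD_chi (zy : Fin m → ℝ) (t : ℝ) {r : ℕ} (i : Fin n) (f : Jet n m r → ℝ)
    (p : Jet n m (r+1)) (hf : DifferentiableAt ℝ f (chi zy t (projJet (Nat.le_succ r) p))) :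
    formalD i (fun p' => f (chi zy t p')) p = formalD i f (chi zy t p) := by
  rw [formalD_eq, formalD_eq, chi_proj]
  have h := hf.hasFDerivAt.comp _ (chi_has zy t (projJet (Nat.le_succ r) p))
  have h' : fderiv ℝ (fun p' => f (chi zy t p')) (projJet (Nat.le_succ r) p) = _ := h.fderiv
  rw [h']
  change fderiv ℝ f _ _ = _
  congr 1
  refine Prod.ext rfl ?_
  funext q
  change t * yc q.1 (addE q.2.1 i) p = yc q.1 (addE q.2.1 i) (chi zy t p)
  rw [yc_chi]
  rw [sum_addE]; omega

lemma formalD_mul {r : ℕ} (i : Fin n) {f g : Jet n m r → ℝ} (p : Jet n m (r+1))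
    (hf : DifferentiableAt ℝ f (projJet (Nat.le_succ r) p))
    (hg : DifferentiableAt ℝ g (projJet (Nat.le_succ r) p)) :
    formalD i (fun p' => f p' * g p') p =
      formalD i f p * g (projJet (Nat.le_succ r) p) + f (projJet (Nat.le_succ r) p) * formalD i g p := by
  rw [formalD_eq, formalD_eq, formalD_eq, fderiv_fun_mul hf hg]
  simp; ring

lemma formalD_coord {r : ℕ} (i : Fin n) (q : JIdx n m r) (b : ℝ) (p : Jet n m (r+1)) :
    formalD i (fun p' : Jet n m r => p'.2 q - b) p = yc q.1 (addE q.2.1 i) p := by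
  rw [formalD_eq]
  have h : HasFDerivAt (fun p' : Jet n m r => p'.2 q - b)
      ((ContinuousLinearMap.proj q).comp (ContinuousLinearMap.snd ℝ _ _))
      (projJet (Nat.le_succ r) p) := by
    have := (((ContinuousLinearMap.proj (R := ℝ) (φ := fun _ : JIdx n m r => ℝ) q).comp
      (ContinuousLinearMap.snd ℝ (Fin n → ℝ) _)).hasFDerivAt
        (x := projJet (Nat.le_succ r) p)).sub_const b
    exact this
  rw [h.fderiv]; rfl

/-- the homotopy integrand -/
noncomputable def atF {d : ℕ} (zy : Fin m → ℝ) (c : Fin m → (Fin n → ℕ) → Fam n m d) (t : ℝ) :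
    Fam n m d := fun s α w p' =>
  t ^ s * ∑ q : JIdx n m d, (p'.2 q - zeta zy q) * c q.1 q.2.1 s α w (chi zy t p')

lemma formalD_atF {d : ℕ} {W : Set ((Fin n → ℝ) × (Fin m → ℝ))} (hW : IsOpen W)
    (zy : Fin m → ℝ) {c : Fin m → (Fin n → ℕ) → Fam n m d} (hc : ∀ σ K, Good W (c σ K))
    (t : ℝ) (s : ℕ) (α) (w) (i : Fin n) (p : Jet n m (d+1)) (hp : chi zy t p ∈ Dset (d+1) W) :
    formalD i (atF zy c t s α w) p = t ^ s * ∑ q : JIdx n m d,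
      (yc q.1 (addE q.2.1 i) p * c q.1 q.2.1 s α w (projJet (Nat.le_succ d) (chi zy t p))
        + (yc q.1 q.2.1 p - zeta zy q) * formalD i (c q.1 q.2.1 s α w) (chi zy t p)) := by
  have hp' : chi zy t (projJet (Nat.le_succ d) p) ∈ Dset d W := by
    rw [← chi_proj, mem_Dset_proj]; exact hp
  have hd : ∀ q : JIdx n m d, DifferentiableAt ℝ (c q.1 q.2.1 s α w)
      (chi zy t (projJet (Nat.le_succ d) p)) :=
    fun q => ((hc q.1 q.2.1).sm s α w).diffAt (Dset_open d hW) hp'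
  have hd2 : ∀ q : JIdx n m d, DifferentiableAt ℝ (fun p' => c q.1 q.2.1 s α w (chi zy t p'))
      (projJet (Nat.le_succ d) p) :=
    fun q => (hd q).comp _ (chi_has zy t _).differentiableAt
  have hd1 : ∀ q : JIdx n m d, DifferentiableAt ℝ (fun p' : Jet n m d => p'.2 q - zeta zy q)
      (projJet (Nat.le_succ d) p) := fun q => by fun_prop
  have h1 : formalD i (atF zy c t s α w) p = t ^ s * ∑ q : JIdx n m d,
      formalD i (fun p' => (p'.2 q - zeta zy q) * c q.1 q.2.1 s α w (chi zy t p')) p := by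
    have : fderiv ℝ (atF zy c t s α w) (projJet (Nat.le_succ d) p) = t ^ s • ∑ q : JIdx n m d,
        fderiv ℝ (fun p' => (p'.2 q - zeta zy q) * c q.1 q.2.1 s α w (chi zy t p'))
          (projJet (Nat.le_succ d) p) := by
      unfold atF
      rw [fderiv_const_mul, fderiv_fun_sum]
      · exact fun q _ => (hd1 q).mul (hd2 q)
      · exact DifferentiableAt.fun_sum fun q _ => (hd1 q).mul (hd2 q)
    rw [formalD_eq, this]
    simp [formalD_eq]
  rw [h1]
  congr 1
  refine Finset.sum_congr rfl fun q _ => ?_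
  rw [formalD_mul i p (hd1 q) (hd2 q), formalD_coord, formalD_chi _ _ _ _ _ (hd q), chi_proj]
  congr 2
  congr 1
  rw [yc_of_le _ _ _ (q.2.2.trans (Nat.le_succ d))]; rfl

end Part14

open scoped BigOperators
section Part15
variable {n m : ℕ}
open MeasureTheory

/-- the weighted sum occurring in `HH` and `FF` -/
noncomputable def Lf {d : ℕ} (g : (s : ℕ) → (Fin s → JIdx n m d) → (Fin s → Fin n) → ℝ) : ℝ :=
  ∑ s ∈ Finset.range n, (s.factorial : ℝ)⁻¹ * ∑ α : Fin s → JIdx n m d, ∑ w : Fin s → Fin n,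
    g s α w

lemma Lf_sum {d : ℕ} {ι : Type*} (S : Finset ι)
    (g : ι → (s : ℕ) → (Fin s → JIdx n m d) → (Fin s → Fin n) → ℝ) :
    Lf (fun s α w => ∑ k ∈ S, g k s α w) = ∑ k ∈ S, Lf (g k) := by
  unfold Lf
  rw [Finset.sum_comm]
  refine Finset.sum_congr rfl fun s _ => ?_
  rw [← Finset.mul_sum]
  congr 1
  symm
  rw [Finset.sum_comm]
  refine Finset.sum_congr rfl fun α _ => ?_
  exact Finset.sum_comm

lemma Lf_add {d : ℕ} (g h : (s : ℕ) → (Fin s → JIdx n m d) → (Fin s → Fin n) → ℝ) :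
    Lf (fun s α w => g s α w + h s α w) = Lf g + Lf h := by
  unfold Lf
  simp only [Finset.sum_add_distrib, mul_add]

lemma Lf_mul {d : ℕ} (a : ℝ) (g : (s : ℕ) → (Fin s → JIdx n m d) → (Fin s → Fin n) → ℝ) :
    Lf (fun s α w => a * g s α w) = a * Lf g := by
  unfold Lf
  rw [Finset.mul_sum]
  refine Finset.sum_congr rfl fun s _ => ?_
  simp only [← Finset.mul_sum]; ring

lemma Lf_int {d : ℕ} (g : ℝ → (s : ℕ) → (Fin s → JIdx n m d) → (Fin s → Fin n) → ℝ)
    (hg : ∀ s α w, IntervalIntegrable (fun t => g t s α w) volume 0 1) :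
    Lf (fun s α w => ∫ t in (0:ℝ)..1, g t s α w) = ∫ t in (0:ℝ)..1, Lf (g t) := by
  unfold Lf
  have h1 : ∀ s α, IntervalIntegrable (fun t => ∑ w, g t s α w) volume 0 1 := fun s α => by
    have := IntervalIntegrable.sum (μ := volume) (a := 0) (b := 1) Finset.univ
      (f := fun w t => g t s α w) (fun w _ => hg s α w)
    simpa [Finset.sum_fn] using this
  have h2 : ∀ s, IntervalIntegrable (fun t => ∑ α, ∑ w, g t s α w) volume 0 1 := fun s => by
    have := IntervalIntegrable.sum (μ := volume) (a := 0) (b := 1) Finset.univ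
      (f := fun α t => ∑ w, g t s α w) (fun α _ => h1 s α)
    simpa [Finset.sum_fn] using this
  rw [intervalIntegral.integral_finsetSum (fun s _ => (h2 s).const_mul _)]
  refine Finset.sum_congr rfl fun s _ => ?_
  rw [intervalIntegral.integral_const_mul]
  congr 1
  rw [intervalIntegral.integral_finsetSum (fun α _ => h1 s α)]
  refine Finset.sum_congr rfl fun α _ => ?_
  rw [intervalIntegral.integral_finsetSum (fun w _ => hg s α w)]

lemma yprod_chi {d s : ℕ} (zy : Fin m → ℝ) (t : ℝ) (α : Fin s → JIdx n m d) (w : Fin s → Fin n)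
    (p : Jet n m (d+1)) : yprod α w (chi zy t p) = t ^ s * yprod α w p := by
  unfold yprod
  have : ∀ l, yc (α l).1 (addE (α l).2.1 (w l)) (chi zy t p) =
      t * yc (α l).1 (addE (α l).2.1 (w l)) p := fun l => by
    rw [yc_chi]; rw [sum_addE]; omega
  simp only [this, Finset.prod_mul_distrib, Finset.prod_const, Finset.card_univ, Fintype.card_fin]

lemma HH_atF {d : ℕ} {W : Set ((Fin n → ℝ) × (Fin m → ℝ))} (hW : IsOpen W)
    (zy : Fin m → ℝ) {c : Fin m → (Fin n → ℕ) → Fam n m d} (hc : ∀ σ K, Good W (c σ K))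
    (t : ℝ) (p : Jet n m (d+1)) (hp : chi zy t p ∈ Dset (d+1) W) :
    HH (atF zy c t) p = ∑ q : JIdx n m d,
      ((yc q.1 q.2.1 p - zeta zy q) * HH (c q.1 q.2.1) (chi zy t p) +
        ∑ i, yc q.1 (addE q.2.1 i) p * FF (c q.1 q.2.1) i (chi zy t p)) := by
  have hH : ∀ (c : Fam n m d) p, HH c p =
    Lf (fun s α w => (∑ i, formalD i (c s α (Fin.cons i w)) p) * yprod α w p) := fun _ _ => rfl
  have hF : ∀ (c : Fam n m d) i p, FF c i p =
    Lf (fun s α w => c s α (Fin.cons i w) (projJet (Nat.le_succ d) p) * yprod α w p) :=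
      fun _ _ _ => rfl
  simp only [hH, hF, ← Lf_mul, ← Lf_sum, ← Lf_add]
  congr 1
  funext s α w
  simp only [formalD_atF hW zy hc t s α _ _ p hp, yprod_chi]
  rw [← Finset.mul_sum, Finset.sum_comm, Finset.mul_sum, Finset.sum_mul]
  refine Finset.sum_congr rfl fun q _ => ?_
  rw [Finset.sum_add_distrib, ← Finset.mul_sum, mul_add, add_mul, add_comm]
  congr 1
  · ring
  · rw [Finset.mul_sum, Finset.sum_mul]
    refine Finset.sum_congr rfl fun i _ => ?_
    ring

lemma sum_shift {d : ℕ} (i : Fin n) (Y : Fin m → (Fin n → ℕ) → ℝ) (f : Fin m → (Fin n → ℕ) → ℝ) :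
    ∑ κ : JIdx n m (d+1), Y κ.1 κ.2.1 * (if 1 ≤ κ.2.1 i then f κ.1 (subE κ.2.1 i) else 0) =
      ∑ q : JIdx n m d, Y q.1 (addE q.2.1 i) * f q.1 q.2.1 := by
  symm
  refine Fintype.sum_of_injective
    (fun q : JIdx n m d => ((q.1, ⟨addE q.2.1 i, by rw [sum_addE]; exact Nat.succ_le_succ q.2.2⟩) :
      JIdx n m (d+1))) ?_ _ _ ?_ ?_
  · intro q q' h
    simp only [Prod.mk.injEq, Subtype.mk.injEq] at h
    refine Prod.ext h.1 (Subtype.ext ?_)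
    rw [← subE_addE q.2.1 i, h.2, subE_addE]
  · intro κ hκ
    rw [if_neg, mul_zero]
    intro h1
    refine hκ ⟨(κ.1, ⟨subE κ.2.1 i, ?_⟩), ?_⟩
    · have := sum_subE h1
      have := κ.2.2
      omega
    · refine Prod.ext rfl (Subtype.ext ?_)
      exact addE_subE h1
  · intro q
    simp only
    rw [if_pos, subE_addE]
    simp [addE]

lemma sum_low {d : ℕ} (f : Fin m → (Fin n → ℕ) → ℝ) (hf : ∀ σ K, (∑ i, K i) = d+1 → f σ K = 0) :
    ∑ κ : JIdx n m (d+1), f κ.1 κ.2.1 = ∑ q : JIdx n m d, f q.1 q.2.1 := by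
  symm
  refine Fintype.sum_of_injective
    (fun q : JIdx n m d => ((q.1, ⟨q.2.1, q.2.2.trans (Nat.le_succ d)⟩) :
      JIdx n m (d+1))) ?_ _ _ ?_ ?_
  · intro q q' h
    simp only [Prod.mk.injEq, Subtype.mk.injEq] at h
    exact Prod.ext h.1 (Subtype.ext h.2)
  · intro κ hκ
    refine hf _ _ ?_
    by_contra h1
    refine hκ ⟨(κ.1, ⟨κ.2.1, ?_⟩), rfl⟩
    have := κ.2.2
    omega
  · intro q; rfl

lemma HH_atF2 {d : ℕ} {W : Set ((Fin n → ℝ) × (Fin m → ℝ))} (hW : IsOpen W)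
    (zy : Fin m → ℝ) {c : Fin m → (Fin n → ℕ) → Fam n m d} (hc : ∀ σ K, Good W (c σ K))
    (hz : ∀ σ (J : Fin n → ℕ), d + 1 ≤ (∑ i, J i) → ∀ s α w p, c σ J s α w p = 0)
    {L : Jet n m (d+1) → ℝ}
    (hL : ∀ σ (K : Fin n → ℕ), (∑ i, K i) ≤ d+1 → ∀ p ∈ Dset (d+1) W,
        pdY σ K L p = HH (c σ K) p + ∑ i, if 1 ≤ K i then FF (c σ (subE K i)) i p else 0)
    (t : ℝ) (p : Jet n m (d+1)) (hp : chi zy t p ∈ Dset (d+1) W) :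
    HH (atF zy c t) p = fderiv ℝ L (chi zy t p) (0, fun κ => p.2 κ - zeta zy κ) := by
  have hz' : ((0 : Fin n → ℝ), (0 : JIdx n m (d+1) → ℝ)) = 0 := rfl
  rw [vec_expand, hz', zero_add, map_sum]
  have e1 : ∀ κ : JIdx n m (d+1), fderiv ℝ L (chi zy t p)
      ((p.2 κ - zeta zy κ) • ((0, Pi.single κ 1) : Jet n m (d+1))) =
      (yc κ.1 κ.2.1 p - (if (∑ i, κ.2.1 i) = 0 then zy κ.1 else 0)) *
        HH (c κ.1 κ.2.1) (chi zy t p) +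
      ∑ i, yc κ.1 κ.2.1 p * (if 1 ≤ κ.2.1 i then FF (c κ.1 (subE κ.2.1 i)) i (chi zy t p) else 0) := by
    intro κ
    have h1 := hL κ.1 κ.2.1 κ.2.2 _ hp
    rw [pdY_eq, dd] at h1
    rw [map_smul, h1, yc_of_le _ _ _ κ.2.2, smul_eq_mul, mul_add]
    congr 1
    rw [Finset.mul_sum]
    refine Finset.sum_congr rfl fun i _ => ?_
    split_ifs with hi
    · rw [zeta, if_neg, sub_zero]
      have := sum_subE hi
      omega
    · simp
  rw [Finset.sum_congr rfl fun κ _ => e1 κ, Finset.sum_add_distrib, Finset.sum_comm]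
  rw [sum_low (fun σ K => (yc σ K p - (if (∑ i, K i) = 0 then zy σ else 0)) *
        HH (c σ K) (chi zy t p))]
  · rw [Finset.sum_congr rfl fun i _ => sum_shift i (fun σ K => yc σ K p)
      (fun σ K => FF (c σ K) i (chi zy t p))]
    rw [Finset.sum_comm, ← Finset.sum_add_distrib, HH_atF hW zy hc t p hp]
    rfl
  · intro σ K hK
    rw [HH_zero (hz σ K hK.ge), mul_zero]

end Part15

open scoped BigOperators
section Part16
variable {n m : ℕ}
open MeasureTheory

lemma Dset_mono {t : ℕ} {W W' : Set ((Fin n → ℝ) × (Fin m → ℝ))} (h : W' ⊆ W) :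
    Dset t W' ⊆ Dset t W := fun _ hp => h hp

def VV (d : ℕ) (zy : Fin m → ℝ) (W : Set ((Fin n → ℝ) × (Fin m → ℝ))) : Set (ℝ × Jet n m d) :=
  {q | chi zy q.1 q.2 ∈ Dset d W}

lemma VV_open (d : ℕ) (zy : Fin m → ℝ) {W : Set ((Fin n → ℝ) × (Fin m → ℝ))} (hW : IsOpen W) :
    IsOpen (VV d zy W) := (Dset_open d hW).preimage (chi_contDiff zy d).continuous

lemma VV_mem (d : ℕ) {z : (Fin n → ℝ) × (Fin m → ℝ)} {ε : ℝ}
    {W : Set ((Fin n → ℝ) × (Fin m → ℝ))} (hb : Metric.ball z ε ⊆ W) :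
    ∀ t ∈ Set.Icc (0:ℝ) 1, ∀ x ∈ Dset d (Metric.ball z ε), (t, x) ∈ VV d z.2 W :=
  fun _ ht _ hx => Dset_mono hb (chi_mem z ε ht hx)

lemma atF_sm {d : ℕ} {W : Set ((Fin n → ℝ) × (Fin m → ℝ))}
    (zy : Fin m → ℝ) {c : Fin m → (Fin n → ℕ) → Fam n m d} (hc : ∀ σ K, Good W (c σ K))
    (s : ℕ) (α) (w) : Sm (fun q : ℝ × Jet n m d => atF zy c q.1 s α w q.2) (VV d zy W) := by
  unfold atF
  refine ContDiffOn.mul (by fun_prop) (ContDiffOn.sum fun κ _ => ContDiffOn.mul (by fun_prop) ?_)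
  exact ((hc κ.1 κ.2.1).sm s α w).comp (chi_contDiff zy d).contDiffOn (fun q hq => hq)

/-- the homotopy potential -/
noncomputable def aF {d : ℕ} (zy : Fin m → ℝ) (c : Fin m → (Fin n → ℕ) → Fam n m d) :
    Fam n m d := fun s α w p' => ∫ t in (0:ℝ)..1, atF zy c t s α w p'

lemma aF_good {d : ℕ} {W : Set ((Fin n → ℝ) × (Fin m → ℝ))} (hW : IsOpen W)
    {z : (Fin n → ℝ) × (Fin m → ℝ)} {ε : ℝ} (hb : Metric.ball z ε ⊆ W)
    {c : Fin m → (Fin n → ℕ) → Fam n m d} (hc : ∀ σ K, Good W (c σ K)) :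
    Good (Metric.ball z ε) (aF z.2 c) where
  sm s α w := pint_sm (Dset_open d Metric.isOpen_ball) (VV_open d z.2 hW) (VV_mem d hb)
    (atF_sm z.2 hc s α w)
  alt s α w τ p := by
    unfold aF
    rw [← intervalIntegral.integral_const_mul]
    congr 1
    funext t
    unfold atF
    simp only [(hc _ _).alt s α w τ]
    rw [Finset.mul_sum, Finset.mul_sum, Finset.mul_sum]
    refine Finset.sum_congr rfl fun q _ => ?_
    ring
  top s α w p h := by
    unfold aF atF
    simp only [(hc _ _).top s α w _ h]
    simp

lemma HH_aF {d : ℕ} {W : Set ((Fin n → ℝ) × (Fin m → ℝ))} (hW : IsOpen W)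
    {z : (Fin n → ℝ) × (Fin m → ℝ)} {ε : ℝ} (hb : Metric.ball z ε ⊆ W)
    {c : Fin m → (Fin n → ℕ) → Fam n m d} (hc : ∀ σ K, Good W (c σ K))
    (p : Jet n m (d+1)) (hp : p ∈ Dset (d+1) (Metric.ball z ε)) :
    HH (aF z.2 c) p = ∫ t in (0:ℝ)..1, HH (atF z.2 c t) p := by
  have hp' : projJet (Nat.le_succ d) p ∈ Dset d (Metric.ball z ε) := (mem_Dset_proj _ _ _).2 hp
  have hU := Dset_open d (Metric.isOpen_ball (x := z) (ε := ε))
  have hfd : ∀ i s α w, formalD i (aF z.2 c s α w) p =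
      ∫ t in (0:ℝ)..1, formalD i (atF z.2 c t s α w) p := by
    intro i s α w
    simp only [formalD_eq]
    exact pint_dd hU (VV_open d z.2 hW) (VV_mem d hb) (atF_sm z.2 hc s α w) hp' (fdir i p)
  have hii : ∀ i s α w, IntervalIntegrable
      (fun t => formalD i (atF z.2 c t s α w) p) volume 0 1 := by
    intro i s α w
    simp only [formalD_eq]
    exact pint_ii (VV_open d z.2 hW) (VV_mem d hb) (atF_sm z.2 hc s α w) hp' (fdir i p)
  have hsi : ∀ s α w, IntervalIntegrable
      (fun t => ∑ i, formalD i (atF z.2 c t s α (Fin.cons i w)) p) volume 0 1 := fun s α w => by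
    have := IntervalIntegrable.sum (μ := volume) (a := 0) (b := 1) Finset.univ
      (f := fun i t => formalD i (atF z.2 c t s α (Fin.cons i w)) p) (fun i _ => hii i s α _)
    simpa [Finset.sum_fn] using this
  have hH : ∀ (c : Fam n m d) p, HH c p =
    Lf (fun s α w => (∑ i, formalD i (c s α (Fin.cons i w)) p) * yprod α w p) := fun _ _ => rfl
  simp only [hH]
  rw [← Lf_int _ (fun s α w => (hsi s α w).mul_const _)]
  congr 1
  funext s α w
  rw [intervalIntegral.integral_mul_const,
    intervalIntegral.integral_finsetSum (fun i _ => hii i s α _)]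
  simp only [hfd]

lemma chi_hasDeriv (zy : Fin m → ℝ) {r : ℕ} (p : Jet n m r) (t : ℝ) :
    HasDerivAt (fun t => chi zy t p) (0, fun κ => p.2 κ - zeta zy κ) t := by
  refine HasDerivAt.prodMk (hasDerivAt_const _ _) ?_
  refine hasDerivAt_pi.2 fun q => ?_
  simpa using ((hasDerivAt_id t).mul_const (p.2 q - zeta zy q)).const_add (zeta zy q)

lemma HH_aF_eq {d : ℕ} {W : Set ((Fin n → ℝ) × (Fin m → ℝ))} (hW : IsOpen W)
    {z : (Fin n → ℝ) × (Fin m → ℝ)} {ε : ℝ} (hb : Metric.ball z ε ⊆ W)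
    {c : Fin m → (Fin n → ℕ) → Fam n m d} (hc : ∀ σ K, Good W (c σ K))
    (hz : ∀ σ (J : Fin n → ℕ), d + 1 ≤ (∑ i, J i) → ∀ s α w p, c σ J s α w p = 0)
    {L : Jet n m (d+1) → ℝ} (hLs : Sm L (Dset (d+1) W))
    (hL : ∀ σ (K : Fin n → ℕ), (∑ i, K i) ≤ d+1 → ∀ p ∈ Dset (d+1) W,
        pdY σ K L p = HH (c σ K) p + ∑ i, if 1 ≤ K i then FF (c σ (subE K i)) i p else 0)
    (p : Jet n m (d+1)) (hp : p ∈ Dset (d+1) (Metric.ball z ε)) :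
    L p = HH (aF z.2 c) p + L (chi z.2 0 p) := by
  have hmem : ∀ t ∈ Set.Icc (0:ℝ) 1, chi z.2 t p ∈ Dset (d+1) W :=
    fun t ht => Dset_mono hb (chi_mem z ε ht hp)
  have hO := Dset_open (d+1) hW
  have h1 : HH (aF z.2 c) p = ∫ t in (0:ℝ)..1,
      fderiv ℝ L (chi z.2 t p) (0, fun κ => p.2 κ - zeta z.2 κ) := by
    rw [HH_aF hW hb hc p hp]
    refine intervalIntegral.integral_congr fun t ht => ?_
    rw [Set.uIcc_of_le zero_le_one] at ht
    exact HH_atF2 hW z.2 hc hz hL t p (hmem t ht)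
  have h2 := intervalIntegral.integral_eq_sub_of_hasDerivAt (a := 0) (b := 1)
    (f := fun t => L (chi z.2 t p))
    (f' := fun t => fderiv ℝ L (chi z.2 t p) (0, fun κ => p.2 κ - zeta z.2 κ)) ?_ ?_
  · rw [h1, h2, chi_one]; ring
  · intro t ht
    rw [Set.uIcc_of_le zero_le_one] at ht
    exact (hLs.diffAt hO (hmem t ht)).hasFDerivAt.comp_hasDerivAt t (chi_hasDeriv z.2 p t)
  · refine ContinuousOn.intervalIntegrable ?_
    rw [Set.uIcc_of_le zero_le_one]
    refine ContinuousOn.clm_apply ?_ continuousOn_const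
    refine (hLs.fderiv hO).continuousOn.comp ?_ hmem
    exact fun t _ => (chi_hasDeriv z.2 p t).continuousAt.continuousWithinAt

/-- restricting a single coordinate -/
noncomputable def eta (i₀ : Fin n) (b t : ℝ) (x : Fin n → ℝ) : Fin n → ℝ :=
  x + ((t - 1) * (x i₀ - b)) • Pi.single i₀ 1

lemma eta_one (i₀ : Fin n) (b : ℝ) (x : Fin n → ℝ) : eta i₀ b 1 x = x := by simp [eta]

lemma eta_mem (i₀ : Fin n) (b : Fin n → ℝ) (ε : ℝ) {t : ℝ} (ht : t ∈ Set.Icc (0:ℝ) 1)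
    {x : Fin n → ℝ} (hx : x ∈ Metric.ball b ε) : eta i₀ (b i₀) t x ∈ Metric.ball b ε := by
  rw [Metric.mem_ball] at hx ⊢
  have hε : 0 < ε := dist_nonneg.trans_lt hx
  rw [dist_pi_lt_iff hε] at hx ⊢
  intro i
  by_cases h : i = i₀
  · subst h
    refine lt_of_le_of_lt ?_ (hx i)
    have : eta i (b i) t x i - b i = t * (x i - b i) := by simp [eta]; ring
    rw [Real.dist_eq, Real.dist_eq, this, abs_mul, abs_of_nonneg ht.1]
    exact mul_le_of_le_one_left (abs_nonneg _) ht.2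
  · have : eta i₀ (b i₀) t x i = x i := by simp [eta, h]
    rw [this]; exact hx i

/-- primitive in one coordinate -/
lemma exists_prim (i₀ : Fin n) (b : Fin n → ℝ) (ε : ℝ) {O : Set (Fin n → ℝ)} (hO : IsOpen O)
    (hb : Metric.ball b ε ⊆ O) {f : (Fin n → ℝ) → ℝ} (hf : Sm f O) :
    ∃ B : (Fin n → ℝ) → ℝ, Sm B (Metric.ball b ε) ∧
      ∀ x ∈ Metric.ball b ε, fderiv ℝ B x (Pi.single i₀ 1) = f x := by
  have hetas : ContDiff ℝ (⊤:ℕ∞) (fun q : ℝ × (Fin n → ℝ) => eta i₀ (b i₀) q.1 q.2) := by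
    unfold eta; fun_prop
  set V : Set (ℝ × (Fin n → ℝ)) := {q | eta i₀ (b i₀) q.1 q.2 ∈ O} with hV
  have hVo : IsOpen V := hO.preimage hetas.continuous
  have hVU : ∀ t ∈ Set.Icc (0:ℝ) 1, ∀ x ∈ Metric.ball b ε, (t, x) ∈ V :=
    fun t ht x hx => hb (eta_mem i₀ b ε ht hx)
  have hΦ : Sm (fun q : ℝ × (Fin n → ℝ) => (q.2 i₀ - b i₀) * f (eta i₀ (b i₀) q.1 q.2)) V := by
    refine ContDiffOn.mul (by fun_prop) ?_
    exact hf.comp hetas.contDiffOn (fun q hq => hq)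
  refine ⟨_, pint_sm Metric.isOpen_ball hVo hVU hΦ, fun x hx => ?_⟩
  rw [pint_dd Metric.isOpen_ball hVo hVU hΦ hx]
  have hderiv : ∀ t ∈ Set.Icc (0:ℝ) 1, HasDerivAt (fun t => t * f (eta i₀ (b i₀) t x))
      (fderiv ℝ (fun y => (y i₀ - b i₀) * f (eta i₀ (b i₀) t y)) x (Pi.single i₀ 1)) t := by
    intro t ht
    have hfd := (hf.diffAt hO (hVU t ht x hx)).hasFDerivAt
    have e1 : HasDerivAt (fun t => eta i₀ (b i₀) t x) ((x i₀ - b i₀) • Pi.single i₀ (1:ℝ)) t := by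
      unfold eta
      have := (((hasDerivAt_id t).sub_const 1).mul_const (x i₀ - b i₀)).smul_const
        (Pi.single i₀ (1:ℝ) : Fin n → ℝ)
      simpa using this.const_add x
    have e2 := (hasDerivAt_id t).mul (hfd.comp_hasDerivAt t e1)
    have e3 : HasFDerivAt (fun y : Fin n → ℝ => y i₀ - b i₀)
        (ContinuousLinearMap.proj (R := ℝ) (φ := fun _ : Fin n => ℝ) i₀) x :=
      (hasFDerivAt_apply i₀ x).sub_const _
    have e4 : HasFDerivAt (fun y : Fin n → ℝ => eta i₀ (b i₀) t y)
        (ContinuousLinearMap.id ℝ _ + ((t - 1) •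
          (ContinuousLinearMap.proj (R := ℝ) (φ := fun _ : Fin n => ℝ) i₀)).smulRight
            (Pi.single i₀ (1:ℝ) : Fin n → ℝ)) x := by
      unfold eta
      exact (hasFDerivAt_id x).add ((e3.const_mul (t-1)).smul_const _)
    have e5 := e3.mul (hfd.comp x e4)
    have e5' : fderiv ℝ (fun y => (y i₀ - b i₀) * f (eta i₀ (b i₀) t y)) x = _ := e5.fderiv
    rw [e5']
    refine e2.congr_deriv ?_
    simp
    ring
  have h := intervalIntegral.integral_eq_sub_of_hasDerivAt (a := 0) (b := 1)
    (f := fun t => t * f (eta i₀ (b i₀) t x))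
    (fun t ht => hderiv t (by rwa [Set.uIcc_of_le zero_le_one] at ht))
    (pint_ii hVo hVU hΦ hx _)
  rw [h, eta_one]; ring

end Part16

open scoped BigOperators
section Part17
variable {n m : ℕ}

noncomputable def bF {d : ℕ} (i₀ : Fin n) (B : (Fin n → ℝ) → ℝ) : Fam n m d :=
  fun s _ w p' => if s = 0 ∧ w 0 = i₀ then B p'.1 else 0

lemma bF_good {d : ℕ} {z : (Fin n → ℝ) × (Fin m → ℝ)} {ε : ℝ} (i₀ : Fin n)
    {B : (Fin n → ℝ) → ℝ} (hB : Sm B (Metric.ball z.1 ε)) :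
    Good (d := d) (Metric.ball z ε) (bF (m := m) i₀ B) where
  sm s α w := by
    unfold bF
    by_cases h : s = 0 ∧ w 0 = i₀
    · simp only [if_pos h]
      refine hB.comp contDiff_fst.contDiffOn fun p hp => ?_
      have hp' : (p.1, fun σ => yc σ (fun _ => 0) p) ∈ Metric.ball z ε := hp
      rw [Metric.mem_ball, Prod.dist_eq, max_lt_iff] at hp'
      exact hp'.1
    · simp only [if_neg h]; exact contDiffOn_const
  alt s α w τ p := by
    unfold bF
    by_cases h : s = 0
    · subst h
      have h1 : Subsingleton (Fin (0 + 1)) := inferInstanceAs (Subsingleton (Fin 1))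
      have : τ = 1 := Equiv.ext fun x => Subsingleton.elim _ _
      subst this
      simp [DL.sg_one]
    · simp [h]
  top s α w p h := by
    unfold bF
    rw [if_neg]
    rintro ⟨hs, -⟩
    subst hs
    exact h fun l => l.elim0

lemma HH_bF {d : ℕ} (hn : 1 ≤ n) (i₀ : Fin n) (B : (Fin n → ℝ) → ℝ) (p : Jet n m (d+1))
    (hB : DifferentiableAt ℝ B p.1) :
    HH (bF i₀ B : Fam n m d) p = fderiv ℝ B p.1 (Pi.single i₀ 1) := by
  unfold HH
  rw [Finset.sum_eq_single 0]
  · rw [Fintype.sum_unique, Fintype.sum_unique, Finset.sum_eq_single i₀]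
    · have h1 : (bF i₀ B : Fam n m d) 0 default (Fin.cons i₀ default) = fun p' => B p'.1 := by
        funext p'
        simp [bF]
      rw [h1, formalD_eq]
      have h2 : HasFDerivAt (fun p' : Jet n m d => B p'.1) _ (projJet (Nat.le_succ d) p) :=
        HasFDerivAt.comp (g := B) (projJet (Nat.le_succ d) p) hB.hasFDerivAt hasFDerivAt_fst
      rw [h2.fderiv]
      simp [yprod, fdir]
    · intro i _ hi
      refine formalD_zero i (fun p' => ?_) p
      simp [bF, hi]
    · simp
  · intro s _ hs
    have : ∀ α w i, formalD i ((bF i₀ B : Fam n m d) s α (Fin.cons i w)) p = 0 := by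
      intro α w i
      refine formalD_zero i (fun p' => ?_) p
      simp [bF, hs]
    simp [this]
  · intro h
    exact absurd (Finset.mem_range.2 hn) h

lemma Good.add {d : ℕ} {W : Set ((Fin n → ℝ) × (Fin m → ℝ))} {a b : Fam n m d} (ha : Good W a)
    (hb : Good W b) : Good W (fun s α w p => a s α w p + b s α w p) where
  sm s α w := (ha.sm s α w).add (hb.sm s α w)
  alt s α w τ p := by rw [ha.alt, hb.alt]; ring
  top s α w p h := by rw [ha.top s α w p h, hb.top s α w p h, add_zero]

lemma HH_add {d : ℕ} {W : Set ((Fin n → ℝ) × (Fin m → ℝ))} (hW : IsOpen W)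
    {a b : Fam n m d} (ha : Good W a)
    (hb : Good W b) (p : Jet n m (d+1)) (hp : p ∈ Dset (d+1) W) :
    HH (fun s α w p => a s α w p + b s α w p) p = HH a p + HH b p := by
  have hp' : projJet (Nat.le_succ d) p ∈ Dset d W := (mem_Dset_proj _ _ _).2 hp
  have hH : ∀ (c : Fam n m d) p, HH c p =
    Lf (fun s α w => (∑ i, formalD i (c s α (Fin.cons i w)) p) * yprod α w p) := fun _ _ => rfl
  simp only [hH, ← Lf_add]
  congr 1
  funext s α w
  rw [← add_mul, ← Finset.sum_add_distrib]
  congr 1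
  refine Finset.sum_congr rfl fun i _ => ?_
  rw [formalD_eq, formalD_eq, formalD_eq, fderiv_fun_add
    ((ha.sm _ _ _).diffAt (Dset_open d hW) hp') ((hb.sm _ _ _).diffAt (Dset_open d hW) hp')]
  rfl

/-- every trivial Lagrangian is locally a divergence of the special form -/
lemma exists_potential {d : ℕ} (hn : 1 ≤ n) {W : Set ((Fin n → ℝ) × (Fin m → ℝ))} (hW : IsOpen W)
    {L : Jet n m (d+1) → ℝ} (hL : Sm L (Dset (d+1) W))
    (htriv : ∀ σ : Fin m, ∀ p ∈ Dset (n := n) (m := m) (2*(d+1)) W, EL σ L p = 0)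
    {z : (Fin n → ℝ) × (Fin m → ℝ)} (hz : z ∈ W) :
    ∃ ε > 0, Metric.ball z ε ⊆ W ∧ ∃ a : Fam n m d, Good (Metric.ball z ε) a ∧
      ∀ p ∈ Dset (d+1) (Metric.ball z ε), L p = HH a p := by
  obtain ⟨ε, hε, hb⟩ := Metric.isOpen_iff.1 hW z hz
  have hdes := fun σ => descent hW (d+1) (fun K => pdY σ K L) (fun K => hL.pdY hW σ K)
    (EL_null hW hL σ (htriv σ))
  choose c hc1 hc2 hc3 using hdes
  set i₀ : Fin n := ⟨0, hn⟩
  set O : Set (Fin n → ℝ) := {x | (x, z.2) ∈ W} with hOdef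
  have hO : IsOpen O := hW.preimage (by fun_prop)
  have hbO : Metric.ball z.1 ε ⊆ O := by
    intro x hx
    refine hb ?_
    rw [Metric.mem_ball, Prod.dist_eq]
    simpa [hε] using hx
  have hmem : ∀ x, (x, (zeta z.2 : JIdx n m (d+1) → ℝ)) ∈ Dset (d+1) W ↔ x ∈ O := by
    intro x
    unfold Dset
    simp only [Set.mem_ofPred_eq, hOdef]
    have : (fun σ => yc σ (fun _ => 0) ((x, (zeta z.2 : JIdx n m (d+1) → ℝ)) : Jet n m (d+1))) = z.2 := by
      funext σ
      rw [yc_of_le _ _ _ (by simp)]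
      simp [zeta]
    rw [this]
  have hL0 : Sm (fun x => L (x, (zeta z.2 : JIdx n m (d+1) → ℝ))) O :=
    hL.comp (contDiff_id.prodMk contDiff_const).contDiffOn (fun x hx => (hmem x).2 hx)
  obtain ⟨B, hB, hB'⟩ := exists_prim i₀ z.1 ε hO hbO hL0
  have ga := aF_good hW hb hc1
  have gb := bF_good (d := d) (m := m) (z := z) i₀ hB
  refine ⟨ε, hε, hb, _, ga.add gb, fun p hp => ?_⟩
  have hp1 : p.1 ∈ Metric.ball z.1 ε := by
    have hp' : (p.1, fun σ => yc σ (fun _ => 0) p) ∈ Metric.ball z ε := hp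
    rw [Metric.mem_ball, Prod.dist_eq, max_lt_iff] at hp'
    exact hp'.1
  rw [HH_add Metric.isOpen_ball ga gb p hp, HH_bF hn i₀ B p (hB.diffAt Metric.isOpen_ball hp1),
    hB' _ hp1, HH_aF_eq hW hb hc1 hc2 hL hc3 p hp]
  congr 2
  refine Prod.ext rfl ?_
  funext q
  simp [chi]

end Part17

open scoped BigOperators
section Part18
variable {n m : ℕ}

lemma epsSign_comp (v : Fin n → Fin n) (π : Equiv.Perm (Fin n)) :
    epsSign (v ∘ π) = DL.sg π * epsSign v := by
  unfold epsSign
  by_cases h : Function.Bijective v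
  · have h' : Function.Bijective (v ∘ π) := h.comp π.bijective
    rw [dif_pos h, dif_pos h']
    have : Equiv.ofBijective (v ∘ π) h' = Equiv.ofBijective v h * π := by
      ext x; rfl
    rw [this, Equiv.Perm.sign_mul, DL.sg]
    push_cast
    ring
  · have h' : ¬ Function.Bijective (v ∘ π) := fun h1 => h (by
      have := h1.comp π.symm.bijective
      rwa [Function.comp_assoc, Equiv.self_comp_symm] at this)
    rw [dif_neg h, dif_neg h', mul_zero]

lemma epsSign_inj {v : Fin n → Fin n} (h : epsSign v ≠ 0) : Function.Injective v := by
  by_contra h1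
  exact h (by rw [epsSign, dif_neg (fun h2 => h1 h2.1)])

lemma epsSign_sq {v : Fin n → Fin n} (h : Function.Injective v) : epsSign v * epsSign v = 1 := by
  have hb : Function.Bijective v := Finite.injective_iff_bijective.1 h
  rw [epsSign, dif_pos hb]
  exact DL.sg_sq _

noncomputable def EE {a b : ℕ} (h : a + b = n) (w : Fin a → Fin n) (iv : Fin b → Fin n) : ℝ :=
  epsSign (fun x : Fin n => Fin.append w iv (Fin.cast h.symm x))

lemma EE_perm {a b : ℕ} (h : a + b = n) (w : Fin a → Fin n) (iv : Fin b → Fin n)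
    (π : Equiv.Perm (Fin a)) (ρ : Equiv.Perm (Fin b)) :
    EE h (w ∘ π) (iv ∘ ρ) = DL.sg π * DL.sg ρ * EE h w iv := by
  subst h
  unfold EE
  have : (fun x => Fin.append (w ∘ π) (iv ∘ ρ) (Fin.cast rfl x)) =
      (fun x => Fin.append w iv (Fin.cast rfl x)) ∘
        (finSumFinEquiv.permCongr (Equiv.Perm.sumCongr π ρ)) := by
    funext x
    refine Fin.addCases (fun j => ?_) (fun j => ?_) x
    · simp [Equiv.permCongr_apply]
    · simp [Equiv.permCongr_apply]
  rw [this, epsSign_comp]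
  congr 1
  rw [DL.sg, Equiv.Perm.sign_permCongr, Equiv.Perm.sign_sumCongr, DL.sg, DL.sg]
  push_cast; ring

lemma EE_left {a b : ℕ} (h : a + b = n) (w : Fin a → Fin n) (iv : Fin b → Fin n)
    (π : Equiv.Perm (Fin a)) : EE h (w ∘ π) iv = DL.sg π * EE h w iv := by
  have := EE_perm h w iv π 1
  rw [DL.sg_one, mul_one] at this
  exact this

lemma EE_right {a b : ℕ} (h : a + b = n) (w : Fin a → Fin n) (iv : Fin b → Fin n)
    (ρ : Equiv.Perm (Fin b)) : EE h w (iv ∘ ρ) = DL.sg ρ * EE h w iv := by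
  have := EE_perm h w iv 1 ρ
  rw [DL.sg_one, one_mul] at this
  exact this

lemma sg_cycleRange {l : ℕ} (k : Fin (l+1)) : DL.sg k.cycleRange = (-1:ℝ)^(k:ℕ) := by
  rw [DL.sg, Fin.sign_cycleRange]; simp

lemma EE_insL {a b : ℕ} (h : (a+1) + b = n) (k : Fin (a+1)) (i : Fin n) (w : Fin a → Fin n)
    (iv : Fin b → Fin n) :
    EE h (k.insertNth i w) iv = (-1:ℝ)^(k:ℕ) * EE h (Fin.cons i w) iv := by
  rw [← sg_cycleRange, ← EE_left, Fin.cons_comp_cycleRange]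

lemma EE_insR {a b : ℕ} (h : a + (b+1) = n) (k : Fin (b+1)) (i : Fin n) (w : Fin a → Fin n)
    (iv : Fin b → Fin n) :
    EE h w (k.insertNth i iv) = (-1:ℝ)^(k:ℕ) * EE h w (Fin.cons i iv) := by
  rw [← sg_cycleRange, ← EE_right, Fin.cons_comp_cycleRange]

lemma append_cons_right {a b : ℕ} (w : Fin a → Fin n) (i : Fin n) (iv : Fin b → Fin n) :
    (@Fin.append a (b+1) _ w (Fin.cons i iv : Fin (b+1) → Fin n)) =
      (Fin.insertNth (⟨a, by omega⟩ : Fin (a+b+1)) i (Fin.append w iv) : Fin (a + b + 1) → Fin n) := by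
  rw [Fin.eq_insertNth_iff]
  constructor
  · have : (⟨a, by omega⟩ : Fin (a+b+1)) = Fin.natAdd a (0 : Fin (b+1)) := by ext; simp
    rw [this]
    exact Fin.append_right w (Fin.cons i iv : Fin (b+1) → Fin n) 0
  · funext x
    refine Fin.addCases (fun j => ?_) (fun j => ?_) x
    · have : Fin.succAbove (⟨a, by omega⟩ : Fin (a+b+1)) (Fin.castAdd b j) =
        (Fin.castAdd (b+1) j : Fin (a+(b+1))) := by
        rw [Fin.succAbove_of_castSucc_lt]
        · ext; simp
        · rw [Fin.lt_def]; simp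
      rw [Fin.removeNth_apply, this]
      rw [Fin.append_left]
      exact (Fin.append_left w iv j).symm
    · have : Fin.succAbove (⟨a, by omega⟩ : Fin (a+b+1)) (Fin.natAdd a j) =
        (Fin.natAdd a j.succ : Fin (a+(b+1))) := by
        rw [Fin.succAbove_of_le_castSucc]
        · ext; simp; omega
        · rw [Fin.le_def]; simp
      rw [Fin.removeNth_apply, this]
      rw [Fin.append_right]
      exact (Fin.append_right w iv j).symm

lemma EE_move {a b : ℕ} (h : a + (b+1) = n) (h' : (a+1) + b = n) (i : Fin n) (w : Fin a → Fin n)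
    (iv : Fin b → Fin n) :
    EE h w (Fin.cons i iv) = (-1:ℝ)^a * EE h' (Fin.cons i w) iv := by
  have e : (a + b) + 1 = n := by omega
  have h1 : EE h w (Fin.cons i iv) = epsSign (fun x : Fin n =>
      (Fin.insertNth (⟨a, by omega⟩ : Fin (a+b+1)) i (Fin.append w iv) : Fin (a + b + 1) → Fin n)
        (Fin.cast e.symm x)) := by
    unfold EE
    rw [← append_cons_right]
  have h2 : EE h' (Fin.cons i w) iv = epsSign (fun x : Fin n =>
      (Fin.cons i (Fin.append w iv) : Fin (a + b + 1) → Fin n) (Fin.cast e.symm x)) := by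
    unfold EE
    congr 1
    funext x
    rw [Fin.append_cons]
    rfl
  rw [h1, h2, ← Fin.cons_comp_cycleRange]
  subst e
  refine (epsSign_comp (Fin.cons i (Fin.append w iv) : Fin (a + b + 1) → Fin (a+b+1))
    (Fin.cycleRange ⟨a, by omega⟩)).trans ?_
  rw [sg_cycleRange]
  rfl

def Comp {a b : ℕ} (w : Fin a → Fin n) (iv : Fin b → Fin n) : Prop :=
  Function.Injective w ∧ Function.Injective iv ∧ ∀ j l, w j ≠ iv l

lemma Comp.swap {a b : ℕ} {w : Fin a → Fin n} {iv : Fin b → Fin n} (h : Comp w iv) : Comp iv w :=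
  ⟨h.2.1, h.1, fun j l e => h.2.2 l j e.symm⟩

lemma Comp.cover {a b : ℕ} (h : a + b = n) {w : Fin a → Fin n} {iv : Fin b → Fin n}
    (hc : Comp w iv) (x : Fin n) : (∃ j, w j = x) ∨ ∃ l, iv l = x := by
  have hi : Function.Injective (Sum.elim w iv) := hc.1.sumElim hc.2.1 hc.2.2
  have hb : Function.Bijective (Sum.elim w iv) :=
    (Fintype.bijective_iff_injective_and_card _).2 ⟨hi, by simp [h]⟩
  obtain ⟨y, hy⟩ := hb.2 x
  rcases y with j | l
  · exact Or.inl ⟨j, hy⟩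
  · exact Or.inr ⟨l, hy⟩

lemma EE_comp {a b : ℕ} (h : a + b = n) {w : Fin a → Fin n} {iv : Fin b → Fin n}
    (hE : EE h w iv ≠ 0) : Comp w iv := by
  have hi := epsSign_inj hE
  have hi2 : Function.Injective (Fin.append w iv) := by
    intro x y hxy
    have := @hi (Fin.cast h x) (Fin.cast h y) (by simpa using hxy)
    simpa using this
  have := Fin.append_injective_iff.1 hi2
  exact ⟨this.1, this.2.1, this.2.2⟩

lemma EE_sq {a b : ℕ} (h : a + b = n) {w : Fin a → Fin n} {iv : Fin b → Fin n}
    (hc : Comp w iv) : EE h w iv * EE h w iv = 1 := by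
  refine epsSign_sq ?_
  have := Fin.append_injective_iff.2 ⟨hc.1, hc.2.1, hc.2.2⟩
  intro x y hxy
  simpa using this hxy

lemma sum_support {a b : ℕ} (h : a + b = n) {w : Fin a → Fin n} {iv : Fin b → Fin n}
    (hc : Comp w iv) (f : (Fin a → Fin n) → ℝ) (hf : ∀ w', ¬ Comp w' iv → f w' = 0) :
    ∑ w', f w' = ∑ π : Equiv.Perm (Fin a), f (w ∘ π) := by
  symm
  refine Fintype.sum_of_injective (fun π : Equiv.Perm (Fin a) => w ∘ π) ?_ _ _ ?_ (fun _ => rfl)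
  · intro π π' hπ
    ext x
    have := hc.1 (congrFun hπ x)
    rw [this]
  · intro w' hw'
    refine hf _ fun hc' => hw' ?_
    have : ∀ j, ∃ j', w j' = w' j := by
      intro j
      rcases hc.cover h (w' j) with h1 | ⟨l, hl⟩
      · exact h1
      · exact absurd hl.symm (hc'.2.2 j l)
    choose g hg using this
    have hgi : Function.Injective g := by
      intro x y hxy
      refine hc'.1 ?_
      rw [← hg, ← hg, hxy]
    refine ⟨Equiv.ofBijective g (Finite.injective_iff_bijective.1 hgi), ?_⟩
    funext j
    exact hg j

lemma exists_comp {a b : ℕ} (h : a + b = n) {w : Fin a → Fin n} (hw : Function.Injective w) :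
    ∃ iv : Fin b → Fin n, Comp w iv := by
  classical
  have hcard : Fintype.card {x // x ∉ Set.range w} = b := by
    have h1 := Fintype.card_subtype_compl (fun x : Fin n => x ∈ Set.range w)
    have h2 : Fintype.card {x // x ∈ Set.range w} = a := by
      rw [Set.card_range_of_injective hw, Fintype.card_fin]
    rw [h1, h2, Fintype.card_fin]; omega
  have e : Fin b ≃ {x // x ∉ Set.range w} := (Fintype.equivFinOfCardEq hcard).symm
  refine ⟨fun l => (e l).1, hw, fun x y hxy => e.injective (Subtype.ext hxy), fun j l hjl => ?_⟩
  exact (e l).2 ⟨j, hjl⟩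

lemma alt_noninj {a : ℕ} {f : (Fin a → Fin n) → ℝ}
    (hf : ∀ w (τ : Equiv.Perm (Fin a)), f (w ∘ τ) = DL.sg τ * f w) {w : Fin a → Fin n}
    (hw : ¬ Function.Injective w) : f w = 0 := by
  unfold Function.Injective at hw
  push Not at hw
  obtain ⟨x, y, hxy, hne⟩ := hw
  have h1 := hf w (Equiv.swap x y)
  have h2 : w ∘ Equiv.swap x y = w := by
    funext j
    simp only [Function.comp_apply, Equiv.swap_apply_def]
    split_ifs with h3 h4
    · rw [h3, hxy]
    · rw [h4, hxy]
    · rfl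
  rw [h2, DL.sg, Equiv.Perm.sign_swap hne] at h1
  norm_num at h1
  linarith

lemma contraction {a b : ℕ} (h : a + b = n) {f : (Fin a → Fin n) → ℝ}
    (hf : ∀ w (τ : Equiv.Perm (Fin a)), f (w ∘ τ) = DL.sg τ * f w) (w : Fin a → Fin n) :
    ∑ iv : Fin b → Fin n, EE h w iv * ∑ w', EE h w' iv * f w' =
      (a.factorial : ℝ) * (b.factorial : ℝ) * f w := by
  by_cases hw : Function.Injective w
  · have h1 : ∀ iv : Fin b → Fin n, EE h w iv * ∑ w', EE h w' iv * f w' =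
        (EE h w iv * EE h w iv) * ((a.factorial : ℝ) * f w) := by
      intro iv
      by_cases hE : EE h w iv = 0
      · simp [hE]
      · have hc := EE_comp h hE
        rw [sum_support h hc]
        · have : ∀ π : Equiv.Perm (Fin a), EE h (w ∘ π) iv * f (w ∘ π) = EE h w iv * f w := by
            intro π
            rw [EE_left, hf]
            have := DL.sg_sq π
            linear_combination (EE h w iv * f w) * this
          rw [Finset.sum_congr rfl fun π _ => this π, Finset.sum_const, Finset.card_univ,
            Fintype.card_perm, Fintype.card_fin, nsmul_eq_mul]
          ring
        · intro w' hw'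
          by_contra h0
          exact hw' (EE_comp h (left_ne_zero_of_mul h0))
    rw [Finset.sum_congr rfl fun iv _ => h1 iv, ← Finset.sum_mul]
    obtain ⟨iv, hc⟩ := exists_comp h hw
    have h2 : ∑ iv : Fin b → Fin n, EE h w iv * EE h w iv = (b.factorial : ℝ) := by
      rw [sum_support (by omega : b + a = n) hc.swap]
      · have : ∀ π : Equiv.Perm (Fin b), EE h w (iv ∘ π) * EE h w (iv ∘ π) = 1 := by
          intro π
          rw [EE_right]
          have h3 := DL.sg_sq π
          have h4 := EE_sq h hc
          linear_combination (EE h w iv * EE h w iv) * h3 + h4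
        rw [Finset.sum_congr rfl fun π _ => this π, Finset.sum_const, Finset.card_univ,
            Fintype.card_perm, Fintype.card_fin, nsmul_eq_mul, mul_one]
      · intro iv' hiv'
        by_contra h0
        exact hiv' (EE_comp h (left_ne_zero_of_mul h0)).swap
    rw [h2]; ring
  · rw [alt_noninj hf hw, mul_zero]
    refine Finset.sum_eq_zero fun iv _ => ?_
    have : EE h w iv = 0 := by
      by_contra h0
      exact hw (EE_comp h h0).1
    rw [this, zero_mul]

end Part18

open scoped BigOperators
section Part19
variable {n m : ℕ}

lemma formalD_lin {d : ℕ} {ι : Type*} [Fintype ι] (i : Fin n) (c : ι → ℝ) (f : ι → Jet n m d → ℝ)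
    (p : Jet n m (d+1)) (hf : ∀ x, DifferentiableAt ℝ (f x) (projJet (Nat.le_succ d) p)) :
    formalD i (fun q => ∑ x, c x * f x q) p = ∑ x, c x * formalD i (f x) p := by
  have h : HasFDerivAt (fun q => ∑ x, c x * f x q)
      (∑ x, c x • fderiv ℝ (f x) (projJet (Nat.le_succ d) p)) (projJet (Nat.le_succ d) p) :=
    HasFDerivAt.fun_sum fun x _ => (hf x).hasFDerivAt.const_mul (c x)
  rw [formalD_eq, h.fderiv, sum_apply]
  refine Finset.sum_congr rfl fun x _ => ?_
  rw [formalD_eq]; rfl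

noncomputable def liftP {s : ℕ} (τ : Equiv.Perm (Fin s)) : Equiv.Perm (Fin (s+1)) :=
  Equiv.Perm.decomposeFin.symm (0, τ)

lemma sg_liftP {s : ℕ} (τ : Equiv.Perm (Fin s)) : DL.sg (liftP τ) = DL.sg τ := by
  rw [DL.sg, DL.sg, liftP, Equiv.Perm.decomposeFin.symm_sign]; simp

lemma cons_liftP {s : ℕ} (τ : Equiv.Perm (Fin s)) (i : Fin n) (w : Fin s → Fin n) :
    (Fin.cons i (w ∘ τ) : Fin (s+1) → Fin n) = (Fin.cons i w : Fin (s+1) → Fin n) ∘ liftP τ := by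
  funext x
  refine Fin.cases ?_ (fun j => ?_) x
  · simp [liftP]
  · simp [liftP]

lemma sum_perm_any {t : ℕ} {B : Type*} [Fintype B] (τ : Equiv.Perm (Fin t)) (f : (Fin t → B) → ℝ) :
    ∑ v, f (v ∘ τ) = ∑ v, f v := by
  classical
  exact Equiv.sum_comp (Equiv.arrowCongr τ.symm (Equiv.refl B)) f

/-- antisymmetrization in the pairs -/
noncomputable def aS {d : ℕ} (a : Fam n m d) : Fam n m d := fun s α w p =>
  ∑ τ : Equiv.Perm (Fin s), ((s.factorial : ℝ)⁻¹ * DL.sg τ) * a s (α ∘ τ) w p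

lemma aS_alt {d : ℕ} (a : Fam n m d) (s : ℕ) (α : Fin s → JIdx n m d) (w) (p) (τ : Equiv.Perm (Fin s)) :
    aS a s (α ∘ τ) w p = DL.sg τ * aS a s α w p := by
  unfold aS
  symm
  rw [Finset.mul_sum, ← Equiv.sum_comp (Equiv.mulLeft τ)]
  refine Finset.sum_congr rfl fun π _ => ?_
  have h1 : (α ∘ τ) ∘ π = α ∘ (τ * π : Equiv.Perm (Fin s)) := rfl
  have h2 := DL.sg_sq τ
  rw [h1, Equiv.coe_mulLeft, DL.sg_mul]
  linear_combination ((s.factorial : ℝ)⁻¹ * DL.sg π * a s (α ∘ (τ * π : Equiv.Perm (Fin s))) w p) * h2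

lemma aS_good {d : ℕ} {W : Set ((Fin n → ℝ) × (Fin m → ℝ))} {a : Fam n m d} (ha : Good W a) :
    Good W (aS a) where
  sm s α w := by
    unfold aS
    exact ContDiffOn.sum fun τ _ => contDiffOn_const.mul (ha.sm s (α ∘ τ) w)
  alt s α w τ p := by
    unfold aS
    rw [Finset.mul_sum]
    refine Finset.sum_congr rfl fun π _ => ?_
    rw [ha.alt]; ring
  top s α w p h := by
    unfold aS
    refine Finset.sum_eq_zero fun τ _ => ?_
    rw [ha.top, mul_zero]
    intro h1
    refine h fun l => ?_
    have := h1 (τ.symm l)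
    simpa using this

lemma HH_aS {d : ℕ} {W : Set ((Fin n → ℝ) × (Fin m → ℝ))} (hW : IsOpen W) {a : Fam n m d}
    (ha : Good W a) (p : Jet n m (d+1)) (hp : p ∈ Dset (d+1) W) : HH (aS a) p = HH a p := by
  have hp' : projJet (Nat.le_succ d) p ∈ Dset d W := (mem_Dset_proj _ _ _).2 hp
  unfold HH
  refine Finset.sum_congr rfl fun s _ => ?_
  congr 1
  set S : (Fin s → JIdx n m d) → (Fin s → Fin n) → ℝ := fun α w =>
    (∑ i, formalD i (a s α (Fin.cons i w)) p) * yprod α w p with hS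
  have h1 : ∀ α w, (∑ i, formalD i (aS a s α (Fin.cons i w)) p) * yprod α w p =
      ∑ τ : Equiv.Perm (Fin s), (s.factorial : ℝ)⁻¹ * S (α ∘ τ) (w ∘ τ) := by
    intro α w
    have h2 : ∀ i, formalD i (aS a s α (Fin.cons i w)) p =
        ∑ τ : Equiv.Perm (Fin s), ((s.factorial : ℝ)⁻¹ * DL.sg τ) *
          formalD i (a s (α ∘ τ) (Fin.cons i w)) p := fun i =>
      formalD_lin i _ (fun τ : Equiv.Perm (Fin s) => a s (α ∘ τ) (Fin.cons i w)) p
        (fun τ => (ha.sm _ _ _).diffAt (Dset_open d hW) hp')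
    simp only [h2]
    rw [Finset.sum_comm, Finset.sum_mul]
    refine Finset.sum_congr rfl fun τ _ => ?_
    have h3 : yprod (α ∘ τ) (w ∘ τ) p = yprod α w p := by
      unfold yprod
      exact Equiv.prod_comp τ (fun l => yc (α l).1 (addE (α l).2.1 (w l)) p)
    have h4 : ∀ i, formalD i (a s (α ∘ τ) (Fin.cons i (w ∘ τ))) p =
        DL.sg τ * formalD i (a s (α ∘ τ) (Fin.cons i w)) p := by
      intro i
      have h5 : a s (α ∘ τ) (Fin.cons i (w ∘ τ)) =
          fun q => ∑ _x : Unit, DL.sg τ * a s (α ∘ τ) (Fin.cons i w) q := by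
        funext q
        rw [cons_liftP, ha.alt, sg_liftP]; simp
      rw [h5, formalD_lin i (fun _ : Unit => DL.sg τ) _ p
        (fun τ => (ha.sm _ _ _).diffAt (Dset_open d hW) hp')]
      simp
    simp only [hS, h4, h3]
    rw [← Finset.mul_sum, ← Finset.mul_sum]; ring
  simp only [h1]
  have h6 : ∀ α, ∑ w : Fin s → Fin n, ∑ τ : Equiv.Perm (Fin s),
      (s.factorial : ℝ)⁻¹ * S (α ∘ τ) (w ∘ τ) =
      ∑ τ : Equiv.Perm (Fin s), (s.factorial : ℝ)⁻¹ * ∑ w, S (α ∘ τ) w := by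
    intro α
    rw [Finset.sum_comm]
    refine Finset.sum_congr rfl fun τ _ => ?_
    rw [← Finset.mul_sum, sum_perm_any τ (S (α ∘ τ))]
  simp only [h6]
  rw [Finset.sum_comm]
  have h7 : ∀ τ : Equiv.Perm (Fin s), ∑ α : Fin s → JIdx n m d,
      (s.factorial : ℝ)⁻¹ * ∑ w, S (α ∘ τ) w = (s.factorial : ℝ)⁻¹ * ∑ α, ∑ w, S α w := by
    intro τ
    rw [← Finset.mul_sum, sum_perm_any τ (fun α => ∑ w, S α w)]
  simp only [h7]
  rw [Finset.sum_const, Finset.card_univ, Fintype.card_perm, Fintype.card_fin, nsmul_eq_mul,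
    ← mul_assoc, mul_inv_cancel₀ (by positivity), one_mul]

end Part19

open scoped BigOperators
section Part20
variable {n m : ℕ}

lemma delTup_succ {B : Type*} {s : ℕ} (k : Fin (s+1)) (f : Fin (s+1) → B) :
    (delTup k f : Fin s → B) = fun j => f (k.succAbove j) := by
  funext j
  unfold delTup Fin.succAbove
  by_cases h : (j:ℕ) < (k:ℕ)
  · have h' : j.castSucc < k := h
    rw [dif_pos h, if_pos h']; rfl
  · have h' : ¬ j.castSucc < k := h
    rw [dif_neg h, if_neg h']; rfl

lemma sum_ins {B : Type*} [Fintype B] {s : ℕ} (k : Fin (s+1)) (f : (Fin (s+1) → B) → ℝ) :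
    ∑ α, f α = ∑ q, ∑ β : Fin s → B, f (k.insertNth q β) := by
  classical
  rw [← Fintype.sum_prod_type' (f := fun (q : B) (β : Fin s → B) => f (k.insertNth q β))]
  exact (Fintype.sum_equiv (Fin.insertNthEquiv (fun _ => B) k) _ _ (fun α => rfl)).symm

lemma trunc_add {d : ℕ} (i : Fin n) (f : Jet n m d → ℝ) (p : Jet n m (d+1)) :
    truncD i f (projJet (Nat.le_succ d) p) +
      ∑ q : JIdx n m d, (if (∑ j, q.2.1 j) = d then (1:ℝ) else 0) *
        (yc q.1 (addE q.2.1 i) p * pdY q.1 q.2.1 f (projJet (Nat.le_succ d) p)) = formalD i f p := by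
  unfold truncD formalD
  rw [add_assoc]
  congr 1
  cases d with
  | zero =>
    rw [Finset.sum_eq_zero, zero_add]
    · refine Finset.sum_congr rfl fun q _ => ?_
      have : (∑ j, q.2.1 j) = 0 := Nat.le_zero.1 q.2.2
      rw [if_pos this, one_mul]
    · intro q _
      rw [yc, dif_neg, zero_mul]
      rw [sum_addE]; omega
  | succ d =>
    have h1 : ∑ q : JIdx n m (d+1), (if (∑ j, q.2.1 j) = d+1 then (0:ℝ) else 1) *
        (yc q.1 (addE q.2.1 i) p * pdY q.1 q.2.1 f (projJet (Nat.le_succ (d+1)) p)) =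
        ∑ q : JIdx n m d, yc q.1 (addE q.2.1 i) (projJet (Nat.le_succ (d+1)) p) *
          pdY q.1 q.2.1 f (projJet (Nat.le_succ (d+1)) p) := by
      rw [sum_low (fun σ K => (if (∑ j, K j) = d+1 then (0:ℝ) else 1) *
        (yc σ (addE K i) p * pdY σ K f (projJet (Nat.le_succ (d+1)) p)))]
      · refine Finset.sum_congr rfl fun q _ => ?_
        have := q.2.2
        rw [if_neg (by omega), one_mul, yc_proj]
        rw [sum_addE]; omega
      · intro σ K h
        rw [if_pos h, zero_mul]
    refine (congrArg (· + _) h1.symm).trans ?_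
    rw [← Finset.sum_add_distrib]
    refine Finset.sum_congr rfl fun q _ => ?_
    split_ifs <;> ring

noncomputable def tp {d s : ℕ} (α : Fin s → JIdx n m d) : ℝ :=
  if ∀ l, (∑ i, (α l).2.1 i) = d then 1 else 0

lemma tp_ins {d s : ℕ} (k : Fin (s+1)) (q : JIdx n m d) (α : Fin s → JIdx n m d) :
    tp (k.insertNth q α : Fin (s+1) → JIdx n m d) =
      (if (∑ j, q.2.1 j) = d then (1:ℝ) else 0) * tp α := by
  unfold tp
  simp only [Fin.forall_iff_succAbove k]
  simp only [Fin.insertNth_apply_same, Fin.insertNth_apply_succAbove]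
  by_cases h1 : (∑ j, q.2.1 j) = d
  · simp [h1]
  · simp [h1]

lemma yprod_ins {d s : ℕ} (k : Fin (s+1)) (q : JIdx n m d) (α : Fin s → JIdx n m d)
    (i : Fin n) (w : Fin s → Fin n) (p : Jet n m (d+1)) :
    yprod (k.insertNth q α : Fin (s+1) → JIdx n m d) (k.insertNth i w) p =
      yc q.1 (addE q.2.1 i) p * yprod α w p := by
  unfold yprod
  rw [Fin.prod_univ_succAbove _ k]
  simp only [Fin.insertNth_apply_same, Fin.insertNth_apply_succAbove]

lemma negsq (k : ℕ) : (-1:ℝ)^k * (-1:ℝ)^k = 1 := by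
  rw [← mul_pow]; norm_num

lemma X1_core {d s b : ℕ} (h : (s+1)+b = n)
    (P : (Fin s → JIdx n m d) → (Fin b → Fin n) → Jet n m d → ℝ) (p : Jet n m (d+1)) :
    ∑ α : Fin (s+1) → JIdx n m d, ∑ iv : Fin b → Fin n, ∑ w : Fin (s+1) → Fin n,
      tp α * (∑ k : Fin (s+1), (-1:ℝ)^(k:ℕ) * pdY (α k).1 (α k).2.1
        (P (fun j => α (k.succAbove j)) iv) (projJet (Nat.le_succ d) p)) * (EE h w iv * yprod α w p) =
    ((s+1 : ℕ) : ℝ) * ∑ α : Fin s → JIdx n m d, ∑ iv : Fin b → Fin n, ∑ w : Fin s → Fin n, ∑ i : Fin n,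
      tp α * EE h (Fin.cons i w) iv * (∑ q : JIdx n m d, (if (∑ j, q.2.1 j) = d then (1:ℝ) else 0) *
        (yc q.1 (addE q.2.1 i) p * pdY q.1 q.2.1 (P α iv) (projJet (Nat.le_succ d) p))) *
        yprod α w p := by
  have hk : ∀ k : Fin (s+1), ∑ α : Fin (s+1) → JIdx n m d, ∑ iv : Fin b → Fin n,
      ∑ w : Fin (s+1) → Fin n, tp α * ((-1:ℝ)^(k:ℕ) * pdY (α k).1 (α k).2.1
        (P (fun j => α (k.succAbove j)) iv) (projJet (Nat.le_succ d) p)) * (EE h w iv * yprod α w p) =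
      ∑ α : Fin s → JIdx n m d, ∑ iv : Fin b → Fin n, ∑ w : Fin s → Fin n, ∑ i : Fin n,
      tp α * EE h (Fin.cons i w) iv * (∑ q : JIdx n m d, (if (∑ j, q.2.1 j) = d then (1:ℝ) else 0) *
        (yc q.1 (addE q.2.1 i) p * pdY q.1 q.2.1 (P α iv) (projJet (Nat.le_succ d) p))) *
        yprod α w p := by
    intro k
    rw [sum_ins k, Finset.sum_comm]
    refine Finset.sum_congr rfl fun α _ => ?_
    rw [Finset.sum_comm]
    refine Finset.sum_congr rfl fun iv _ => ?_
    simp only [sum_ins (B := Fin n) k]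
    rw [Finset.sum_congr rfl fun q _ => Finset.sum_comm, Finset.sum_comm]
    refine Finset.sum_congr rfl fun w _ => ?_
    rw [Finset.sum_comm]
    refine Finset.sum_congr rfl fun i _ => ?_
    rw [Finset.mul_sum, Finset.sum_mul]
    refine Finset.sum_congr rfl fun q _ => ?_
    rw [tp_ins, yprod_ins, EE_insL]
    simp only [Fin.insertNth_apply_same, Fin.insertNth_apply_succAbove]
    have := negsq k
    generalize (if (∑ j, q.2.1 j) = d then (1:ℝ) else 0) = e
    generalize pdY q.1 q.2.1 (P α iv) (projJet (Nat.le_succ d) p) = x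
    linear_combination (e * tp α * x * EE h (Fin.cons i w) iv * yc q.1 (addE q.2.1 i) p * yprod α w p) * this
  have h1 : ∀ (α : Fin (s+1) → JIdx n m d) (iv : Fin b → Fin n) (w : Fin (s+1) → Fin n),
      tp α * (∑ k : Fin (s+1), (-1:ℝ)^(k:ℕ) * pdY (α k).1 (α k).2.1
        (P (fun j => α (k.succAbove j)) iv) (projJet (Nat.le_succ d) p)) * (EE h w iv * yprod α w p) =
      ∑ k : Fin (s+1), tp α * ((-1:ℝ)^(k:ℕ) * pdY (α k).1 (α k).2.1
        (P (fun j => α (k.succAbove j)) iv) (projJet (Nat.le_succ d) p)) * (EE h w iv * yprod α w p) := by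
    intro α iv w
    rw [Finset.mul_sum, Finset.sum_mul]
  simp only [h1]
  have h2 : ∀ F : (Fin (s+1) → JIdx n m d) → (Fin b → Fin n) → (Fin (s+1) → Fin n) → Fin (s+1) → ℝ,
      ∑ α, ∑ iv, ∑ w, ∑ k, F α iv w k = ∑ k, ∑ α, ∑ iv, ∑ w, F α iv w k := by
    intro F
    rw [Finset.sum_comm (s := (Finset.univ : Finset (Fin (s+1))))]
    refine Finset.sum_congr rfl fun α _ => ?_
    rw [Finset.sum_comm (s := (Finset.univ : Finset (Fin (s+1))))]
    refine Finset.sum_congr rfl fun iv _ => ?_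
    rw [Finset.sum_comm]
  rw [h2, Finset.sum_congr rfl fun k _ => hk k, Finset.sum_const, Finset.card_univ,
    Fintype.card_fin, nsmul_eq_mul]

lemma X2_core {d s N : ℕ} (h : s+N = n) (hN : 0 < N) (h' : (s+1)+(N-1) = n)
    (P : (Fin s → JIdx n m d) → (Fin (N-1) → Fin n) → Jet n m d → ℝ) (p : Jet n m (d+1)) :
    ∑ α : Fin s → JIdx n m d, ∑ iv : Fin N → Fin n, ∑ w : Fin s → Fin n,
      tp α * (∑ k : Fin N, (-1:ℝ)^(s+(k:ℕ)) * truncD (iv k)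
        (P α (delTup k iv)) (projJet (Nat.le_succ d) p)) * (EE h w iv * yprod α w p) =
    (N : ℝ) * ∑ α : Fin s → JIdx n m d, ∑ iv : Fin (N-1) → Fin n, ∑ w : Fin s → Fin n, ∑ i : Fin n,
      tp α * EE h' (Fin.cons i w) iv * truncD i (P α iv) (projJet (Nat.le_succ d) p) *
        yprod α w p := by
  obtain ⟨b, rfl⟩ : ∃ b, N = b+1 := ⟨N-1, by omega⟩
  have hk : ∀ (α : Fin s → JIdx n m d) (k : Fin (b+1)), ∑ iv : Fin (b+1) → Fin n, ∑ w : Fin s → Fin n,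
      tp α * ((-1:ℝ)^(s+(k:ℕ)) * truncD (iv k)
        (P α (delTup k iv)) (projJet (Nat.le_succ d) p)) * (EE h w iv * yprod α w p) =
      ∑ iv : Fin b → Fin n, ∑ w : Fin s → Fin n, ∑ i : Fin n,
      tp α * EE (a := s+1) (b := b) h' (Fin.cons i w) iv * truncD i (P α iv) (projJet (Nat.le_succ d) p) *
        yprod α w p := by
    intro α k
    rw [sum_ins k, Finset.sum_comm]
    refine Finset.sum_congr rfl fun iv _ => ?_
    rw [Finset.sum_comm]
    refine Finset.sum_congr rfl fun w _ => ?_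
    refine Finset.sum_congr rfl fun i _ => ?_
    have e : (delTup k (k.insertNth i iv : Fin (b+1) → Fin n) : Fin b → Fin n) = iv := by
      rw [delTup_succ]; funext j; simp
    rw [EE_insR, EE_move h h']
    have e2 : truncD ((k.insertNth i iv : Fin (b+1) → Fin n) k)
        (P α (delTup k (k.insertNth i iv : Fin (b+1) → Fin n))) (projJet (Nat.le_succ d) p) =
        truncD i (P α iv) (projJet (Nat.le_succ d) p) := by
      rw [Fin.insertNth_apply_same]
      exact congrArg (fun v => truncD i (P α v) (projJet (Nat.le_succ d) p)) e
    rw [e2]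
    have := negsq k
    have h3 := negsq s
    generalize truncD i (P α iv) (projJet (Nat.le_succ d) p) = x
    rw [pow_add]
    generalize (-1:ℝ)^(k:ℕ) = u at *
    generalize (-1:ℝ)^s = v at *
    linear_combination (tp α * x * EE (a := s+1) (b := b) h' (Fin.cons i w) iv * yprod α w p) * (u * u) * h3
      + (tp α * x * EE (a := s+1) (b := b) h' (Fin.cons i w) iv * yprod α w p) * this
  rw [Finset.mul_sum]
  refine Finset.sum_congr rfl fun α _ => ?_
  have h1 : ∀ (iv : Fin (b+1) → Fin n) (w : Fin s → Fin n),
      tp α * (∑ k : Fin (b+1), (-1:ℝ)^(s+(k:ℕ)) * truncD (iv k)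
        (P α (delTup k iv)) (projJet (Nat.le_succ d) p)) * (EE h w iv * yprod α w p) =
      ∑ k : Fin (b+1), tp α * ((-1:ℝ)^(s+(k:ℕ)) * truncD (iv k)
        (P α (delTup k iv)) (projJet (Nat.le_succ d) p)) * (EE h w iv * yprod α w p) := by
    intro iv w
    rw [Finset.mul_sum, Finset.sum_mul]
  simp only [h1]
  have h2 : ∀ F : (Fin (b+1) → Fin n) → (Fin s → Fin n) → Fin (b+1) → ℝ,
      ∑ iv, ∑ w, ∑ k, F iv w k = ∑ k, ∑ iv, ∑ w, F iv w k := by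
    intro F
    rw [Finset.sum_comm (s := (Finset.univ : Finset (Fin (b+1))))]
    refine Finset.sum_congr rfl fun iv _ => ?_
    rw [Finset.sum_comm]
  rw [h2, Finset.sum_congr rfl fun k _ => hk α k, Finset.sum_const, Finset.card_univ,
    Fintype.card_fin, nsmul_eq_mul]
  rfl

/-- the contracted coefficient -/
noncomputable def cP {d s b : ℕ} (h : (s+1)+b = n) (a : Fam n m d) (α : Fin s → JIdx n m d)
    (iv : Fin b → Fin n) : Jet n m d → ℝ := fun q =>
  ∑ w' : Fin (s+1) → Fin n, (((s+1).factorial : ℝ)⁻¹ * EE h w' iv) * a s α w' q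

lemma T_core {d s b : ℕ} (h : (s+1)+b = n) {W : Set ((Fin n → ℝ) × (Fin m → ℝ))} (hW : IsOpen W)
    {a : Fam n m d} (ha : Good W a) (p : Jet n m (d+1)) (hp : p ∈ Dset (d+1) W) :
    ∑ α : Fin s → JIdx n m d, ∑ iv : Fin b → Fin n, ∑ w : Fin s → Fin n, ∑ i : Fin n,
      tp α * EE h (Fin.cons i w) iv * formalD i (cP h a α iv) p * yprod α w p =
    (b.factorial : ℝ) * ∑ α : Fin s → JIdx n m d, ∑ w : Fin s → Fin n,
      (∑ i, formalD i (a s α (Fin.cons i w)) p) * yprod α w p := by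
  have hp' : projJet (Nat.le_succ d) p ∈ Dset d W := (mem_Dset_proj _ _ _).2 hp
  rw [Finset.mul_sum]
  refine Finset.sum_congr rfl fun α _ => ?_
  rw [Finset.sum_comm, Finset.mul_sum]
  refine Finset.sum_congr rfl fun w _ => ?_
  rw [Finset.sum_comm, Finset.sum_mul, Finset.mul_sum]
  refine Finset.sum_congr rfl fun i _ => ?_
  have hlin : ∀ iv, formalD i (cP h a α iv) p = ((s+1).factorial : ℝ)⁻¹ *
      ∑ w', EE h w' iv * formalD i (a s α w') p := by
    intro iv
    unfold cP
    rw [formalD_lin i (fun w' : Fin (s+1) → Fin n => ((s+1).factorial : ℝ)⁻¹ * EE h w' iv) _ p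
      (fun w' => (ha.sm _ _ _).diffAt (Dset_open d hW) hp'), Finset.mul_sum]
    exact Finset.sum_congr rfl fun w' _ => by ring
  have halt : ∀ (w' : Fin (s+1) → Fin n) (τ : Equiv.Perm (Fin (s+1))),
      formalD i (a s α (w' ∘ τ)) p = DL.sg τ * formalD i (a s α w') p := by
    intro w' τ
    have h5 : a s α (w' ∘ τ) = fun q => ∑ _x : Unit, DL.sg τ * a s α w' q := by
      funext q
      rw [ha.alt]; simp
    rw [h5, formalD_lin i (fun _ : Unit => DL.sg τ) _ p
        (fun τ => (ha.sm _ _ _).diffAt (Dset_open d hW) hp')]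
    simp
  have hc := contraction h (f := fun w' => formalD i (a s α w') p) halt (Fin.cons i w)
  have h1 : ∑ iv, tp α * EE h (Fin.cons i w) iv * formalD i (cP h a α iv) p * yprod α w p =
      tp α * yprod α w p * ((s+1).factorial : ℝ)⁻¹ * ∑ iv, EE h (Fin.cons i w) iv *
        ∑ w', EE h w' iv * formalD i (a s α w') p := by
    rw [Finset.mul_sum]
    refine Finset.sum_congr rfl fun iv _ => ?_
    rw [hlin]; ring
  rw [h1, hc]
  have hf : ((s+1).factorial : ℝ) ≠ 0 := by positivity
  unfold tp
  split_ifs with ht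
  · field_simp
  · rw [formalD_zero i (fun q => ha.top s α _ q ht)]; ring

end Part20

open scoped BigOperators
section Part21
variable {n m : ℕ}

open Classical in
noncomputable def Afam {d : ℕ} (a : Fam n m d) : JetFam n m (d+1) := fun s I σs iv =>
  if h : s < n ∧ ∀ l, (∑ i, I l i) ≤ d then
    cP (b := n - s - 1) (by omega) a (fun l => (σs l, ⟨I l, h.2 l⟩)) iv
  else fun _ => 0

lemma Afam_sm {d : ℕ} {W : Set ((Fin n → ℝ) × (Fin m → ℝ))} {a : Fam n m d} (ha : Good W a)
    (s I σs iv) : Sm (Afam a s I σs iv) (Dset d W) := by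
  unfold Afam
  split_ifs with h
  · unfold cP
    exact ContDiffOn.sum fun w _ => contDiffOn_const.mul (ha.sm s _ w)
  · exact contDiffOn_const

lemma Afam_alt {d : ℕ} {a : Fam n m d}
    (ha : ∀ s (α : Fin s → JIdx n m d) w p (τ : Equiv.Perm (Fin s)),
      a s (α ∘ τ) w p = DL.sg τ * a s α w p) : IsAltSym (Afam a) := by
  intro s τ ρ I σs iv p
  unfold Afam
  by_cases h : s < n ∧ ∀ l, (∑ i, I l i) ≤ d
  · have h' : s < n ∧ ∀ l, (∑ i, (I ∘ τ) l i) ≤ d := ⟨h.1, fun l => h.2 (τ l)⟩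
    rw [dif_pos h, dif_pos h']
    unfold cP
    rw [Finset.mul_sum]
    refine Finset.sum_congr rfl fun w _ => ?_
    have h1 := ha s (fun l => (σs l, ⟨I l, h.2 l⟩)) w p τ
    rw [EE_right]
    refine (congrArg (_ * ·) h1).trans ?_
    unfold DL.sg
    ring
  · have h' : ¬ (s < n ∧ ∀ l, (∑ i, (I ∘ τ) l i) ≤ d) := fun h1 => h ⟨h1.1, fun l => by
      have := h1.2 (τ.symm l)
      simpa using this⟩
    rw [dif_neg h, dif_neg h', mul_zero]

noncomputable def X1 {d : ℕ} (A : JetFam n m (d+1)) (p : Jet n m (d+1)) (s : ℕ) (hs : s ≤ n) : ℝ :=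
  ((s.factorial * (n - s).factorial : ℕ) : ℝ)⁻¹ *
    ∑ α : Fin s → JIdx n m d, ∑ iv : Fin (n-s) → Fin n, ∑ w : Fin s → Fin n,
      tp α * (∑ k : Fin s, (-1:ℝ)^(k:ℕ) * pdY (α k).1 (α k).2.1
        (A (s-1) (delTup k fun l => (α l).2.1) (delTup k fun l => (α l).1)
          (fun j : Fin (n - (s-1) - 1) =>
            iv (Fin.cast (by have := k.isLt; omega : n - (s-1) - 1 = n - s) j)))
          (projJet (Nat.le_succ d) p)) * (EE (by omega : s + (n-s) = n) w iv * yprod α w p)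

noncomputable def X2 {d : ℕ} (A : JetFam n m (d+1)) (p : Jet n m (d+1)) (s : ℕ) (hs : s ≤ n) : ℝ :=
  ((s.factorial * (n - s).factorial : ℕ) : ℝ)⁻¹ *
    ∑ α : Fin s → JIdx n m d, ∑ iv : Fin (n-s) → Fin n, ∑ w : Fin s → Fin n,
      tp α * (∑ k : Fin (n-s), (-1:ℝ)^(s+(k:ℕ)) * truncD (t := d) (iv k)
        (A s (fun l => (α l).2.1) (fun l => (α l).1) (delTup k iv))
          (projJet (Nat.le_succ d) p)) * (EE (by omega : s + (n-s) = n) w iv * yprod α w p)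

lemma LagA_split {d : ℕ} (A : JetFam n m (d+1)) (p : Jet n m (d+1)) :
    LagA A p = ∑ s : Fin (n+1), (X1 A p s (Nat.lt_succ_iff.1 s.isLt) + X2 A p s (Nat.lt_succ_iff.1 s.isLt)) := by
  unfold LagA LagC
  refine Finset.sum_congr rfl fun s _ => ?_
  unfold X1 X2
  rw [← mul_add]
  congr 1
  rw [← Finset.sum_add_distrib, sum_arrow_prod, Finset.sum_comm]
  refine Finset.sum_congr rfl fun σs _ => ?_
  refine Finset.sum_congr rfl fun I _ => ?_
  rw [← Finset.sum_add_distrib]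
  refine Finset.sum_congr rfl fun iv _ => ?_
  rw [← Finset.sum_add_distrib]
  unfold hyperJ
  rw [Finset.mul_sum]
  refine Finset.sum_congr rfl fun w _ => ?_
  rw [← add_mul, ← mul_add]
  rfl

lemma X1_zero {d : ℕ} (A : JetFam n m (d+1)) (p : Jet n m (d+1)) (h) : X1 A p 0 h = 0 := by
  unfold X1
  simp

lemma X2_top {d : ℕ} (A : JetFam n m (d+1)) (p : Jet n m (d+1)) (h) : X2 A p n h = 0 := by
  unfold X2
  have : ∀ (F : Fin (n - n) → ℝ), ∑ k, F k = 0 := by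
    intro F
    have : IsEmpty (Fin (n-n)) := by rw [Nat.sub_self]; infer_instance
    exact Finset.sum_of_isEmpty _
  simp only [this]
  simp

lemma X1_succ {d : ℕ} (A : JetFam n m (d+1)) (p : Jet n m (d+1)) (s : ℕ) (hs : s + 1 ≤ n) :
    X1 A p (s+1) hs = ((s.factorial : ℝ) * ((n-s-1).factorial : ℝ))⁻¹ *
     ∑ α : Fin s → JIdx n m d, ∑ iv : Fin (n-s-1) → Fin n, ∑ w : Fin s → Fin n, ∑ i : Fin n,
      tp α * EE (by omega : (s+1) + (n-s-1) = n) (Fin.cons i w) iv *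
       (∑ q : JIdx n m d, (if (∑ j, q.2.1 j) = d then (1:ℝ) else 0) *
        (yc q.1 (addE q.2.1 i) p * pdY q.1 q.2.1 (r := d)
          (A s (fun l => (α l).2.1) (fun l => (α l).1) iv) (projJet (Nat.le_succ d) p))) *
        yprod α w p := by
  have h := X1_core (by omega : (s+1) + (n-s-1) = n)
    (fun (α : Fin s → JIdx n m d) iv => A s (fun l => (α l).2.1) (fun l => (α l).1) iv) p
  unfold X1
  have e : ∀ (k : Fin (s+1)) (α : Fin (s+1) → JIdx n m d) (iv : Fin (n-(s+1)) → Fin n),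
      A (s+1-1) (delTup k fun l => (α l).2.1) (delTup k fun l => (α l).1)
          (fun j : Fin (n - (s+1-1) - 1) =>
            iv (Fin.cast (by have := k.isLt; omega : n - (s+1-1) - 1 = n - (s+1)) j)) =
      A s (fun l => (α (k.succAbove l)).2.1) (fun l => (α (k.succAbove l)).1) iv := by
    intro k α iv
    have e1 := delTup_succ k fun l => (α l).2.1
    have e2 := delTup_succ k fun l => (α l).1
    exact (congrArg (fun I => A s I (delTup k fun l => (α l).1) iv) e1).trans
      (congrArg (fun J => A s (fun l => (α (k.succAbove l)).2.1) J iv) e2)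
  simp only [e]
  refine (congrArg (_ * ·) h).trans ?_
  rw [← mul_assoc]
  congr 1
  have h0 : (n - (s+1)) = n - s - 1 := rfl
  rw [h0, Nat.factorial_succ]
  have h1 : (s.factorial : ℝ) ≠ 0 := by positivity
  have h2 : ((n-s-1).factorial : ℝ) ≠ 0 := by positivity
  have h3 : ((s+1 : ℕ) : ℝ) ≠ 0 := by positivity
  rw [Nat.cast_mul, Nat.cast_mul]
  field_simp

lemma X2_lt {d : ℕ} (A : JetFam n m (d+1)) (p : Jet n m (d+1)) (s : ℕ) (hs : s < n) :
    X2 A p s hs.le = ((s.factorial : ℝ) * ((n-s-1).factorial : ℝ))⁻¹ *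
     ∑ α : Fin s → JIdx n m d, ∑ iv : Fin (n-s-1) → Fin n, ∑ w : Fin s → Fin n, ∑ i : Fin n,
      tp α * EE (by omega : (s+1) + (n-s-1) = n) (Fin.cons i w) iv *
       truncD (t := d) i
          (A s (fun l => (α l).2.1) (fun l => (α l).1) iv) (projJet (Nat.le_succ d) p) *
        yprod α w p := by
  have h := X2_core (by omega : s + (n-s) = n) (by omega) (by omega : (s+1) + (n-s-1) = n)
    (fun (α : Fin s → JIdx n m d) iv => A s (fun l => (α l).2.1) (fun l => (α l).1) iv) p
  unfold X2
  refine (congrArg (_ * ·) h).trans ?_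
  rw [← mul_assoc]
  congr 1
  have h0 : (n - s).factorial = (n-s) * (n - s - 1).factorial :=
    (Nat.mul_factorial_pred (by omega)).symm
  rw [h0]
  have h1 : (s.factorial : ℝ) ≠ 0 := by positivity
  have h2 : ((n-s-1).factorial : ℝ) ≠ 0 := by positivity
  have h3 : ((n-s : ℕ) : ℝ) ≠ 0 := by
    have : n - s ≠ 0 := by omega
    exact_mod_cast this
  rw [Nat.cast_mul, Nat.cast_mul]
  field_simp

lemma LagA_HH {d : ℕ} {W : Set ((Fin n → ℝ) × (Fin m → ℝ))} (hW : IsOpen W)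
    {a : Fam n m d} (ha : Good W a) (p : Jet n m (d+1)) (hp : p ∈ Dset (d+1) W) :
    LagA (Afam a) p = HH a p := by
  rw [LagA_split, Finset.sum_add_distrib]
  rw [Fin.sum_univ_succ, Fin.sum_univ_castSucc (f := fun s : Fin (n+1) => X2 (Afam a) p s _)]
  have z1 : X1 (Afam a) p ((0 : Fin (n+1)) : ℕ) (Nat.lt_succ_iff.1 (0 : Fin (n+1)).isLt) = 0 :=
    X1_zero _ _ _
  have z2 : X2 (Afam a) p ((Fin.last n : Fin (n+1)) : ℕ)
      (Nat.lt_succ_iff.1 (Fin.last n).isLt) = 0 := X2_top _ _ _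
  rw [z1, z2, zero_add, add_zero, ← Finset.sum_add_distrib]
  unfold HH
  rw [Finset.sum_range]
  refine Finset.sum_congr rfl fun s _ => ?_
  have hs : (s:ℕ) < n := s.isLt
  refine (congrArg₂ (· + ·) (X1_succ (Afam a) p s hs) (X2_lt (Afam a) p s hs)).trans ?_
  have hT := T_core (by omega : ((s:ℕ)+1) + (n-s-1) = n) hW ha p hp
  have h2 : ((n-s-1).factorial : ℝ) ≠ 0 := by positivity
  have h1 : ((s:ℕ).factorial : ℝ) ≠ 0 := by positivity
  rw [← mul_add, mul_inv, mul_assoc]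
  congr 1
  rw [inv_mul_eq_iff_eq_mul₀ h2]
  refine Eq.trans ?_ hT
  simp only [← Finset.sum_add_distrib]
  refine Finset.sum_congr rfl fun α _ => ?_
  refine Finset.sum_congr rfl fun iv _ => ?_
  refine Finset.sum_congr rfl fun w _ => ?_
  refine Finset.sum_congr rfl fun i _ => ?_
  have e : Afam a s (fun l => (α l).2.1) (fun l => (α l).1) iv = cP (by omega) a α iv := by
    unfold Afam
    rw [dif_pos ⟨hs, fun l => (α l).2.2⟩]
    rfl
  rw [e, ← trunc_add]
  ring

end Part21

/-- local structure theorem for variationally trivial Lagrangians: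
they are hyper-Jacobian polynomials in the highest-order derivatives. -/
theorem variationally_trivial_local_structure (n m r : ℕ)
    (hn : 1 ≤ n) (hm : 1 ≤ m) (hr : 1 ≤ r)
    (W : Set (((Fin n) → ℝ) × ((Fin m) → ℝ))) (hW : IsOpen W)
    (L : Jet n m r → ℝ) (hL : ContDiffOn ℝ (⊤:ℕ∞) L (Dset r W))
    (htriv : ∀ σ : Fin m, ∀ p ∈ Dset (n := n) (m := m) (2*r) W, EL σ L p = 0) :
    ∀ z ∈ W, ∃ W' : Set (((Fin n) → ℝ) × ((Fin m) → ℝ)),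
      IsOpen W' ∧ z ∈ W' ∧ W' ⊆ W ∧
      ∃ A : JetFam n m r, IsAltSym A ∧
        (∀ s I σs iv, ContDiffOn ℝ (⊤:ℕ∞) (A s I σs iv) (Dset (r-1) W')) ∧
        ∀ p ∈ Dset (n := n) (m := m) r W', L p = LagA A p := by
  intro z hz
  obtain ⟨d, rfl⟩ : ∃ d, r = d+1 := ⟨r-1, by omega⟩
  obtain ⟨ε, hε, hsub, a, ha, hLa⟩ := exists_potential hn hW hL htriv hz
  refine ⟨Metric.ball z ε, Metric.isOpen_ball, Metric.mem_ball_self hε, hsub,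
    Afam (aS a), Afam_alt (aS_alt a), fun s I σs iv => Afam_sm (aS_good ha) s I σs iv, ?_⟩
  intro p hp
  rw [hLa p hp, LagA_HH Metric.isOpen_ball (aS_good ha) p hp, HH_aS Metric.isOpen_ball ha p hp]

end JetVar
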